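/- Let K be a number field with ring of integers O_K. Then there exist elements a, b, c, e ∈ O_K generating four pairwise distinct prime ideals of O_K such that: (1) a ≡ 1 mod 8·O_K and σ(a) > 0 for every real embedding σ : K → ℝ; (2) b ≡ 1 mod 2a·O_K; (3) c ≡ 1 mod 2·O_K and c is not congruent to a square of an element of O_K modulo the prime ideal (a); (4) e is not congruent to a square of an element of O_K modulo the prime ideal (a). -/

import Mathlib

open NumberField

section

open MeasureTheory Set Filter Topology Complex

theorem differentiable_mellin_of_rapid_decay {f : ℝ → ℂ} (hf : LocallyIntegrableOn f (Ioi 0))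
    (hf1 : ∀ t, 1 < t → f t = 0)
    (hf0 : ∀ k : ℕ, ∃ C : ℝ, ∀ t ∈ Ioc (0 : ℝ) 1, ‖f t‖ ≤ C * t ^ k) (s : ℂ) :
    MellinConvergent (fun t ↦ Real.log t • f t) s ∧
      HasDerivAt (mellin f) (mellin (fun t ↦ Real.log t • f t) s) s := by
  obtain ⟨k, hk⟩ := exists_nat_gt (-s.re)
  obtain ⟨C, hC⟩ := hf0 k
  refine mellin_hasDerivAt_of_isBigO_rpow (a := s.re + 1) (b := -k) hf ?_ (by linarith) ?_
    (by linarith)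
  · refine (Asymptotics.isBigO_zero _ _).congr' ?_ EventuallyEq.rfl
    filter_upwards [eventually_gt_atTop 1] with t ht using (hf1 t ht).symm
  · refine Asymptotics.IsBigO.of_bound C ?_
    filter_upwards [Ioc_mem_nhdsGT (zero_lt_one' ℝ)] with t ht
    have := hC t ht
    rwa [neg_neg, Real.rpow_natCast, Real.norm_of_nonneg (pow_nonneg ht.1.le _)]

theorem mellinConvergent_of_rapid_decay {f : ℝ → ℂ} (hf : LocallyIntegrableOn f (Ioi 0))
    (hf1 : ∀ t, 1 < t → f t = 0)
    (hf0 : ∀ k : ℕ, ∃ C : ℝ, ∀ t ∈ Ioc (0 : ℝ) 1, ‖f t‖ ≤ C * t ^ k) (s : ℂ) :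
    MellinConvergent f s := by
  obtain ⟨k, hk⟩ := exists_nat_gt (-s.re)
  obtain ⟨C, hC⟩ := hf0 k
  refine mellinConvergent_of_isBigO_rpow (a := s.re + 1) (b := -k) hf ?_ (by linarith) ?_
    (by linarith)
  · refine (Asymptotics.isBigO_zero _ _).congr' ?_ EventuallyEq.rfl
    filter_upwards [eventually_gt_atTop 1] with t ht using (hf1 t ht).symm
  · refine Asymptotics.IsBigO.of_bound C ?_
    filter_upwards [Ioc_mem_nhdsGT (zero_lt_one' ℝ)] with t ht
    have := hC t ht
    rwa [neg_neg, Real.rpow_natCast, Real.norm_of_nonneg (pow_nonneg ht.1.le _)]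

/-- A smoothing weight: a continuous bump function supported in `[1/4, 1]`. -/
structure IsWeight (w : ℝ → ℝ) : Prop where
  continuous : Continuous w
  nonneg : ∀ u, 0 ≤ w u
  le_of_ne : ∀ u, w u ≠ 0 → 1 / 4 ≤ u ∧ u ≤ 1
  pos : 0 < w (1 / 2)

namespace IsWeight

variable {w : ℝ → ℝ} (hw : IsWeight w)

theorem mellin_real (f : ℝ → ℝ) (x : ℝ) :
    mellin (fun t ↦ (f t : ℂ)) x = ((∫ t in Ioi (0 : ℝ), t ^ (x - 1) * f t : ℝ) : ℂ) := by
  rw [mellin, ← integral_complex_ofReal]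
  refine setIntegral_congr_fun measurableSet_Ioi fun t ht ↦ ?_
  simp [ofReal_cpow (le_of_lt ht)]

include hw

theorem eq_zero_of_lt {u : ℝ} (h : u < 1 / 4) : w u = 0 := by
  by_contra h'; linarith [(hw.le_of_ne u h').1]

theorem eq_zero_of_gt {u : ℝ} (h : 1 < u) : w u = 0 := by
  by_contra h'; linarith [(hw.le_of_ne u h').2]

theorem rapid_decay (n k : ℕ) : ∃ C : ℝ, ∀ t ∈ Ioc (0 : ℝ) 1,
    ‖((Real.log t ^ n * w t : ℝ) : ℂ)‖ ≤ C * t ^ k := by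
  have : ContinuousOn (fun t ↦ (Real.log t ^ n * w t) / t ^ k) (Icc (1 / 4 : ℝ) 1) := by
    refine ContinuousOn.div (ContinuousOn.mul (ContinuousOn.pow (Real.continuousOn_log.mono ?_) _)
      hw.continuous.continuousOn) (by fun_prop) ?_
    · intro t ht h; simp only [mem_singleton_iff] at h; subst h; norm_num at ht
    · intro t ht; exact pow_ne_zero _ (by linarith [ht.1])
  obtain ⟨C, hC⟩ := isCompact_Icc.exists_bound_of_continuousOn this
  refine ⟨max C 0, fun t ht ↦ ?_⟩
  have ht' := pow_pos ht.1 k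
  by_cases h : w t = 0
  · simp only [h, mul_zero, ofReal_zero, norm_zero]; positivity
  · have := hC t (hw.le_of_ne t h)
    rw [norm_div, Real.norm_of_nonneg ht'.le, div_le_iff₀ ht'] at this
    rw [norm_real]
    exact this.trans (by gcongr; exact le_max_left _ _)

theorem locallyIntegrableOn (n : ℕ) :
    LocallyIntegrableOn (fun t ↦ ((Real.log t ^ n * w t : ℝ) : ℂ)) (Ioi 0) := by
  refine ContinuousOn.locallyIntegrableOn ?_ measurableSet_Ioi
  refine continuous_ofReal.comp_continuousOn (ContinuousOn.mul (ContinuousOn.pow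
    (Real.continuousOn_log.mono ?_) _) hw.continuous.continuousOn)
  intro t ht h; simp only [mem_singleton_iff] at h; subst h; simp at ht

theorem hasDerivAt_mellin_log_pow (n : ℕ) (s : ℂ) :
    HasDerivAt (mellin fun t ↦ ((Real.log t ^ n * w t : ℝ) : ℂ))
      (mellin (fun t ↦ ((Real.log t ^ (n + 1) * w t : ℝ) : ℂ)) s) s := by
  convert (differentiable_mellin_of_rapid_decay (hw.locallyIntegrableOn n) ?_
    (fun k ↦ hw.rapid_decay n k) s).2 using 3
  · simp; ring
  · intro t ht; simp [hw.eq_zero_of_gt ht]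

theorem iteratedDeriv_mellin (n : ℕ) :
    iteratedDeriv n (mellin fun t ↦ (w t : ℂ)) =
      mellin (fun t ↦ ((Real.log t ^ n * w t : ℝ) : ℂ)) := by
  induction n with
  | zero => simp
  | succ n ih =>
    rw [iteratedDeriv_succ, ih]
    ext s
    exact (hw.hasDerivAt_mellin_log_pow n s).deriv

theorem differentiable_mellin : Differentiable ℂ (mellin fun t ↦ (w t : ℂ)) := by
  intro s
  simpa using (hw.hasDerivAt_mellin_log_pow 0 s).differentiableAt

theorem mellin_convergent (s : ℂ) : MellinConvergent (fun t ↦ (w t : ℂ)) s := by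
  have := mellinConvergent_of_rapid_decay (hw.locallyIntegrableOn 0) ?_
    (fun k ↦ hw.rapid_decay 0 k) s
  · simpa using this
  · intro t ht; simp [hw.eq_zero_of_gt ht]

theorem mellin_pos (x : ℝ) : ∃ y : ℝ, 0 < y ∧ mellin (fun t ↦ (w t : ℂ)) x = y := by
  refine ⟨_, ?_, mellin_real w x⟩
  have hint : IntegrableOn (fun t : ℝ ↦ t ^ (x - 1) * w t) (Ioi 0) := by
    have h := (hw.mellin_convergent x).re
    refine h.congr ?_
    filter_upwards [ae_restrict_mem measurableSet_Ioi] with t ht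
    rw [← ofReal_one, ← ofReal_sub, ← ofReal_cpow (le_of_lt ht)]
    simp
  have hc : ContinuousOn (fun t : ℝ ↦ t ^ (x - 1) * w t) (Ioi 0) :=
    ContinuousOn.mul (fun t ht ↦ (Real.continuousAt_rpow_const _ _
      (Or.inl (ne_of_gt ht))).continuousWithinAt) hw.continuous.continuousOn
  rw [setIntegral_pos_iff_support_of_nonneg_ae _ hint]
  · have h1 : (1 / 2 : ℝ) ∈ w ⁻¹' Ioi 0 ∩ Ioi 0 := ⟨hw.pos, by norm_num⟩
    have h2 : IsOpen (w ⁻¹' Ioi 0 ∩ Ioi 0) := (isOpen_Ioi.preimage hw.continuous).inter isOpen_Ioi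
    refine (h2.measure_pos volume ⟨_, h1⟩).trans_le (measure_mono ?_)
    rintro t ⟨ht, ht0⟩
    exact ⟨(mul_pos (Real.rpow_pos_of_pos ht0 _) ht).ne', ht0⟩
  · filter_upwards [ae_restrict_mem measurableSet_Ioi] with t ht
    exact mul_nonneg (Real.rpow_nonneg (le_of_lt ht) _) (hw.nonneg t)

open scoped ComplexOrder in
theorem alternating_mellin (n : ℕ) (x : ℝ) :
    0 ≤ (-1) ^ n * iteratedDeriv n (mellin fun t ↦ (w t : ℂ)) x := by
  rw [hw.iteratedDeriv_mellin, mellin_real, show ((-1 : ℂ) ^ n) = (((-1) ^ n : ℝ) : ℂ) by simp,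
    ← ofReal_mul, zero_le_real, ← integral_const_mul]
  refine setIntegral_nonneg measurableSet_Ioi fun t ht ↦ ?_
  by_cases h : w t = 0
  · simp [h]
  rw [show (-1) ^ n * (t ^ (x - 1) * (Real.log t ^ n * w t)) =
    t ^ (x - 1) * ((-Real.log t) ^ n * w t) by rw [neg_pow]; ring]
  have := Real.log_nonpos (le_of_lt ht) (hw.le_of_ne t h).2
  exact mul_nonneg (Real.rpow_nonneg (le_of_lt ht) _) (mul_nonneg (pow_nonneg (by linarith) _) (hw.nonneg t))

/-- The smoothed counting function attached to the coefficients `a`. -/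
theorem continuousOn_smoothed (a : ℕ → ℂ) :
    ContinuousOn (fun t : ℝ ↦ ∑' n : ℕ, a n * (w (t * n) : ℂ)) (Ioi 0) := by
  intro t₀ ht₀
  refine ContinuousAt.continuousWithinAt ?_
  obtain ⟨N, hN⟩ := exists_nat_gt (2 / t₀)
  have : (fun t : ℝ ↦ ∑ n ∈ Finset.range N, a n * (w (t * n) : ℂ)) =ᶠ[𝓝 t₀]
      fun t : ℝ ↦ ∑' n : ℕ, a n * (w (t * n) : ℂ) := by
    filter_upwards [lt_mem_nhds (half_lt_self ht₀)] with t ht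
    rw [tsum_eq_sum]
    intro n hn
    rw [Finset.mem_range, not_lt] at hn
    have : 1 < t * n := by
      have h1 : 2 / t₀ < n := hN.trans_le (by exact_mod_cast hn)
      have h0 : (0 : ℝ) < t₀ := ht₀
      rw [div_lt_iff₀ h0] at h1
      nlinarith [(Nat.cast_nonneg n : (0 : ℝ) ≤ n)]
    simp [hw.eq_zero_of_gt this]
  refine ContinuousAt.congr ?_ this
  have := hw.continuous
  fun_prop

theorem mellin_smoothed (a : ℕ → ℂ) {s : ℂ} (ha : LSeriesSummable a s) :
    mellin (fun t : ℝ ↦ ∑' n : ℕ, a n * (w (t * n) : ℂ)) s =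
      LSeries a s * mellin (fun t ↦ (w t : ℂ)) s := by
  set F : ℕ → ℝ → ℂ := fun n t ↦ (t : ℂ) ^ (s - 1) * (a n * (w (t * n) : ℂ)) with hF
  have hconv (n : ℕ) : MellinConvergent (fun t : ℝ ↦ a n * (w (t * n) : ℂ)) s := by
    refine MellinConvergent.const_smul (E := ℂ) ?_ (a n)
    rcases Nat.eq_zero_or_pos n with rfl | hn
    · simp [hw.eq_zero_of_lt (show (0 : ℝ) < 1 / 4 by norm_num), MellinConvergent]
    · simpa only [mul_comm] using (MellinConvergent.comp_mul_left (f := fun t ↦ (w t : ℂ)) (s := s)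
        (Nat.cast_pos.mpr hn : (0 : ℝ) < n)).mpr (hw.mellin_convergent s)
  have hnorm (n : ℕ) : ∫ t in Ioi (0 : ℝ), ‖F n t‖ =
      ‖LSeries.term a s n‖ * ∫ t in Ioi (0 : ℝ), t ^ (s.re - 1) * w t := by
    rcases Nat.eq_zero_or_pos n with rfl | hn
    · simp [hF, hw.eq_zero_of_lt (show (0 : ℝ) < 1 / 4 by norm_num)]
    have hn' : (0 : ℝ) < n := Nat.cast_pos.mpr hn
    have h1 : ∫ t in Ioi (0 : ℝ), ‖F n t‖ =
        ‖a n‖ * ∫ t in Ioi (0 : ℝ), t ^ (s.re - 1) * w (t * n) := by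
      rw [← integral_const_mul]
      refine setIntegral_congr_fun measurableSet_Ioi fun t ht ↦ ?_
      simp only [hF, norm_mul, norm_cpow_eq_rpow_re_of_pos ht, norm_real,
        Real.norm_of_nonneg (hw.nonneg _)]
      simp; ring
    have h2 : ∫ t in Ioi (0 : ℝ), t ^ (s.re - 1) * w (t * n) =
        (n : ℝ) ^ (-s.re) * ∫ t in Ioi (0 : ℝ), t ^ (s.re - 1) * w t := by
      have := mellin_comp_mul_right (fun t ↦ (w t : ℂ)) (s.re : ℂ) hn'
      beta_reduce at this
      rw [mellin_real (fun t ↦ w (t * n)), mellin_real, ← ofReal_neg, ← ofReal_cpow hn'.le,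
        smul_eq_mul, ← ofReal_mul, ofReal_inj] at this
      exact this
    rw [h1, h2, LSeries.norm_term_eq, if_neg hn.ne', Real.rpow_neg hn'.le]
    ring
  have hint (n : ℕ) : ∫ t in Ioi (0 : ℝ), F n t =
      LSeries.term a s n * mellin (fun t ↦ (w t : ℂ)) s := by
    rcases Nat.eq_zero_or_pos n with rfl | hn
    · simp [hF, hw.eq_zero_of_lt (show (0 : ℝ) < 1 / 4 by norm_num)]
    have hn' : (0 : ℝ) < n := Nat.cast_pos.mpr hn
    have := mellin_comp_mul_right (fun t ↦ (w t : ℂ)) s hn'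
    rw [LSeries.term_of_ne_zero hn.ne', div_eq_mul_inv, ← cpow_neg, mul_assoc]
    simp only [smul_eq_mul, ofReal_natCast] at this
    rw [← this, mellin, ← integral_const_mul]
    refine setIntegral_congr_fun measurableSet_Ioi fun t ht ↦ ?_
    simp only [hF, smul_eq_mul]; ring
  have hsum : Summable fun n ↦ ∫ t in Ioi (0 : ℝ), ‖F n t‖ := by
    simp_rw [hnorm]
    exact ha.norm.mul_right _
  have key := hasSum_integral_of_summable_integral_norm (μ := volume.restrict (Ioi 0))
    (fun n ↦ hconv n) hsum
  have key2 (t : ℝ) : (t : ℂ) ^ (s - 1) • ∑' n : ℕ, a n * (w (t * n) : ℂ) = ∑' n, F n t := by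
    simp only [hF, smul_eq_mul, tsum_mul_left]
  simp_rw [mellin, key2]
  rw [← mellin, LSeries, ← tsum_mul_right, ← tsum_congr hint]
  exact key.tsum_eq.symm

theorem smoothed_eq_zero (a : ℕ → ℂ) {t : ℝ} (ht : 1 < t) :
    ∑' n : ℕ, a n * (w (t * n) : ℂ) = 0 := by
  refine (tsum_congr fun n ↦ ?_).trans tsum_zero
  rcases Nat.eq_zero_or_pos n with rfl | hn
  · simp [hw.eq_zero_of_lt (show (0 : ℝ) < 1 / 4 by norm_num)]
  · have : 1 < t * n := by
      have : (1 : ℝ) ≤ n := by exact_mod_cast hn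
      nlinarith
    simp [hw.eq_zero_of_gt this]

/-- If the smoothed sums of `a` are asymptotic to `κ / t` up to any power of `t`, then the L-series
of `a` times the Mellin transform of the weight is entire up to a simple pole at `1`. -/
theorem exists_entire (a : ℕ → ℂ) (ha : ∀ s : ℂ, 1 < s.re → LSeriesSummable a s) (κ : ℂ)
    (hκ : ∀ k : ℕ, ∃ C : ℝ, ∀ t ∈ Ioc (0 : ℝ) 1,
      ‖∑' n : ℕ, a n * (w (t * n) : ℂ) - κ / t‖ ≤ C * t ^ k) :
    ∃ E : ℂ → ℂ, Differentiable ℂ E ∧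
      ∀ s : ℂ, 1 < s.re → LSeries a s * mellin (fun t ↦ (w t : ℂ)) s = κ / (s - 1) + E s := by
  set S : ℝ → ℂ := fun t ↦ ∑' n : ℕ, a n * (w (t * n) : ℂ) with hS
  set P : ℝ → ℂ := (Ioc 0 1).indicator fun t : ℝ ↦ (t : ℂ) ^ (-1 : ℂ) with hP
  set R : ℝ → ℂ := fun t ↦ S t - κ • P t with hR
  have hPm (s : ℂ) (hs : 1 < s.re) : HasMellin P s (1 / (s + (-1))) :=
    hasMellin_cpow_Ioc (-1) (by simpa using by linarith)
  have hRint : LocallyIntegrableOn R (Ioi 0) := by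
    refine LocallyIntegrableOn.sub ((hw.continuousOn_smoothed a).locallyIntegrableOn
      measurableSet_Ioi) (LocallyIntegrableOn.smul ?_ κ)
    have : LocallyIntegrableOn (fun t : ℝ ↦ (t : ℂ) ^ (-1 : ℂ)) (Ioi 0) := by
      refine ContinuousOn.locallyIntegrableOn (fun t ht ↦ ?_) measurableSet_Ioi
      exact (continuousAt_ofReal_cpow_const _ _ (Or.inr <| ne_of_gt ht)).continuousWithinAt
    intro x hx
    obtain ⟨U, hU, hi⟩ := this x hx
    exact ⟨U, hU, hi.indicator measurableSet_Ioc⟩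
  have hR1 : ∀ t, 1 < t → R t = 0 := by
    intro t ht
    have : t ∉ Ioc (0 : ℝ) 1 := fun h ↦ by linarith [h.2]
    simp [hR, hS, hP, hw.smoothed_eq_zero a ht, this]
  have hR0 : ∀ k : ℕ, ∃ C : ℝ, ∀ t ∈ Ioc (0 : ℝ) 1, ‖R t‖ ≤ C * t ^ k := by
    intro k
    obtain ⟨C, hC⟩ := hκ k
    refine ⟨C, fun t ht ↦ ?_⟩
    convert hC t ht using 2
    simp [hR, hP, ht, cpow_neg_one, div_eq_mul_inv, hS]
  refine ⟨mellin R, fun s ↦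
    (differentiable_mellin_of_rapid_decay hRint hR1 hR0 s).2.differentiableAt, fun s hs ↦ ?_⟩
  rw [← hw.mellin_smoothed a (ha s hs)]
  have h1 := mellinConvergent_of_rapid_decay hRint hR1 hR0 s
  have h2 := hasMellin_const_smul (hPm s hs).1 κ
  have h3 := hasMellin_add h1 h2.1
  have h4 : (fun t ↦ R t + κ • P t) = S := by ext t; simp [hR]
  rw [h4] at h3
  rw [h3.2, h2.2, (hPm s hs).2]
  simp only [smul_eq_mul]
  ring

end IsWeight

end

section

open MeasureTheory Set Filter Topology Complex
open scoped ComplexOrder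

/-- The derivatives of `f` at `c` alternate in sign. -/
def AlternatingAt (f : ℂ → ℂ) (c : ℂ) : Prop :=
  ∀ n, 0 ≤ (-1) ^ n * iteratedDeriv n f c

theorem AlternatingAt.mul {f g : ℂ → ℂ} {c : ℂ} (hf : AlternatingAt f c) (hg : AlternatingAt g c)
    (hf' : AnalyticAt ℂ f c) (hg' : AnalyticAt ℂ g c) : AlternatingAt (f * g) c := by
  intro n
  rw [iteratedDeriv_mul hf'.contDiffAt hg'.contDiffAt, Finset.mul_sum]
  refine Finset.sum_nonneg fun i hi ↦ ?_
  have hi' : i ≤ n := Nat.lt_succ_iff.mp (Finset.mem_range.mp hi)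
  have : (-1 : ℂ) ^ n = (-1) ^ i * (-1) ^ (n - i) := by rw [← pow_add, Nat.add_sub_cancel' hi']
  rw [this, show ((-1 : ℂ) ^ i * (-1) ^ (n - i)) * (↑(n.choose i) * iteratedDeriv i f c *
    iteratedDeriv (n - i) g c) = (n.choose i : ℂ) * (((-1) ^ i * iteratedDeriv i f c) *
    ((-1) ^ (n - i) * iteratedDeriv (n - i) g c)) by ring]
  exact mul_nonneg (Nat.cast_nonneg _) (mul_nonneg (hf i) (hg _))

/-- A form of Landau's lemma: if the Dirichlet series of a nonnegative sequence `r`, multiplied by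
a function `W` with alternating derivatives, is entire, then it converges at `0`. -/
theorem sum_le_of_differentiable {r : ℕ → ℂ} (hr : 0 ≤ r)
    (hs : ∀ s : ℂ, 1 < s.re → LSeriesSummable r s) {W Q : ℂ → ℂ} (hW : Differentiable ℂ W)
    (hWa : AlternatingAt W 2) (hQ : Differentiable ℂ Q)
    (h : ∀ s : ℂ, 1 < s.re → Q s = LSeries r s * W s) (X : ℕ) :
    ∑ n ∈ Finset.Ico 1 X, r n * W 0 ≤ Q 0 := by
  classical
  set r' : ℕ → ℂ := fun n ↦ if n < X then 0 else r n with hr'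
  set r'' : ℕ → ℂ := fun n ↦ if n < X then r n else 0 with hr''
  have hr'0 : 0 ≤ r' := fun n ↦ by
    simp only [hr']; split_ifs
    · exact le_rfl
    · exact hr n
  have hfin (s : ℂ) : LSeries r'' s = ∑ n ∈ Finset.Ico 1 X, LSeries.term r s n := by
    rw [LSeries, tsum_eq_sum (s := Finset.Ico 1 X)]
    · refine Finset.sum_congr rfl fun n hn ↦ ?_
      rw [Finset.mem_Ico] at hn
      simp [LSeries.term_def, hr'', hn.2]
    · intro n hn
      rw [Finset.mem_Ico, not_and_or, not_le, not_lt] at hn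
      rcases hn with hn | hn
      · simp [show n = 0 by omega]
      · simp [LSeries.term_def, hr'', hn]
  have hfs (s : ℂ) : LSeriesSummable r'' s := by
    refine summable_of_hasFiniteSupport ((finite_lt_nat X).subset fun n hn ↦ ?_)
    by_contra h
    simp only [mem_setOf_eq] at h
    apply hn
    simp [LSeries.term_def, hr'', h]
  have hsplit : r = r' + r'' := by
    ext n; simp only [hr', hr'', Pi.add_apply]; split_ifs <;> simp
  have hr's (s : ℂ) (h1 : 1 < s.re) : LSeriesSummable r' s := by
    have : r' = r - r'' := by rw [hsplit]; simp
    rw [this]; exact (hs s h1).sub (hfs s)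
  set f : ℂ → ℂ := fun s ↦ Q s - (∑ n ∈ Finset.Ico 1 X, LSeries.term r s n) * W s with hf
  have hfd : Differentiable ℂ f := by
    refine hQ.sub (Differentiable.mul (Differentiable.fun_sum fun n hn ↦ ?_) hW)
    exact fun s ↦ (LSeries.hasDerivAt_term r n s).differentiableAt
  have hfeq : {s : ℂ | 1 < s.re}.EqOn f (LSeries r' * W) := by
    intro s h1
    simp only [hf, h s h1, Pi.mul_apply]
    rw [← hfin, hsplit, LSeries_add (hr's s h1) (hfs s)]
    ring
  have hopen : IsOpen {s : ℂ | 1 < s.re} := continuous_re.isOpen_preimage _ isOpen_Ioi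
  have habs : LSeries.abscissaOfAbsConv r' ≤ 1 := by
    refine LSeries.abscissaOfAbsConv_le_of_forall_lt_LSeriesSummable fun y hy ↦ hr's y ?_
    simpa using hy
  have habs2 : LSeries.abscissaOfAbsConv r' < (2 : ℝ) :=
    habs.trans_lt (by exact_mod_cast one_lt_two)
  have halt : AlternatingAt f 2 := by
    intro n
    rw [hfeq.iteratedDeriv_of_isOpen hopen n (by simp)]
    refine AlternatingAt.mul (fun n ↦ ?_) hWa ?_ (hW.analyticAt _) n
    · exact_mod_cast LSeries.iteratedDeriv_alternating hr'0 habs2 n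
    · exact LSeries_analyticOnNhd r' 2 (by simpa using habs2)
  have h1 : f 2 ≤ f 0 := hfd.apply_le_of_iteratedDeriv_alternating (fun n _ ↦ halt n)
    (by norm_num)
  have h2 : 0 ≤ f 2 := by simpa using halt 0
  have h3 := h2.trans h1
  simp only [hf, sub_nonneg] at h3
  convert h3 using 1
  rw [Finset.sum_mul]
  refine Finset.sum_congr rfl fun n hn ↦ ?_
  rw [Finset.mem_Ico] at hn
  simp [LSeries.term_of_ne_zero (show n ≠ 0 by omega)]

end

section

open MeasureTheory Set Filter Topology Complex NumberField
open scoped ComplexOrder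

section IdealSeries

variable (K : Type*) [Field K] [NumberField K]

/-- The finite set of ideals of norm `n`. -/
noncomputable def normFiber (n : ℕ) : Finset (Ideal (𝓞 K)) :=
  (Ideal.finite_setOfPred_absNorm_eq n).toFinset

variable {K}

@[simp] theorem mem_normFiber {n : ℕ} {I : Ideal (𝓞 K)} :
    I ∈ normFiber K n ↔ Ideal.absNorm I = n := by
  simp [normFiber]

variable (K) in
open Classical in
/-- The finite set of pairs `(P, k)` with `P` prime and `P ^ (k + 1)` of norm `n`. -/
noncomputable def primePowFiber (n : ℕ) : Finset (Ideal (𝓞 K) × ℕ) :=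
  ((Ideal.finite_setOfPred_absNorm_le (S := 𝓞 K) n).toFinset ×ˢ Finset.range n).filter
    fun x ↦ Prime x.1 ∧ Ideal.absNorm x.1 ^ (x.2 + 1) = n

theorem two_le_absNorm_of_prime {P : Ideal (𝓞 K)} (hP : Prime P) : 2 ≤ Ideal.absNorm P := by
  have h0 : Ideal.absNorm P ≠ 0 := by
    rw [Ne, Ideal.absNorm_eq_zero_iff]; exact hP.ne_zero
  have h1 : Ideal.absNorm P ≠ 1 := by
    rw [Ne, Ideal.absNorm_eq_one_iff]
    rintro rfl
    exact hP.not_isUnit (by rw [← Ideal.one_eq_top]; exact isUnit_one)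
  omega

theorem mem_primePowFiber {n : ℕ} {x : Ideal (𝓞 K) × ℕ} :
    x ∈ primePowFiber K n ↔ Prime x.1 ∧ Ideal.absNorm x.1 ^ (x.2 + 1) = n := by
  simp only [primePowFiber, Finset.mem_filter, Finset.mem_product, Finite.mem_toFinset,
    Finset.mem_range, and_iff_right_iff_imp]
  rintro ⟨h1, rfl⟩
  have h2 := two_le_absNorm_of_prime h1
  refine ⟨?_, ?_⟩
  · show Ideal.absNorm x.1 ≤ _
    exact Nat.le_self_pow (by omega) _
  · exact (Nat.lt_succ_self _).trans (Nat.lt_pow_self h2)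

/-- The Dirichlet coefficients of a function on ideals. -/
noncomputable def idealCoeff (ψ : Ideal (𝓞 K) → ℂ) : ArithmeticFunction ℂ :=
  ⟨fun n ↦ if n = 0 then 0 else ∑ I ∈ normFiber K n, ψ I, by simp⟩

theorem idealCoeff_apply (ψ : Ideal (𝓞 K) → ℂ) {n : ℕ} (hn : n ≠ 0) :
    idealCoeff ψ n = ∑ I ∈ normFiber K n, ψ I := by
  simp [idealCoeff, hn]

/-- The coefficients of the logarithmic derivative of the Dirichlet series attached to `ψ`. -/
noncomputable def primePowCoeff (ψ : Ideal (𝓞 K) → ℂ) : ArithmeticFunction ℂ :=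
  ⟨fun n ↦ if n = 0 then 0 else
    ∑ x ∈ primePowFiber K n, ψ (x.1 ^ (x.2 + 1)) * Real.log (Ideal.absNorm x.1), by simp⟩

theorem primePowCoeff_apply (ψ : Ideal (𝓞 K) → ℂ) {n : ℕ} (hn : n ≠ 0) :
    primePowCoeff ψ n =
      ∑ x ∈ primePowFiber K n, ψ (x.1 ^ (x.2 + 1)) * Real.log (Ideal.absNorm x.1) := by
  simp [primePowCoeff, hn]

theorem sum_log_absNorm {A : Ideal (𝓞 K)} (hA : A ≠ 0) (T : Finset (Ideal (𝓞 K) × ℕ))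
    (hT : ∀ x, x ∈ T ↔ Prime x.1 ∧ x.1 ^ (x.2 + 1) ∣ A) :
    ∑ x ∈ T, Real.log (Ideal.absNorm x.1) = Real.log (Ideal.absNorm A) := by
  classical
  set s := UniqueFactorizationMonoid.normalizedFactors A with hs
  have hsP : ∀ P ∈ s, Prime P := fun P hP ↦
    UniqueFactorizationMonoid.prime_of_normalized_factor P hP
  have hcount : ∀ P k, Prime P → (P ^ (k + 1) ∣ A ↔ k < s.count P) := by
    intro P k hP
    rw [pow_dvd_iff_le_emultiplicity,
      UniqueFactorizationMonoid.emultiplicity_eq_count_normalizedFactors hP.irreducible hA,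
      normalize_eq, Nat.cast_le, Nat.succ_le_iff]
  have h1 : ∑ x ∈ T, Real.log (Ideal.absNorm x.1) =
      ∑ x ∈ s.toFinset.sigma fun P ↦ Finset.range (s.count P), Real.log (Ideal.absNorm x.1) := by
    refine Finset.sum_nbij' (fun x ↦ ⟨x.1, x.2⟩) (fun x ↦ (x.1, x.2)) ?_ ?_ ?_ ?_ ?_
    · intro x hx
      obtain ⟨h1, h2⟩ := (hT x).1 hx
      rw [hcount _ _ h1] at h2
      simp only [Finset.mem_sigma, Multiset.mem_toFinset, Finset.mem_range]
      exact ⟨Multiset.count_pos.1 (by omega), h2⟩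
    · intro x hx
      simp only [Finset.mem_sigma, Multiset.mem_toFinset, Finset.mem_range] at hx
      have := hsP _ hx.1
      exact (hT _).2 ⟨this, (hcount _ _ this).2 hx.2⟩
    · intro x _; rfl
    · intro x _; rfl
    · intro x _; rfl
  rw [h1, Finset.sum_sigma]
  simp only [Finset.sum_const, Finset.card_range]
  rw [← Finset.sum_multiset_map_count]
  have hprod : s.prod = A :=
    associated_iff_eq.1 (UniqueFactorizationMonoid.prod_normalizedFactors hA)
  have hN : ∀ t : Multiset (Ideal (𝓞 K)), (∀ P ∈ t, P ≠ 0) →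
      (t.map fun P ↦ Real.log (Ideal.absNorm P)).sum = Real.log (Ideal.absNorm t.prod) := by
    intro t
    induction t using Multiset.induction_on with
    | empty => simp
    | cons P t ih =>
      intro h
      rw [Multiset.map_cons, Multiset.sum_cons, ih fun Q hQ ↦ h Q (Multiset.mem_cons_of_mem hQ),
        Multiset.prod_cons, map_mul, Nat.cast_mul, Real.log_mul]
      · simpa [Ideal.absNorm_eq_zero_iff] using h P (Multiset.mem_cons_self _ _)
      · have : t.prod ≠ 0 := Multiset.prod_ne_zero fun h0 ↦
          h 0 (Multiset.mem_cons_of_mem h0) rfl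
        simpa [Ideal.absNorm_eq_zero_iff] using this
  rw [hN s fun P hP ↦ (hsP P hP).ne_zero, hprod]

theorem idealCoeff_mul_log (ψ : Ideal (𝓞 K) →*₀ ℂ) (n : ℕ) :
    idealCoeff ψ n * Real.log n = (idealCoeff ψ * primePowCoeff ψ) n := by
  classical
  rcases eq_or_ne n 0 with rfl | hn
  · simp
  let S : Finset ((Ideal (𝓞 K)) × (Ideal (𝓞 K) × ℕ)) :=
    n.divisorsAntidiagonal.biUnion fun d ↦ normFiber K d.1 ×ˢ primePowFiber K d.2
  have hS : ∀ y, y ∈ S ↔ Prime y.2.1 ∧ Ideal.absNorm (y.1 * y.2.1 ^ (y.2.2 + 1)) = n := by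
    intro y
    simp only [S, Finset.mem_biUnion, Nat.mem_divisorsAntidiagonal, Finset.mem_product,
      mem_normFiber, mem_primePowFiber, map_mul, map_pow]
    constructor
    · rintro ⟨d, ⟨h1, -⟩, h2, h3, h4⟩
      exact ⟨h3, by rw [h2, h4, h1]⟩
    · rintro ⟨h1, h2⟩
      exact ⟨(_, _), ⟨h2, hn⟩, rfl, h1, rfl⟩
  have hR : (idealCoeff ψ * primePowCoeff ψ) n =
      ∑ y ∈ S, ψ (y.1 * y.2.1 ^ (y.2.2 + 1)) * Real.log (Ideal.absNorm y.2.1) := by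
    rw [Finset.sum_biUnion, ArithmeticFunction.mul_apply]
    · refine Finset.sum_congr rfl fun d hd ↦ ?_
      obtain ⟨h1, -⟩ := Nat.mem_divisorsAntidiagonal.1 hd
      rw [idealCoeff_apply _ (by rintro h; simp [h] at h1; omega),
        primePowCoeff_apply _ (by rintro h; simp [h] at h1; omega), Finset.sum_product,
        Finset.sum_mul_sum]
      refine Finset.sum_congr rfl fun I _ ↦ Finset.sum_congr rfl fun x _ ↦ ?_
      rw [map_mul]; ring
    · intro d _ d' _ hdd
      refine Finset.disjoint_left.2 fun y h1 h2 ↦ hdd ?_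
      simp only [Finset.mem_product, mem_normFiber, mem_primePowFiber] at h1 h2
      exact Prod.ext (h1.1.symm.trans h2.1) (h1.2.2.symm.trans h2.2.2)
  rw [hR, idealCoeff_apply _ hn, Finset.sum_mul,
    ← Finset.sum_fiberwise_of_maps_to (s := S) (t := normFiber K n)
      (g := fun y ↦ y.1 * y.2.1 ^ (y.2.2 + 1)) fun y hy ↦ mem_normFiber.2 ((hS y).1 hy).2]
  refine Finset.sum_congr rfl fun A hA ↦ ?_
  rw [mem_normFiber] at hA
  have hA0 : A ≠ 0 := by rintro rfl; simp at hA; exact hn hA.symm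
  rw [← hA, ← sum_log_absNorm hA0 ((S.filter fun y ↦ y.1 * y.2.1 ^ (y.2.2 + 1) = A).image
    fun y ↦ y.2), Finset.sum_image]
  · push_cast
    rw [Finset.mul_sum]
    refine Finset.sum_congr rfl fun y hy ↦ ?_
    rw [(Finset.mem_filter.1 hy).2]
  · intro y hy z hz hyz
    have h1 := (Finset.mem_filter.1 hy)
    have h2 := (Finset.mem_filter.1 hz)
    refine Prod.ext ?_ hyz
    have h3 := h1.2.trans h2.2.symm
    simp only at hyz
    rw [← hyz] at h3
    exact mul_right_cancel₀ (pow_ne_zero _ ((hS y).1 h1.1).1.ne_zero) h3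
  · intro x
    simp only [Finset.mem_image, Finset.mem_filter, hS]
    constructor
    · rintro ⟨y, ⟨⟨h1, h2⟩, h3⟩, rfl⟩
      exact ⟨h1, Dvd.intro_left _ h3⟩
    · rintro ⟨h1, B, hB⟩
      refine ⟨(B, x), ⟨⟨h1, ?_⟩, ?_⟩, rfl⟩
      · dsimp only; rw [mul_comm, ← hB, hA]
      · dsimp only; rw [mul_comm, ← hB]

theorem summable_card_normFiber {s : ℂ} (hs : 1 < s.re) :
    LSeriesSummable (fun n ↦ ((normFiber K n).card : ℂ)) s := by
  have h := Ideal.tendsto_norm_le_div_atTop₀ K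
  have h2 : (fun n : ℕ ↦ ∑ k ∈ Finset.Icc 1 n, ((normFiber K k).card : ℝ)) =O[atTop]
      fun n ↦ (n : ℝ) ^ (1 : ℝ) := by
    have h3 := ((h.comp tendsto_natCast_atTop_atTop).isBigO_one ℝ).mul
      (Asymptotics.isBigO_refl (fun n : ℕ ↦ (n : ℝ)) atTop)
    refine Asymptotics.IsBigO.congr' h3 ?_ ?_
    · filter_upwards [eventually_ne_atTop 0] with n hn
      rw [Function.comp_apply, div_mul_cancel₀ _ (by exact_mod_cast hn)]
      simp only [Nat.cast_le, ← Nat.cast_sum]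
      congr
      rw [← add_left_inj 1, ← Ideal.card_norm_le_eq_card_norm_le_add_one,
        show Finset.Icc 1 n = Finset.Ioc 0 n from Finset.Icc_succ_left_eq_Ioc _ _,
        show 1 = (normFiber K 0).card by
          rw [eq_comm, Finset.card_eq_one]; refine ⟨⊥, ?_⟩; ext; simp [Ideal.absNorm_eq_zero_iff],
        Finset.sum_Ioc_add_eq_sum_Icc (f := fun k ↦ (normFiber K k).card) (n.zero_le)]
      rw [← Finset.card_biUnion]
      · refine Nat.subtype_card _ fun I ↦ ?_
        simp
      · intro a _ b _ hab
        refine Finset.disjoint_left.2 fun I h1 h2 ↦ hab ?_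
        rw [mem_normFiber] at h1 h2
        exact h1.symm.trans h2
    · filter_upwards with n
      simp
  exact LSeriesSummable_of_sum_norm_bigO_and_nonneg h2 (fun _ ↦ by positivity) zero_le_one hs

end IdealSeries

end

section

open MeasureTheory Set Filter Topology Complex NumberField
open scoped ComplexOrder ComplexConjugate

section Nonvanishing

variable {K : Type*} [Field K] [NumberField K]

theorem LSeriesSummable.of_norm_le {f g : ℕ → ℂ} {s : ℂ} (hg : LSeriesSummable g s)
    (h : ∀ n, n ≠ 0 → ‖f n‖ ≤ ‖g n‖) : LSeriesSummable f s := by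
  refine Summable.of_norm_bounded hg.norm fun n ↦ ?_
  rcases eq_or_ne n 0 with rfl | hn
  · simp
  · exact LSeries.norm_term_le s (h n hn)

theorem norm_idealCoeff_le {ψ : Ideal (𝓞 K) → ℂ} (hψ : ∀ I, ‖ψ I‖ ≤ 1) (n : ℕ) :
    ‖idealCoeff ψ n‖ ≤ ‖((normFiber K n).card : ℂ)‖ := by
  rcases eq_or_ne n 0 with rfl | hn
  · simp
  rw [idealCoeff_apply _ hn]
  refine (norm_sum_le_of_le _ fun I _ ↦ hψ I).trans ?_
  simp

theorem summable_idealCoeff {ψ : Ideal (𝓞 K) → ℂ} (hψ : ∀ I, ‖ψ I‖ ≤ 1) {s : ℂ} (hs : 1 < s.re) :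
    LSeriesSummable (fun n ↦ idealCoeff ψ n) s :=
  (summable_card_normFiber (K := K) hs).of_norm_le fun n _ ↦ norm_idealCoeff_le hψ n

theorem abscissa_idealCoeff_lt {ψ : Ideal (𝓞 K) → ℂ} (hψ : ∀ I, ‖ψ I‖ ≤ 1) {s : ℂ}
    (hs : 1 < s.re) : LSeries.abscissaOfAbsConv (fun n ↦ idealCoeff ψ n) < s.re :=
  (LSeries.abscissaOfAbsConv_le_of_forall_lt_LSeriesSummable (x := 1) fun y hy ↦
    summable_idealCoeff hψ (by simpa using hy)).trans_lt (by exact_mod_cast hs)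

theorem normFiber_one : normFiber K 1 = {1} := by
  ext I; simp [Ideal.absNorm_eq_one_iff, Ideal.one_eq_top]

theorem idealCoeff_one (ψ : Ideal (𝓞 K) →*₀ ℂ) : idealCoeff ψ 1 = 1 := by
  rw [idealCoeff_apply _ one_ne_zero, normFiber_one, Finset.sum_singleton, map_one]

variable (K) in
open Classical in
/-- The trivial character on ideals. -/
noncomputable def trivialIdealChar : Ideal (𝓞 K) →*₀ ℂ where
  toFun I := if I = ⊥ then 0 else 1
  map_zero' := by simp
  map_one' := by rw [if_neg]; exact one_ne_zero
  map_mul' I J := by by_cases hI : I = ⊥ <;> by_cases hJ : J = ⊥ <;> simp [hI, hJ]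

theorem primePowCoeff_nonneg {ψ : Ideal (𝓞 K) → ℂ} (hψ : ∀ I, 0 ≤ ψ I) (n : ℕ) :
    0 ≤ primePowCoeff ψ n := by
  rcases eq_or_ne n 0 with rfl | hn
  · simp
  rw [primePowCoeff_apply _ hn]
  exact Finset.sum_nonneg fun x _ ↦ mul_nonneg (hψ _)
    (Complex.zero_le_real.2 (Real.log_natCast_nonneg _))

/-- If `f` has logarithmic derivative `M ≥ 0` and `f 1 = 1` then `f ≥ 0` and `M ≤ f · log`. -/
theorem nonneg_of_logDeriv_nonneg {f M : ArithmeticFunction ℂ} (h1 : f 1 = 1)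
    (hM : ∀ n, 0 ≤ M n) (h : ∀ n, f n * Real.log n = (f * M) n) (n : ℕ) :
    0 ≤ f n ∧ M n ≤ f n * Real.log n := by
  induction n using Nat.strong_induction_on with
  | _ n ih =>
  rcases Nat.lt_or_ge n 2 with hn | hn
  · interval_cases n
    · simp
    · have := h 1
      simp [h1] at this
      simp [h1, ← this]
  have key : M n ≤ f n * Real.log n := by
    rw [h, ArithmeticFunction.mul_apply]
    have hmem : (1, n) ∈ n.divisorsAntidiagonal := by simp; omega
    rw [← Finset.add_sum_erase _ _ hmem]
    simp only [h1, one_mul, le_add_iff_nonneg_right]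
    refine Finset.sum_nonneg fun d hd ↦ ?_
    obtain ⟨hd1, hd2⟩ := Finset.mem_erase.1 hd
    obtain ⟨hd3, hd4⟩ := Nat.mem_divisorsAntidiagonal.1 hd2
    rcases (Nat.le_of_dvd (by omega) (Dvd.intro _ hd3)).lt_or_eq with hlt | heq
    · exact mul_nonneg (ih _ hlt).1 (hM _)
    · have hd5 : d.2 = 1 := by
        rw [heq] at hd3
        exact Nat.eq_of_mul_eq_mul_left (by omega : 0 < n) (by omega)
      have hM1 : M 1 = 0 := by
        have := h 1
        simp [h1] at this
        exact this.symm
      rw [hd5, hM1, mul_zero]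
  refine ⟨?_, key⟩
  have hlog : 0 < Real.log n := Real.log_pos (by exact_mod_cast hn)
  have : f n = (f n * Real.log n) * ((Real.log n)⁻¹ : ℝ) := by
    rw [mul_assoc, ← ofReal_mul, mul_inv_cancel₀ hlog.ne']; simp
  rw [this]
  exact mul_nonneg ((hM n).trans key) (Complex.zero_le_real.2 (by positivity))

theorem mul_log_of_logDeriv {f g M N : ArithmeticFunction ℂ}
    (hf : ∀ n, f n * Real.log n = (f * M) n) (hg : ∀ n, g n * Real.log n = (g * N) n) (n : ℕ) :
    (f * g) n * Real.log n = (f * g * (M + N)) n := by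
  have h : (f * g) * (M + N) = (f * M) * g + f * (g * N) := by ring
  rw [h, ArithmeticFunction.add_apply, ArithmeticFunction.mul_apply (f := f * M),
    ArithmeticFunction.mul_apply (g := g * N), ArithmeticFunction.mul_apply, Finset.sum_mul,
    ← Finset.sum_add_distrib]
  refine Finset.sum_congr rfl fun d hd ↦ ?_
  obtain ⟨h1, h2⟩ := Nat.mem_divisorsAntidiagonal.1 hd
  rw [← hf, ← hg, ← h1, Nat.cast_mul, Real.log_mul]
  · push_cast; ring
  · rintro h0; simp at h0; simp [h0] at h1; omega
  · rintro h0; simp at h0; simp [h0] at h1; omega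

theorem norm_primePowCoeff_le {ψ : Ideal (𝓞 K) → ℂ} (hψ : ∀ I, ‖ψ I‖ ≤ 1) (n : ℕ) :
    ‖primePowCoeff ψ n‖ ≤ ‖primePowCoeff (trivialIdealChar K) n‖ := by
  rcases eq_or_ne n 0 with rfl | hn
  · simp
  have h : primePowCoeff (trivialIdealChar K) n =
      ((∑ x ∈ primePowFiber K n, Real.log (Ideal.absNorm x.1) : ℝ) : ℂ) := by
    rw [primePowCoeff_apply _ hn, ofReal_sum]
    refine Finset.sum_congr rfl fun x hx ↦ ?_
    have h1 := pow_ne_zero (x.2 + 1) (mem_primePowFiber.1 hx).1.ne_zero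
    have h2 : trivialIdealChar K (x.1 ^ (x.2 + 1)) = 1 := if_neg h1
    rw [h2, one_mul]
  rw [h, Complex.norm_real, Real.norm_of_nonneg (Finset.sum_nonneg fun _ _ ↦
    Real.log_natCast_nonneg _), primePowCoeff_apply _ hn]
  refine norm_sum_le_of_le _ fun x _ ↦ ?_
  rw [norm_mul, Complex.norm_real, Real.norm_of_nonneg (Real.log_natCast_nonneg _)]
  exact mul_le_of_le_one_left (Real.log_natCast_nonneg _) (hψ _)

theorem trivialIdealChar_nonneg {F : Type*} [Field F] (I : Ideal (𝓞 F)) :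
    0 ≤ trivialIdealChar F I := by
  simp only [trivialIdealChar, MonoidWithZeroHom.coe_mk, ZeroHom.coe_mk]
  split_ifs <;> simp

theorem norm_trivialIdealChar_le {F : Type*} [Field F] (I : Ideal (𝓞 F)) :
    ‖trivialIdealChar F I‖ ≤ 1 := by
  simp only [trivialIdealChar, MonoidWithZeroHom.coe_mk, ZeroHom.coe_mk]
  split_ifs <;> simp

theorem summable_primePowCoeff {ψ : Ideal (𝓞 K) → ℂ} (hψ : ∀ I, ‖ψ I‖ ≤ 1) {s : ℂ}
    (hs : 1 < s.re) : LSeriesSummable (fun n ↦ primePowCoeff ψ n) s := by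
  have h0 := LSeriesSummable_logMul_of_lt_re
    (abscissa_idealCoeff_lt (K := K) norm_trivialIdealChar_le hs)
  refine h0.of_norm_le fun n hn ↦ (norm_primePowCoeff_le hψ n).trans ?_
  have h1 := (nonneg_of_logDeriv_nonneg (idealCoeff_one (trivialIdealChar K))
    (primePowCoeff_nonneg trivialIdealChar_nonneg) (idealCoeff_mul_log (trivialIdealChar K)) n).2
  rw [LSeries.logMul, ← Complex.natCast_log, mul_comm]
  have h2 := primePowCoeff_nonneg (K := K) trivialIdealChar_nonneg n
  have h3 : ∀ z : ℂ, 0 ≤ z → z = (‖z‖ : ℝ) := fun z hz ↦ (RCLike.norm_of_nonneg' (K := ℂ) hz).symm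
  have h4 := h2.trans h1
  rw [h3 _ h2, h3 _ h4] at h1
  exact Complex.real_le_real.1 h1

theorem deriv_LSeries_idealCoeff {ψ : Ideal (𝓞 K) →*₀ ℂ} (hψ : ∀ I, ‖ψ I‖ ≤ 1) {s : ℂ}
    (hs : 1 < s.re) : deriv (LSeries fun n ↦ idealCoeff ψ n) s =
      -(LSeries (fun n ↦ idealCoeff ψ n) s * LSeries (fun n ↦ primePowCoeff ψ n) s) := by
  rw [LSeries_deriv (abscissa_idealCoeff_lt hψ hs), ← ArithmeticFunction.LSeries_mul'
    (summable_idealCoeff hψ hs) (summable_primePowCoeff hψ hs)]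
  congr 1
  refine LSeries_congr (fun {n} _ ↦ ?_) s
  rw [← idealCoeff_mul_log, LSeries.logMul, Complex.natCast_log, mul_comm]

end Nonvanishing

end

section

open MeasureTheory Set Filter Topology Complex NumberField
open scoped ComplexOrder ComplexConjugate
set_option linter.unusedSectionVars false

section Nonvanishing

variable {K : Type*} [Field K] [NumberField K] {G : Type*} [CommGroup G] [Finite G]

/-- The extension by zero of a character of `G`. -/
noncomputable def charExt {G : Type*} [CommGroup G] (χ : AddChar (Additive G) ℂ) :
    WithZero G →*₀ ℂ where
  toFun x := x.recZeroCoe 0 fun g ↦ χ (Additive.ofMul g)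
  map_zero' := rfl
  map_one' := by
    show χ (Additive.ofMul 1) = 1
    simp
  map_mul' x y := by
    induction x using WithZero.recZeroCoe with
    | zero => rw [zero_mul]; exact (zero_mul _).symm
    | coe g =>
      induction y using WithZero.recZeroCoe with
      | zero => rw [mul_zero]; exact (mul_zero _).symm
      | coe h =>
        rw [← WithZero.coe_mul]
        show χ (Additive.ofMul (g * h)) = χ (Additive.ofMul g) * χ (Additive.ofMul h)
        rw [ofMul_mul, AddChar.map_add_eq_mul]

/-- The character of ideals attached to a character of a class group. -/
noncomputable def charTwist (cl : Ideal (𝓞 K) →*₀ WithZero G) (χ : AddChar (Additive G) ℂ) :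
    Ideal (𝓞 K) →*₀ ℂ :=
  (charExt χ).comp cl

theorem withZero_cases {G : Type*} (x : WithZero G) : x = 0 ∨ ∃ g : G, x = g := by
  induction x using WithZero.recZeroCoe with
  | zero => exact Or.inl rfl
  | coe g => exact Or.inr ⟨g, rfl⟩

variable (cl : Ideal (𝓞 K) →*₀ WithZero G)

theorem charTwist_of_zero (χ : AddChar (Additive G) ℂ) {I : Ideal (𝓞 K)} (h : cl I = 0) :
    charTwist cl χ I = 0 := by
  show charExt χ (cl I) = 0
  rw [h, map_zero]

theorem charTwist_of_coe (χ : AddChar (Additive G) ℂ) {I : Ideal (𝓞 K)} {g : G} (h : cl I = g) :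
    charTwist cl χ I = χ (Additive.ofMul g) := by
  show charExt χ (cl I) = _
  rw [h]; rfl

theorem norm_charTwist_le (χ : AddChar (Additive G) ℂ) (I : Ideal (𝓞 K)) :
    ‖charTwist cl χ I‖ ≤ 1 := by
  obtain h | ⟨g, h⟩ := withZero_cases (cl I)
  · simp [charTwist_of_zero cl χ h]
  · simp [charTwist_of_coe cl χ h]

theorem charTwist_neg (χ : AddChar (Additive G) ℂ) (I : Ideal (𝓞 K)) :
    charTwist cl (-χ) I = conj (charTwist cl χ I) := by
  obtain h | ⟨g, h⟩ := withZero_cases (cl I)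
  · simp [charTwist_of_zero cl _ h]
  · rw [charTwist_of_coe cl _ h, charTwist_of_coe cl _ h, ← AddChar.map_neg_eq_conj,
      AddChar.neg_apply]

theorem idealCoeff_conj (ψ : Ideal (𝓞 K) → ℂ) (n : ℕ) :
    idealCoeff (fun I ↦ conj (ψ I)) n = conj (idealCoeff ψ n) := by
  rcases eq_or_ne n 0 with rfl | hn
  · simp
  · simp [idealCoeff_apply _ hn]

theorem LSeries_conj (f : ℕ → ℂ) (x : ℝ) :
    LSeries (fun n ↦ conj (f n)) x = conj (LSeries f x) := by
  rw [LSeries, LSeries, Complex.conj_tsum]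
  refine tsum_congr fun n ↦ ?_
  rcases eq_or_ne n 0 with rfl | hn
  · simp
  · rw [LSeries.term_of_ne_zero hn, LSeries.term_of_ne_zero hn, map_div₀, ← ofReal_natCast,
      ← ofReal_cpow n.cast_nonneg, conj_ofReal]

open Classical in
/-- The number of ideals of norm `n` in the class `g`. -/
noncomputable def classCount (g : G) (n : ℕ) : ℕ :=
  ((normFiber K n).filter fun I ↦ cl I = g).card

/-- Smoothed equidistribution of ideals among the classes. -/
def SmoothedEquidistribution (w : ℝ → ℝ) (κ : ℝ) : Prop :=
  ∀ (g : G) (k : ℕ), ∃ C : ℝ, ∀ t ∈ Ioc (0 : ℝ) 1,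
    |∑' n : ℕ, classCount cl g n * w (t * n) - κ / t| ≤ C * t ^ k

theorem idealCoeff_charTwist [Fintype G] (χ : AddChar (Additive G) ℂ) {n : ℕ} (hn : n ≠ 0) :
    idealCoeff (charTwist cl χ) n = ∑ g : G, χ (Additive.ofMul g) * classCount cl g n := by
  classical
  rw [idealCoeff_apply _ hn]
  have h1 : ∀ I, charTwist cl χ I =
      ∑ g : G, χ (Additive.ofMul g) * if cl I = (g : WithZero G) then 1 else 0 := by
    intro I
    obtain h | ⟨g, h⟩ := withZero_cases (cl I)
    · simp [charTwist_of_zero cl _ h, h]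
    · rw [charTwist_of_coe cl _ h]
      simp [h, WithZero.coe_inj]
  simp_rw [h1]
  rw [Finset.sum_comm]
  refine Finset.sum_congr rfl fun g _ ↦ ?_
  rw [← Finset.mul_sum, classCount, Finset.sum_boole]

variable {w : ℝ → ℝ} (hw : IsWeight w) {κ : ℝ} (hκ : 0 < κ)
  (H : SmoothedEquidistribution cl w κ)

include hw in
theorem summable_smoothed (a : ℕ → ℝ) {t : ℝ} (ht : 0 < t) : Summable fun n : ℕ ↦ a n * w (t * n) := by
  refine summable_of_hasFiniteSupport ((Set.finite_Iic ⌊t⁻¹⌋₊).subset fun n hn ↦ ?_)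
  have h1 : w (t * n) ≠ 0 := fun h ↦ hn (by simp [h])
  have h2 := (hw.le_of_ne _ h1).2
  refine Nat.le_floor ?_
  rw [← one_div, le_div_iff₀ ht]
  linarith

include hw H in
theorem smoothed_charTwist (χ : AddChar (Additive G) ℂ) (k : ℕ) : ∃ C : ℝ,
    ∀ t ∈ Ioc (0 : ℝ) 1, ‖∑' n : ℕ, idealCoeff (charTwist cl χ) n * (w (t * n) : ℂ) -
      (if χ = 0 then (κ * Nat.card G : ℂ) else 0) / t‖ ≤ C * t ^ k := by
  classical
  have := Fintype.ofFinite G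
  choose C hC using fun g ↦ H g k
  refine ⟨∑ g : G, C g, fun t ht ↦ ?_⟩
  have h1 : ∑' n : ℕ, idealCoeff (charTwist cl χ) n * (w (t * n) : ℂ) =
      ∑ g : G, χ (Additive.ofMul g) * ((∑' n : ℕ, classCount cl g n * w (t * n) : ℝ) : ℂ) := by
    have h2 : ∀ n : ℕ, idealCoeff (charTwist cl χ) n * (w (t * n) : ℂ) =
        ∑ g : G, χ (Additive.ofMul g) * ((classCount cl g n * w (t * n) : ℝ) : ℂ) := by
      intro n
      rcases eq_or_ne n 0 with rfl | hn
      · have : w 0 = 0 := hw.eq_zero_of_lt (by norm_num)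
        simp [this]
      · rw [idealCoeff_charTwist cl χ hn, Finset.sum_mul]
        refine Finset.sum_congr rfl fun g _ ↦ ?_
        push_cast; ring
    have hs := fun g ↦ summable_smoothed hw (fun n ↦ (classCount cl g n : ℝ)) ht.1
    simp_rw [h2]
    rw [Summable.tsum_finsetSum fun g _ ↦ (Complex.summable_ofReal.2 (hs g)).mul_left _]
    refine Finset.sum_congr rfl fun g _ ↦ ?_
    rw [tsum_mul_left, ofReal_tsum]
  have h3 : (if χ = 0 then (κ * Nat.card G : ℂ) else 0) / t =
      ∑ g : G, χ (Additive.ofMul g) * ((κ / t : ℝ) : ℂ) := by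
    rw [← Finset.sum_mul]
    have h4 : ∑ g : G, χ (Additive.ofMul g) = ∑ a : Additive G, χ a :=
      Fintype.sum_equiv Additive.ofMul _ _ fun _ ↦ rfl
    rw [h4, AddChar.sum_eq_ite]
    split_ifs with h
    · rw [← Nat.card_eq_fintype_card, show Nat.card (Additive G) = Nat.card G from rfl]
      push_cast; ring
    · simp
  rw [h1, h3, ← Finset.sum_sub_distrib, Finset.sum_mul]
  refine norm_sum_le_of_le _ fun g _ ↦ ?_
  rw [← mul_sub, norm_mul, AddChar.norm_apply, one_mul, ← ofReal_sub, Complex.norm_real]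
  exact hC g t ht

include hw H in
/-- Analytic continuation of the `L`-functions. -/
theorem exists_entire_charTwist (χ : AddChar (Additive G) ℂ) : ∃ P : ℂ → ℂ, Differentiable ℂ P ∧
    (χ = 0 → P 1 = κ * Nat.card G) ∧ ∀ s : ℂ, 1 < s.re →
      P s = (s - 1) ^ (if χ = 0 then 1 else 0) *
        (LSeries (fun n ↦ idealCoeff (charTwist cl χ) n) s * mellin (fun t ↦ (w t : ℂ)) s) := by
  obtain ⟨E, hE, h⟩ := hw.exists_entire (fun n ↦ idealCoeff (charTwist cl χ) n)
    (fun s hs ↦ summable_idealCoeff (norm_charTwist_le cl χ) hs)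
    (if χ = 0 then (κ * Nat.card G : ℂ) else 0) (smoothed_charTwist cl hw H χ)
  by_cases hχ : χ = 0
  · refine ⟨fun s ↦ κ * Nat.card G + (s - 1) * E s, by fun_prop, by simp, fun s hs ↦ ?_⟩
    have hs1 : s - 1 ≠ 0 := fun h ↦ by
      have : s = 1 := by linear_combination h
      simp [this] at hs
    simp only [h s hs, if_pos hχ]
    field_simp
  · refine ⟨E, hE, fun h ↦ absurd h hχ, fun s hs ↦ ?_⟩
    simp [h s hs, if_neg hχ]

end Nonvanishing

end

section

open MeasureTheory Set Filter Topology Complex NumberField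
open scoped ComplexOrder ComplexConjugate
set_option linter.unusedSectionVars false

section Nonvanishing

variable {K : Type*} [Field K] [NumberField K] {G : Type*} [CommGroup G] [Finite G]
  (cl : Ideal (𝓞 K) →*₀ WithZero G)

/-- The coefficients of `L(0)² L(χ) L(-χ)`. -/
noncomputable def auxCoeff (χ : AddChar (Additive G) ℂ) : ArithmeticFunction ℂ :=
  idealCoeff (charTwist cl 0) * idealCoeff (charTwist cl 0) *
    (idealCoeff (charTwist cl χ) * idealCoeff (charTwist cl (-χ)))

/-- The coefficients of the logarithmic derivative of `L(0)² L(χ) L(-χ)`. -/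
noncomputable def auxLogCoeff (χ : AddChar (Additive G) ℂ) : ArithmeticFunction ℂ :=
  primePowCoeff (charTwist cl 0) + primePowCoeff (charTwist cl 0) +
    (primePowCoeff (charTwist cl χ) + primePowCoeff (charTwist cl (-χ)))

theorem auxLogCoeff_eq (χ : AddChar (Additive G) ℂ) (n : ℕ) :
    auxLogCoeff cl χ n = primePowCoeff (fun I ↦ ((2 * (charTwist cl 0 I).re +
      2 * (charTwist cl χ I).re : ℝ) : ℂ)) n := by
  rcases eq_or_ne n 0 with rfl | hn
  · simp
  simp only [auxLogCoeff, ArithmeticFunction.add_apply, primePowCoeff_apply _ hn,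
    ← Finset.sum_add_distrib]
  refine Finset.sum_congr rfl fun x _ ↦ ?_
  have h1 : charTwist cl 0 (x.1 ^ (x.2 + 1)) = ((charTwist cl 0 (x.1 ^ (x.2 + 1))).re : ℂ) := by
    obtain h | ⟨g, h⟩ := withZero_cases (cl (x.1 ^ (x.2 + 1)))
    · simp [charTwist_of_zero cl _ h]
    · simp [charTwist_of_coe cl _ h]
  have h2 := Complex.add_conj (charTwist cl χ (x.1 ^ (x.2 + 1)))
  rw [← charTwist_neg] at h2
  generalize charTwist cl 0 (x.1 ^ (x.2 + 1)) = z at *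
  generalize charTwist cl χ (x.1 ^ (x.2 + 1)) = y at *
  generalize charTwist cl (-χ) (x.1 ^ (x.2 + 1)) = y' at *
  push_cast at h2 ⊢
  rw [← h1, ← h2]
  ring

theorem auxLogCoeff_weight_nonneg (χ : AddChar (Additive G) ℂ) (I : Ideal (𝓞 K)) :
    (0 : ℂ) ≤ ((2 * (charTwist cl 0 I).re + 2 * (charTwist cl χ I).re : ℝ) : ℂ) := by
  rw [Complex.zero_le_real]
  obtain h | ⟨g, h⟩ := withZero_cases (cl I)
  · simp [charTwist_of_zero cl _ h]
  · rw [charTwist_of_coe cl _ h, charTwist_of_coe cl _ h]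
    have h1 := Complex.abs_re_le_norm (χ (Additive.ofMul g))
    rw [AddChar.norm_apply] at h1
    simp only [AddChar.zero_apply, one_re]
    linarith [(abs_le.1 h1).1]

theorem auxCoeff_nonneg (χ : AddChar (Additive G) ℂ) (n : ℕ) :
    0 ≤ auxCoeff cl χ n ∧ auxLogCoeff cl χ n ≤ auxCoeff cl χ n * Real.log n := by
  refine nonneg_of_logDeriv_nonneg ?_ ?_ ?_ n
  · simp [auxCoeff, idealCoeff_one]
  · intro n
    rw [auxLogCoeff_eq]
    exact primePowCoeff_nonneg (auxLogCoeff_weight_nonneg cl χ) n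
  · exact mul_log_of_logDeriv (mul_log_of_logDeriv (idealCoeff_mul_log _) (idealCoeff_mul_log _))
      (mul_log_of_logDeriv (idealCoeff_mul_log _) (idealCoeff_mul_log _))

theorem auxCoeff_ge {q : Ideal (𝓞 K)} (hq : Prime q) (hcl : cl q ≠ 0)
    (χ : AddChar (Additive G) ℂ) (k : ℕ) :
    ((1 / (Nat.card G * (k + 1)) : ℝ) : ℂ) ≤
      auxCoeff cl χ (Ideal.absNorm q ^ (Nat.card G * (k + 1))) := by
  obtain h | ⟨g, hg⟩ := withZero_cases (cl q)
  · exact absurd h hcl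
  have hG : 0 < Nat.card G := Nat.card_pos
  have hN := two_le_absNorm_of_prime hq
  set m := Nat.card G * (k + 1) with hm
  have hm0 : m ≠ 0 := by positivity
  obtain ⟨m', hm'⟩ := Nat.exists_eq_succ_of_ne_zero hm0
  set n := Ideal.absNorm q ^ m with hn
  have hn0 : n ≠ 0 := pow_ne_zero _ (by omega)
  have hclm : cl (q ^ m) = ((1 : G) : WithZero G) := by
    rw [map_pow, hg, ← WithZero.coe_pow, hm, pow_mul, pow_card_eq_one', one_pow]
  have hlogq : 0 < Real.log (Ideal.absNorm q) := Real.log_pos (by exact_mod_cast hN)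
  have h1 : ((Real.log (Ideal.absNorm q) : ℝ) : ℂ) ≤ auxLogCoeff cl χ n := by
    rw [auxLogCoeff_eq, primePowCoeff_apply _ hn0]
    have hmem : (q, m') ∈ primePowFiber K n := mem_primePowFiber.2 ⟨hq, by rw [hn, hm']⟩
    refine le_trans ?_ (Finset.single_le_sum (fun x _ ↦ mul_nonneg
      (auxLogCoeff_weight_nonneg cl χ _) (Complex.zero_le_real.2 (Real.log_natCast_nonneg _))) hmem)
    simp only
    rw [← Nat.succ_eq_add_one, ← hm', charTwist_of_coe cl _ hclm, charTwist_of_coe cl _ hclm,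
      ← ofReal_mul, Complex.real_le_real]
    simp
    linarith
  have h2 := h1.trans (auxCoeff_nonneg cl χ n).2
  have h3 : Real.log n = m * Real.log (Ideal.absNorm q) := by
    rw [hn, Nat.cast_pow, Real.log_pow]
  have hmc : (m : ℝ) = Nat.card G * (k + 1) := by rw [hm]; push_cast; ring
  have hm1 : (0 : ℝ) < m := by positivity
  rw [← hmc]
  have h4 : (0 : ℂ) ≤ ((1 / (m * Real.log (Ideal.absNorm q)) : ℝ) : ℂ) :=
    Complex.zero_le_real.2 (by positivity)
  have h5 := mul_le_mul_of_nonneg_right h2 h4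
  rw [h3, mul_assoc, ← ofReal_mul, ← ofReal_mul, mul_one_div_cancel (by positivity)] at h5
  rw [ofReal_one, mul_one] at h5
  convert h5 using 2
  field_simp

theorem AlternatingAt.pow_four {f : ℂ → ℂ} {c : ℂ} (hf : AlternatingAt f c)
    (hf' : Differentiable ℂ f) : AlternatingAt (f * f * (f * f)) c :=
  have h2 := hf.mul hf (hf'.analyticAt _) (hf'.analyticAt _)
  h2.mul h2 ((hf'.mul hf').analyticAt _) ((hf'.mul hf').analyticAt _)

theorem differentiable_dslope {f : ℂ → ℂ} (hf : Differentiable ℂ f) (a : ℂ) :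
    Differentiable ℂ (dslope f a) := by
  rw [← differentiableOn_univ] at hf ⊢
  exact (Complex.differentiableOn_dslope univ_mem).2 hf

variable {w : ℝ → ℝ} (hw : IsWeight w) {κ : ℝ} (hκ : 0 < κ)
  (H : SmoothedEquidistribution cl w κ)

include hw H in
theorem charTwist_ne_zero {q : Ideal (𝓞 K)} (hq : Prime q) (hcl : cl q ≠ 0)
    {χ : AddChar (Additive G) ℂ} (hχ : χ ≠ 0) {P : ℂ → ℂ} (hP : Differentiable ℂ P)
    (hPL : ∀ s : ℂ, 1 < s.re →
      P s = LSeries (fun n ↦ idealCoeff (charTwist cl χ) n) s * mellin (fun t ↦ (w t : ℂ)) s) :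
    P 1 ≠ 0 := by
  intro hP1
  obtain ⟨P0, hP0, -, hPL0⟩ := exists_entire_charTwist cl hw H 0
  obtain ⟨P', hP', -, hPL'⟩ := exists_entire_charTwist cl hw H (-χ)
  simp only [if_true, pow_one] at hPL0
  simp only [neg_eq_zero, if_neg hχ, pow_zero, one_mul] at hPL'
  have hP'1 : P' 1 = 0 := by
    have h1 : ∀ x : ℝ, 1 < x → P' x = conj (P x) := by
      intro x hx
      rw [hPL' x (by simpa), hPL x (by simpa), map_mul, ← LSeries_conj]
      congr 1
      · congr 1
        funext n
        rw [← idealCoeff_conj]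
        congr 2
        funext I
        exact charTwist_neg cl χ I
      · obtain ⟨y, -, hy⟩ := hw.mellin_pos x
        rw [hy, conj_ofReal]
    have h2 : Tendsto (fun x : ℝ ↦ P' x) (𝓝[>] 1) (𝓝 (P' 1)) :=
      ((hP'.continuous.comp continuous_ofReal).tendsto' _ _ (by simp)).mono_left
        nhdsWithin_le_nhds
    have h3 : Tendsto (fun x : ℝ ↦ conj (P x)) (𝓝[>] 1) (𝓝 (conj (P 1))) :=
      ((Complex.continuous_conj.comp (hP.continuous.comp continuous_ofReal)).tendsto' _ _
        (by simp)).mono_left nhdsWithin_le_nhds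
    rw [hP1, map_zero] at h3
    refine tendsto_nhds_unique h2 (h3.congr' ?_)
    filter_upwards [self_mem_nhdsWithin] with x hx
    exact (h1 x hx).symm
  set W : ℂ → ℂ := mellin fun t ↦ (w t : ℂ) with hWdef
  have hW : Differentiable ℂ W := hw.differentiable_mellin
  have hWa : AlternatingAt W 2 := fun n ↦ by simpa using hw.alternating_mellin n 2
  set Q : ℂ → ℂ := P0 * P0 * (dslope P 1 * dslope P' 1) with hQdef
  have hQ : Differentiable ℂ Q :=
    (hP0.mul hP0).mul ((differentiable_dslope hP 1).mul (differentiable_dslope hP' 1))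
  have hsum0 := fun (χ : AddChar (Additive G) ℂ) (s : ℂ) (hs : 1 < s.re) ↦
    summable_idealCoeff (norm_charTwist_le cl χ) hs
  have hsum : ∀ s : ℂ, 1 < s.re → LSeriesSummable (fun n ↦ auxCoeff cl χ n) s := fun s hs ↦
    ArithmeticFunction.LSeriesSummable_mul
      (ArithmeticFunction.LSeriesSummable_mul (hsum0 0 s hs) (hsum0 0 s hs))
      (ArithmeticFunction.LSeriesSummable_mul (hsum0 χ s hs) (hsum0 (-χ) s hs))
  have hQL : ∀ s : ℂ, 1 < s.re → Q s = LSeries (fun n ↦ auxCoeff cl χ n) s *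
      (W * W * (W * W)) s := by
    intro s hs
    have hs1 : s ≠ 1 := by rintro rfl; simp at hs
    have hs2 : s - 1 ≠ 0 := sub_ne_zero.2 hs1
    rw [auxCoeff, ArithmeticFunction.LSeries_mul'
      (ArithmeticFunction.LSeriesSummable_mul (hsum0 0 s hs) (hsum0 0 s hs))
      (ArithmeticFunction.LSeriesSummable_mul (hsum0 χ s hs) (hsum0 (-χ) s hs)),
      ArithmeticFunction.LSeries_mul' (hsum0 0 s hs) (hsum0 0 s hs),
      ArithmeticFunction.LSeries_mul' (hsum0 χ s hs) (hsum0 (-χ) s hs)]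
    simp only [hQdef, Pi.mul_apply, dslope_of_ne _ hs1, slope_def_field, hP1, hP'1, sub_zero,
      hPL s hs, hPL0 s hs, hPL' s hs]
    field_simp
  have hbound := sum_le_of_differentiable (r := fun n ↦ auxCoeff cl χ n)
    (fun n ↦ (auxCoeff_nonneg cl χ n).1) hsum ((hW.mul hW).mul (hW.mul hW))
    (hWa.pow_four hW) hQ hQL
  obtain ⟨y, hy0, hy⟩ := hw.mellin_pos 0
  have hy' : (W * W * (W * W)) 0 = ((y ^ 4 : ℝ) : ℂ) := by
    rw [ofReal_zero] at hy
    simp only [Pi.mul_apply, hWdef, hy]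
    push_cast; ring
  have hN := two_le_absNorm_of_prime hq
  have hG : 0 < Nat.card G := Nat.card_pos
  have key : ∀ Y : ℕ, ∑ k ∈ Finset.range Y, (1 / ((k : ℝ) + 1)) ≤
      (Q 0).re / y ^ 4 * Nat.card G := by
    intro Y
    have h1 := hbound (Ideal.absNorm q ^ (Nat.card G * Y) + 1)
    have h2 : ∑ k ∈ Finset.range Y, ((1 / (Nat.card G * (k + 1)) * y ^ 4 : ℝ) : ℂ) ≤ Q 0 := by
      refine le_trans ?_ h1
      have hinj : Function.Injective fun k : ℕ ↦ Ideal.absNorm q ^ (Nat.card G * (k + 1)) := by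
        intro a b hab
        have := Nat.pow_right_injective hN hab
        have := Nat.eq_of_mul_eq_mul_left hG this
        omega
      calc _ ≤ ∑ k ∈ Finset.range Y, auxCoeff cl χ (Ideal.absNorm q ^ (Nat.card G * (k + 1))) *
            (W * W * (W * W)) 0 := by
            refine Finset.sum_le_sum fun k _ ↦ ?_
            rw [ofReal_mul, hy']
            exact mul_le_mul_of_nonneg_right (auxCoeff_ge cl hq hcl χ k)
              (Complex.zero_le_real.2 (by positivity))
        _ = ∑ n ∈ (Finset.range Y).map ⟨_, hinj⟩, auxCoeff cl χ n * (W * W * (W * W)) 0 := by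
            rw [Finset.sum_map]; rfl
        _ ≤ _ := by
            refine Finset.sum_le_sum_of_subset_of_nonneg ?_ fun n _ _ ↦ ?_
            · intro n hn
              obtain ⟨k, hk, rfl⟩ := Finset.mem_map.1 hn
              rw [Finset.mem_range] at hk
              simp only [Function.Embedding.coeFn_mk, Finset.mem_Ico]
              exact ⟨Nat.pos_of_ne_zero (pow_ne_zero _ (by omega)), Nat.lt_succ_of_le
                (Nat.pow_le_pow_right (by omega) (Nat.mul_le_mul_left _ hk))⟩
            · rw [hy']
              exact mul_nonneg (auxCoeff_nonneg cl χ n).1 (Complex.zero_le_real.2 (by positivity))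
    have h3 := (Complex.le_def.1 h2).1
    rw [← ofReal_sum, ofReal_re] at h3
    have hG' : (0 : ℝ) < Nat.card G := by exact_mod_cast hG
    have h4 : ∑ k ∈ Finset.range Y, (1 / (Nat.card G * ((k : ℝ) + 1)) * y ^ 4) =
        (∑ k ∈ Finset.range Y, (1 / ((k : ℝ) + 1))) * (y ^ 4 / Nat.card G) := by
      rw [Finset.sum_mul]
      refine Finset.sum_congr rfl fun k _ ↦ ?_
      field_simp
    rw [h4, ← le_div_iff₀ (by positivity)] at h3
    refine h3.trans_eq ?_
    field_simp
  obtain ⟨Y, hY⟩ := ((Real.tendsto_sum_range_one_div_nat_succ_atTop).eventually_gt_atTop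
    ((Q 0).re / y ^ 4 * Nat.card G)).exists
  exact absurd (key Y) (not_le.2 hY)

end Nonvanishing

end

section

open MeasureTheory Set Filter Topology Complex NumberField
open scoped ComplexOrder ComplexConjugate
set_option linter.unusedSectionVars false

section Dirichlet

variable {K : Type*} [Field K] [NumberField K] {G : Type*} [CommGroup G] [Finite G]
  (cl : Ideal (𝓞 K) →*₀ WithZero G)

variable {w : ℝ → ℝ} (hw : IsWeight w) {κ : ℝ} (hκ : 0 < κ)
  (H : SmoothedEquidistribution cl w κ)

include hw hκ H in
theorem tendsto_LSeries_primePowCoeff {q : Ideal (𝓞 K)} (hq : Prime q) (hcl : cl q ≠ 0)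
    (χ : AddChar (Additive G) ℂ) : ∃ l : ℂ, Tendsto (fun x : ℝ ↦
      LSeries (fun n ↦ primePowCoeff (charTwist cl χ) n) x - (if χ = 0 then 1 / ((x : ℂ) - 1) else 0))
      (𝓝[>] 1) (𝓝 l) := by
  obtain ⟨P, hP, hP0, hPL⟩ := exists_entire_charTwist cl hw H χ
  set W : ℂ → ℂ := mellin fun t ↦ (w t : ℂ) with hWdef
  have hW : Differentiable ℂ W := hw.differentiable_mellin
  have hP1 : P 1 ≠ 0 := by
    by_cases hχ : χ = 0
    · rw [hP0 hχ]
      have : Nat.card G ≠ 0 := Nat.card_pos.ne'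
      exact mul_ne_zero (by exact_mod_cast hκ.ne') (by exact_mod_cast this)
    · exact charTwist_ne_zero cl hw H hq hcl hχ hP fun s hs ↦ by
        rw [hPL s hs, if_neg hχ, pow_zero, one_mul]
  have hW1 : W 1 ≠ 0 := by
    obtain ⟨y, hy, h⟩ := hw.mellin_pos 1
    rw [ofReal_one] at h
    rw [hWdef, h]
    exact_mod_cast hy.ne'
  have hPc : Continuous (deriv P) := (hP.contDiff (n := 1)).continuous_deriv le_rfl
  have hWc : Continuous (deriv W) := (hW.contDiff (n := 1)).continuous_deriv le_rfl
  have hlim : Tendsto (fun s : ℂ ↦ deriv W s / W s - deriv P s / P s) (𝓝 1)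
      (𝓝 (deriv W 1 / W 1 - deriv P 1 / P 1)) :=
    ((hWc.tendsto 1).div (hW.continuous.tendsto 1) hW1).sub
      ((hPc.tendsto 1).div (hP.continuous.tendsto 1) hP1)
  have hof : Tendsto (fun x : ℝ ↦ (x : ℂ)) (𝓝[>] 1) (𝓝 1) :=
    (continuous_ofReal.tendsto' 1 1 (by simp)).mono_left nhdsWithin_le_nhds
  refine ⟨_, (hlim.comp hof).congr' ?_⟩
  have hPne : ∀ᶠ x : ℝ in 𝓝[>] 1, P x ≠ 0 :=
    hof.eventually (hP.continuous.continuousAt.eventually_ne hP1)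
  have hWne : ∀ᶠ x : ℝ in 𝓝[>] 1, W x ≠ 0 :=
    hof.eventually (hW.continuous.continuousAt.eventually_ne hW1)
  filter_upwards [hPne, hWne, self_mem_nhdsWithin] with x hPx hWx hx
  have hx1 : 1 < (x : ℂ).re := by simpa using hx
  set L : ℂ → ℂ := LSeries fun n ↦ idealCoeff (charTwist cl χ) n with hLdef
  have hLd : deriv L x = -(L x * LSeries (fun n ↦ primePowCoeff (charTwist cl χ) n) x) :=
    deriv_LSeries_idealCoeff (norm_charTwist_le cl χ) hx1
  have hLdiff : DifferentiableAt ℂ L x :=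
    (LSeries_hasDerivAt (abscissa_idealCoeff_lt (norm_charTwist_le cl χ) hx1)).differentiableAt
  have hev : P =ᶠ[𝓝 (x : ℂ)] fun s ↦ (s - 1) ^ (if χ = 0 then 1 else 0) * (L s * W s) := by
    filter_upwards [(isOpen_lt continuous_const continuous_re).mem_nhds hx1] with s hs
    exact hPL s hs
  have hPx' := hPL x hx1
  have hxne : (x : ℂ) - 1 ≠ 0 := by
    rw [sub_ne_zero]; rintro h; rw [h] at hx1; simp at hx1
  have hLx : L x ≠ 0 := by
    intro h; rw [hPx', h] at hPx; simp at hPx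
  simp only [Function.comp_apply]
  rw [hev.deriv_eq, hPx']
  by_cases hχ : χ = 0
  · simp only [if_pos hχ, pow_one]
    have h1 : HasDerivAt (fun s : ℂ ↦ s - 1) 1 (x : ℂ) := (hasDerivAt_id _).sub_const 1
    rw [show (fun s ↦ (s - 1) * (L s * W s)) = (fun s ↦ s - 1) * (L * W) from rfl,
      (h1.mul (hLdiff.hasDerivAt.mul hW.differentiableAt.hasDerivAt)).deriv, hLd]
    simp only [Pi.mul_apply]
    field_simp
    ring
  · simp only [if_neg hχ, pow_zero, one_mul, sub_zero]
    rw [show (fun s ↦ L s * W s) = L * W from rfl,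
      (hLdiff.hasDerivAt.mul hW.differentiableAt.hasDerivAt).deriv, hLd]
    field_simp
    ring

open Classical in
/-- The indicator function of a class of ideals. -/
noncomputable def classIndicator (g : G) (I : Ideal (𝓞 K)) : ℂ := if cl I = g then 1 else 0

theorem card_mul_classIndicator (g : G) (I : Ideal (𝓞 K)) :
    (Nat.card G : ℂ) * classIndicator cl g I =
      ∑ χ : AddChar (Additive G) ℂ, χ (-Additive.ofMul g) * charTwist cl χ I := by
  classical
  have := Fintype.ofFinite (Additive G)
  obtain h | ⟨k, h⟩ := withZero_cases (cl I)
  · simp [charTwist_of_zero cl _ h, classIndicator, h]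
  · simp_rw [charTwist_of_coe cl _ h, ← AddChar.map_add_eq_mul]
    rw [AddChar.sum_apply_eq_ite, classIndicator, h, ← Nat.card_eq_fintype_card,
      show Nat.card (Additive G) = Nat.card G from rfl]
    by_cases hk : k = g
    · simp [hk]
    · have h1 : -Additive.ofMul g + Additive.ofMul k ≠ 0 := by
        rw [Ne, neg_add_eq_zero, Additive.ofMul.injective.eq_iff]
        exact Ne.symm hk
      rw [if_neg h1, if_neg (by rwa [WithZero.coe_inj]), mul_zero]

theorem LSeries_classIndicator (g : G) {s : ℂ} (hs : 1 < s.re) :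
    (Nat.card G : ℂ) * LSeries (fun n ↦ primePowCoeff (classIndicator cl g) n) s =
      ∑ χ : AddChar (Additive G) ℂ, χ (-Additive.ofMul g) *
        LSeries (fun n ↦ primePowCoeff (charTwist cl χ) n) s := by
  have h1 : ∀ n : ℕ, (Nat.card G : ℂ) * primePowCoeff (classIndicator cl g) n =
      ∑ χ : AddChar (Additive G) ℂ, χ (-Additive.ofMul g) * primePowCoeff (charTwist cl χ) n := by
    intro n
    rcases eq_or_ne n 0 with rfl | hn
    · simp
    simp_rw [primePowCoeff_apply _ hn, Finset.mul_sum]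
    rw [Finset.sum_comm]
    refine Finset.sum_congr rfl fun x _ ↦ ?_
    rw [← mul_assoc, card_mul_classIndicator, Finset.sum_mul]
    simp_rw [mul_assoc]
  have h2 := fun χ : AddChar (Additive G) ℂ ↦
    summable_primePowCoeff (norm_charTwist_le cl χ) hs
  simp_rw [← LSeries_smul]
  rw [← LSeries_sum fun χ _ ↦ (h2 χ).smul _]
  congr 1
  funext n
  simpa using h1 n

theorem summable_absNorm_rpow : Summable fun I : Ideal (𝓞 K) ↦
    (Ideal.absNorm I : ℝ) ^ (-(3 / 2) : ℝ) := by
  classical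
  have h := summable_card_normFiber (K := K) (s := ((3 / 2 : ℝ) : ℂ))
    (by rw [ofReal_re]; norm_num)
  have h1 := h.norm
  have h2 : ∀ n : ℕ, ‖LSeries.term (fun n ↦ ((normFiber K n).card : ℂ)) ((3 / 2 : ℝ) : ℂ) n‖ =
      (normFiber K n).card * (n : ℝ) ^ (-(3 / 2) : ℝ) := by
    intro n
    rcases eq_or_ne n 0 with rfl | hn
    · rw [LSeries.term_zero, norm_zero, Nat.cast_zero, Real.zero_rpow (by norm_num), mul_zero]
    · rw [LSeries.norm_term_eq, if_neg hn, ofReal_re, Real.rpow_neg n.cast_nonneg]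
      simp [div_eq_mul_inv]
  simp_rw [h2] at h1
  refine summable_of_sum_le (c := ∑' n : ℕ, (normFiber K n).card * (n : ℝ) ^ (-(3 / 2) : ℝ))
    (fun _ ↦ by positivity) fun T ↦ ?_
  rw [← Finset.sum_fiberwise_of_maps_to (s := T) (t := T.image Ideal.absNorm)
    (g := fun I ↦ Ideal.absNorm I) fun I hI ↦ Finset.mem_image_of_mem _ hI]
  refine le_trans (Finset.sum_le_sum fun n _ ↦ ?_) (h1.sum_le_tsum _ fun n _ ↦ by positivity)
  rw [Finset.sum_congr rfl (g := fun _ ↦ (n : ℝ) ^ (-(3 / 2) : ℝ)) fun I hI ↦ by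
    rw [(Finset.mem_filter.1 hI).2], Finset.sum_const, nsmul_eq_mul]
  refine mul_le_mul_of_nonneg_right ?_ (by positivity)
  exact_mod_cast Finset.card_le_card fun I hI ↦ mem_normFiber.2 (Finset.mem_filter.1 hI).2

open Classical in
/-- A majorant of the prime power contributions in which only finitely many primes have
exponent one. -/
noncomputable def primePowMajorant (S : Finset (Ideal (𝓞 K))) (x : Ideal (𝓞 K) × ℕ) : ℝ :=
  if Prime x.1 ∧ (x.2 = 0 → x.1 ∈ S) then
    Real.log (Ideal.absNorm x.1) * ((Ideal.absNorm x.1 : ℝ) ^ (x.2 + 1))⁻¹ else 0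

theorem primePowMajorant_nonneg (S : Finset (Ideal (𝓞 K))) (x : Ideal (𝓞 K) × ℕ) :
    0 ≤ primePowMajorant S x := by
  rw [primePowMajorant]
  split_ifs
  · exact mul_nonneg (Real.log_natCast_nonneg _) (by positivity)
  · exact le_rfl

theorem summable_primePowMajorant (S : Finset (Ideal (𝓞 K))) :
    Summable (primePowMajorant S) := by
  classical
  have h1 : Summable fun x : Ideal (𝓞 K) × ℕ ↦ if x ∈ S ×ˢ {0} then primePowMajorant S x else 0 :=
    summable_of_hasFiniteSupport ((S ×ˢ {0} : Finset (Ideal (𝓞 K) × ℕ)).finite_toSet.subset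
      fun x hx ↦ by
        by_contra h
        exact hx (if_neg h))
  have h2 : Summable fun x : Ideal (𝓞 K) × ℕ ↦
      (Ideal.absNorm x.1 : ℝ) ^ (-(3 / 2) : ℝ) * (4 * (1 / 2 : ℝ) ^ x.2) :=
    summable_absNorm_rpow.mul_of_nonneg
      ((summable_geometric_of_lt_one (by norm_num) (by norm_num)).mul_left 4)
      (fun _ ↦ by positivity) fun _ ↦ by positivity
  refine (h1.add h2).of_nonneg_of_le (primePowMajorant_nonneg S) fun x ↦ ?_
  obtain ⟨P, k⟩ := x
  by_cases hk : (P, k) ∈ S ×ˢ ({0} : Finset ℕ)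
  · rw [if_pos hk]
    exact le_add_of_nonneg_right (by positivity)
  · rw [if_neg hk, zero_add, primePowMajorant]
    split_ifs with h
    · obtain ⟨hP, hS⟩ := h
      rcases k with _ | k
      · simp at hk; exact absurd (hS rfl) hk
      have hN : (2 : ℝ) ≤ Ideal.absNorm P := by exact_mod_cast two_le_absNorm_of_prime hP
      simp only
      generalize (Ideal.absNorm P : ℝ) = N at hN
      have hN0 : 0 < N := by linarith
      have hlog : Real.log N ≤ 2 * N ^ (1 / 2 : ℝ) := by
        have := Real.log_le_rpow_div hN0.le (ε := 1 / 2) (by norm_num)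
        linarith
      have hsplit : (N ^ (k + 1 + 1))⁻¹ = N ^ (-2 : ℝ) * (N⁻¹) ^ k := by
        rw [Real.rpow_neg hN0.le, show (2 : ℝ) = ((2 : ℕ) : ℝ) by norm_num, Real.rpow_natCast,
          inv_pow, ← mul_inv, ← pow_add]
        congr 2; ring
      have hinv : N⁻¹ ^ k ≤ (1 / 2 : ℝ) ^ k := by
        refine pow_le_pow_left₀ (by positivity) ?_ k
        rw [one_div]; exact inv_anti₀ (by norm_num) hN
      calc Real.log N * (N ^ (k + 1 + 1))⁻¹
          ≤ (2 * N ^ (1 / 2 : ℝ)) * (N ^ (-2 : ℝ) * (1 / 2 : ℝ) ^ k) := by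
            rw [hsplit]; gcongr
        _ = N ^ (-(3 / 2) : ℝ) * (4 * (1 / 2 : ℝ) ^ (k + 1)) := by
            have : N ^ (-(3 / 2) : ℝ) = N ^ (1 / 2 : ℝ) * N ^ (-2 : ℝ) := by
              rw [← Real.rpow_add hN0]; norm_num
            rw [this, pow_succ]; ring
    · positivity

theorem norm_LSeries_classIndicator_le {g : G} (hfin : {P | Prime P ∧ cl P = g}.Finite) :
    ∃ B : ℝ, ∀ x : ℝ, 1 < x →
      ‖LSeries (fun n ↦ primePowCoeff (classIndicator cl g) n) x‖ ≤ B := by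
  classical
  set S := hfin.toFinset with hS
  refine ⟨∑' x, primePowMajorant S x, fun x hx ↦ ?_⟩
  have hle : ∀ n : ℕ, ‖LSeries.term (fun n ↦ primePowCoeff (classIndicator cl g) n) x n‖ ≤
      ∑ y ∈ primePowFiber K n, primePowMajorant S y := by
    intro n
    rcases eq_or_ne n 0 with rfl | hn
    · rw [LSeries.term_zero, norm_zero]
      exact Finset.sum_nonneg fun y _ ↦ primePowMajorant_nonneg S y
    rw [LSeries.norm_term_eq, if_neg hn, ofReal_re, primePowCoeff_apply _ hn, div_eq_mul_inv]
    have hn1 : (1 : ℝ) ≤ n := by exact_mod_cast Nat.one_le_iff_ne_zero.2 hn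
    have h1 : ((n : ℝ) ^ x)⁻¹ ≤ (n : ℝ)⁻¹ := by
      refine inv_anti₀ (by positivity) ?_
      calc (n : ℝ) = (n : ℝ) ^ (1 : ℝ) := (Real.rpow_one _).symm
        _ ≤ _ := Real.rpow_le_rpow_of_exponent_le hn1 hx.le
    refine (mul_le_mul_of_nonneg_right (norm_sum_le _ _) (by positivity)).trans ?_
    rw [Finset.sum_mul]
    refine Finset.sum_le_sum fun y hy ↦ ?_
    obtain ⟨hy1, hy2⟩ := mem_primePowFiber.1 hy
    rw [norm_mul, Complex.norm_real, Real.norm_of_nonneg (Real.log_natCast_nonneg _)]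
    by_cases hc : cl (y.1 ^ (y.2 + 1)) = g
    · rw [classIndicator, if_pos hc, primePowMajorant, if_pos, norm_one, one_mul]
      · refine mul_le_mul_of_nonneg_left ?_ (Real.log_natCast_nonneg _)
        rw [← hy2] at h1 ⊢
        exact h1.trans_eq (by push_cast; rfl)
      · refine ⟨hy1, fun h0 ↦ ?_⟩
        rw [h0, zero_add, pow_one] at hc
        rw [hS, Set.Finite.mem_toFinset]
        exact ⟨hy1, hc⟩
    · rw [classIndicator, if_neg hc, norm_zero, zero_mul, zero_mul]
      exact primePowMajorant_nonneg S y
  have hpart : ∀ X : ℕ, ∑ n ∈ Finset.range X,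
      ‖LSeries.term (fun n ↦ primePowCoeff (classIndicator cl g) n) x n‖ ≤
        ∑' x, primePowMajorant S x := by
    intro X
    refine (Finset.sum_le_sum fun n _ ↦ hle n).trans ?_
    rw [← Finset.sum_biUnion]
    · exact (summable_primePowMajorant S).sum_le_tsum _ fun y _ ↦ primePowMajorant_nonneg S y
    · intro a _ b _ hab
      refine Finset.disjoint_left.2 fun y h1 h2 ↦ hab ?_
      exact (mem_primePowFiber.1 h1).2.symm.trans (mem_primePowFiber.1 h2).2
  have hsum := summable_of_sum_range_le (fun _ ↦ norm_nonneg _) hpart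
  exact (norm_tsum_le_tsum_norm hsum).trans (Real.tsum_le_of_sum_range_le
    (fun _ ↦ norm_nonneg _) hpart)

include hw hκ H in
/-- Dirichlet's theorem: equidistribution of ideals implies that every class contains infinitely
many primes. -/
theorem infinite_primes_of_equidistribution {q : Ideal (𝓞 K)} (hq : Prime q) (hcl : cl q ≠ 0)
    (g : G) : {P | Prime P ∧ cl P = g}.Infinite := by
  classical
  intro hfin
  obtain ⟨B, hB⟩ := norm_LSeries_classIndicator_le cl hfin
  choose l hl using tendsto_LSeries_primePowCoeff cl hw hκ H hq hcl
  have h1 : Tendsto (fun x : ℝ ↦ ∑ χ : AddChar (Additive G) ℂ, χ (-Additive.ofMul g) *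
      (LSeries (fun n ↦ primePowCoeff (charTwist cl χ) n) x -
        (if χ = 0 then 1 / ((x : ℂ) - 1) else 0))) (𝓝[>] 1)
      (𝓝 (∑ χ : AddChar (Additive G) ℂ, χ (-Additive.ofMul g) * l χ)) :=
    tendsto_finsetSum _ fun χ _ ↦ (hl χ).const_mul _
  have h2 := h1.norm
  have h3 : Tendsto (fun x : ℝ ↦ 1 / (x - 1)) (𝓝[>] 1) atTop := by
    simp_rw [one_div]
    refine tendsto_inv_nhdsGT_zero.comp ?_
    refine tendsto_nhdsWithin_iff.2 ⟨?_, ?_⟩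
    · exact ((continuous_id.sub continuous_const).tendsto' 1 0 (by simp)).mono_left
        nhdsWithin_le_nhds
    · filter_upwards [self_mem_nhdsWithin] with x hx
      exact sub_pos.2 (show (1 : ℝ) < x from hx)
  have h4 := h2.eventually_lt_const (lt_add_one _)
  obtain ⟨x, hx1, hx2, hx3⟩ := (h4.and ((h3.eventually_gt_atTop
    (Nat.card G * B + (‖∑ χ : AddChar (Additive G) ℂ, χ (-Additive.ofMul g) * l χ‖ + 1))).and
    self_mem_nhdsWithin)).exists
  have hx : (1 : ℝ) < x := hx3
  simp_rw [mul_sub] at hx1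
  rw [Finset.sum_sub_distrib, ← LSeries_classIndicator cl g (by simpa using hx)] at hx1
  simp only [mul_ite, mul_zero, Finset.sum_ite_eq', Finset.mem_univ, if_true] at hx1
  rw [AddChar.zero_apply, one_mul] at hx1
  have h5 : ‖(1 : ℂ) / ((x : ℂ) - 1)‖ = 1 / (x - 1) := by
    rw [← ofReal_one, ← ofReal_sub, ← ofReal_div, Complex.norm_real, Real.norm_of_nonneg]
    have := sub_pos.2 hx
    positivity
  have h6 : ‖(Nat.card G : ℂ) * LSeries (fun n ↦ primePowCoeff (classIndicator cl g) n) x‖ ≤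
      Nat.card G * B := by
    rw [norm_mul, Complex.norm_natCast]
    exact mul_le_mul_of_nonneg_left (hB x hx) (Nat.cast_nonneg _)
  have h7 := norm_sub_norm_le ((1 : ℂ) / ((x : ℂ) - 1))
    ((Nat.card G : ℂ) * LSeries (fun n ↦ primePowCoeff (classIndicator cl g) n) x)
  rw [norm_sub_rev, h5] at h7
  linarith

end Dirichlet

end

section

open MeasureTheory Set Filter Topology Module Submodule
open scoped ContDiff

section LatticeSum

theorem exists_norm_le_of_hasCompactSupport {V : Type*} [NormedAddCommGroup V] {f : V → ℝ} (hf : HasCompactSupport f) :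
    ∃ R : ℝ, 0 < R ∧ ∀ x, f x ≠ 0 → ‖x‖ ≤ R := by
  obtain ⟨R, hR, h⟩ := hf.isBounded.exists_pos_norm_le
  exact ⟨R, hR, fun x hx ↦ h x (subset_tsupport f hx)⟩

variable {V ι : Type*} [NormedAddCommGroup V] [NormedSpace ℝ V]

/-- The sum of the values of `f` at the points of the translated and scaled lattice spanned
by `e`. -/
noncomputable def latticeSum (e : Basis ι ℝ V) (f : V → ℝ) (ε : ℝ) (x : V) : ℝ :=
  ∑' l : span ℤ (Set.range e), f (ε • (x + (l : V)))

theorem latticeSum_add_mem (e : Basis ι ℝ V) (f : V → ℝ) (ε : ℝ) (x : V) {l : V}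
    (hl : l ∈ span ℤ (Set.range e)) : latticeSum e f ε (x + l) = latticeSum e f ε x := by
  unfold latticeSum
  rw [← (Equiv.addLeft (⟨l, hl⟩ : span ℤ (Set.range e))).tsum_eq
    fun m : span ℤ (Set.range e) ↦ f (ε • (x + (m : V)))]
  refine tsum_congr fun m ↦ ?_
  simp [add_assoc]

variable [Fintype ι]

theorem finite_latticeSum_support [FiniteDimensional ℝ V] (e : Basis ι ℝ V) {f : V → ℝ}
    (hf : HasCompactSupport f) {ε : ℝ} (hε : 0 < ε) (r : ℝ) :
    {l : span ℤ (Set.range e) | ∃ x : V, ‖x‖ ≤ r ∧ f (ε • (x + (l : V))) ≠ 0}.Finite := by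
  obtain ⟨R, hR, h⟩ := exists_norm_le_of_hasCompactSupport hf
  have h1 := ZSpan.setFinite_inter e (s := Metric.closedBall (0 : V) (R / ε + r))
    Metric.isBounded_closedBall
  refine Set.Finite.of_finite_image (f := Subtype.val) (h1.subset ?_)
    Subtype.val_injective.injOn
  rintro _ ⟨l, ⟨x, hx, hl⟩, rfl⟩
  refine ⟨?_, l.2⟩
  have h2 := h _ hl
  rw [norm_smul, Real.norm_of_nonneg hε.le] at h2
  have h3 : ‖x + (l : V)‖ ≤ R / ε := by rw [le_div_iff₀ hε]; linarith
  have h4 := norm_sub_le (x + (l : V)) x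
  rw [add_sub_cancel_left] at h4
  simp only [Metric.mem_closedBall, dist_zero_right]
  linarith

theorem exists_abs_repr_le [FiniteDimensional ℝ V] (e : Basis ι ℝ V) :
    ∃ c : ℝ, 0 < c ∧ ∀ y i, |e.repr y i| ≤ c * ‖y‖ := by
  refine ⟨∑ i, ‖LinearMap.toContinuousLinearMap (e.coord i)‖ + 1, by positivity, fun y i ↦ ?_⟩
  have h := (LinearMap.toContinuousLinearMap (e.coord i)).le_opNorm y
  simp only [LinearMap.coe_toContinuousLinearMap', Basis.coord_apply, Real.norm_eq_abs] at h
  refine h.trans (mul_le_mul_of_nonneg_right ?_ (norm_nonneg _))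
  have := Finset.single_le_sum
    (f := fun i ↦ ‖LinearMap.toContinuousLinearMap (e.coord i)‖) (fun i _ ↦ norm_nonneg _)
    (Finset.mem_univ i)
  linarith

theorem exists_abs_latticeSum_le [FiniteDimensional ℝ V] (e : Basis ι ℝ V) {f : V → ℝ}
    (hf : HasCompactSupport f) (hfc : Continuous f) :
    ∃ C : ℝ, 0 ≤ C ∧ ∀ x, ∀ ε ∈ Ioc (0 : ℝ) 1,
      |latticeSum e f ε x| ≤ C / ε ^ Fintype.card ι := by
  classical
  obtain ⟨R, hR, h⟩ := exists_norm_le_of_hasCompactSupport hf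
  obtain ⟨c, hc, hrepr⟩ := exists_abs_repr_le e
  obtain ⟨B, hB⟩ := hf.exists_bound_of_continuous hfc
  have hB0 : 0 ≤ B := (norm_nonneg _).trans (hB 0)
  refine ⟨(2 * c * R + 1) ^ Fintype.card ι * B, by positivity, fun x ε ⟨hε, hε1⟩ ↦ ?_⟩
  have hfin := finite_latticeSum_support e hf hε ‖x‖
  set T := hfin.toFinset
  have hT : latticeSum e f ε x = ∑ l ∈ T, f (ε • (x + (l : V))) := by
    refine tsum_eq_sum fun l hl ↦ ?_
    by_contra h0
    exact hl (hfin.mem_toFinset.2 ⟨x, le_rfl, h0⟩)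
  set T' := T.filter fun l : span ℤ (Set.range e) ↦ f (ε • (x + (l : V))) ≠ 0
  have hT' : latticeSum e f ε x = ∑ l ∈ T', f (ε • (x + (l : V))) := by
    rw [hT, Finset.sum_filter_ne_zero]
  set ρ := c * R / ε
  have hρ : 0 < ρ := by positivity
  let box := Fintype.piFinset fun i ↦ Finset.Icc ⌈-e.repr x i - ρ⌉ ⌊-e.repr x i + ρ⌋
  have hcard : T'.card ≤ box.card := by
    refine Finset.card_le_card_of_injOn (fun l i ↦ ⌊e.repr (l : V) i⌋) ?_ ?_
    · intro l hl
      have hl0 := (Finset.mem_filter.1 hl).2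
      have h2 := h _ hl0
      rw [norm_smul, Real.norm_of_nonneg hε.le] at h2
      simp only [box, Finset.mem_coe, Fintype.mem_piFinset, Finset.mem_Icc]
      intro i
      obtain ⟨z, hz⟩ := (e.mem_span_iff_repr_mem ℤ (l : V)).1 l.2 i
      simp only [algebraMap_int_eq, eq_intCast] at hz
      rw [← hz, Int.floor_intCast]
      have h3 := hrepr (x + (l : V)) i
      have h4 : c * ‖x + (l : V)‖ ≤ ρ := by
        rw [le_div_iff₀ hε]
        nlinarith
      rw [map_add, Finsupp.add_apply, ← hz] at h3
      have h5 := abs_le.1 (h3.trans h4)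
      exact ⟨Int.ceil_le.2 (by linarith), Int.le_floor.2 (by linarith)⟩
    · intro l _ l' _ hll
      refine Subtype.ext (e.ext_elem fun i ↦ ?_)
      obtain ⟨z, hz⟩ := (e.mem_span_iff_repr_mem ℤ (l : V)).1 l.2 i
      obtain ⟨z', hz'⟩ := (e.mem_span_iff_repr_mem ℤ (l' : V)).1 l'.2 i
      simp only [algebraMap_int_eq, eq_intCast] at hz hz'
      have := congrFun hll i
      simp only [← hz, ← hz', Int.floor_intCast] at this
      rw [← hz, ← hz', this]
  have hbox : (box.card : ℝ) ≤ ((2 * c * R + 1) / ε) ^ Fintype.card ι := by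
    rw [Fintype.card_piFinset, Nat.cast_prod, ← Finset.card_univ, ← Finset.prod_const]
    refine Finset.prod_le_prod (fun _ _ ↦ Nat.cast_nonneg _) fun i _ ↦ ?_
    rw [Int.card_Icc]
    have h1 : (2 * ρ + 1) ≤ (2 * c * R + 1) / ε := by
      rw [le_div_iff₀ hε]
      have : ρ * ε = c * R := by simp only [ρ]; field_simp
      nlinarith
    refine le_trans ?_ h1
    have h2 := Int.floor_le (-e.repr x i + ρ)
    have h3 := Int.le_ceil (-e.repr x i - ρ)
    rcases le_total 0 (⌊-e.repr x i + ρ⌋ + 1 - ⌈-e.repr x i - ρ⌉) with h0 | h0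
    · have : ((⌊-e.repr x i + ρ⌋ + 1 - ⌈-e.repr x i - ρ⌉).toNat : ℝ) =
          ⌊-e.repr x i + ρ⌋ + 1 - ⌈-e.repr x i - ρ⌉ := by
        exact_mod_cast congrArg (Int.cast : ℤ → ℝ) (Int.toNat_of_nonneg h0)
      rw [this]
      linarith
    · rw [Int.toNat_eq_zero.2 h0]
      push_cast
      linarith
  rw [hT']
  refine (Finset.abs_sum_le_sum_abs _ _).trans ?_
  refine (Finset.sum_le_card_nsmul _ _ B fun l _ ↦ hB _).trans ?_
  rw [nsmul_eq_mul]
  calc (T'.card : ℝ) * B ≤ ((2 * c * R + 1) / ε) ^ Fintype.card ι * B :=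
        mul_le_mul_of_nonneg_right ((Nat.cast_le.2 hcard).trans hbox) hB0
    _ = _ := by rw [div_pow]; ring

theorem hasDerivAt_latticeSum [FiniteDimensional ℝ V] (e : Basis ι ℝ V) {f : V → ℝ}
    (hf : HasCompactSupport f) (hfc : ContDiff ℝ ∞ f) {ε : ℝ} (hε : 0 < ε) (x v : V) (t : ℝ) :
    HasDerivAt (fun t : ℝ ↦ latticeSum e f ε (x + t • v))
      (ε * latticeSum e (fun y ↦ fderiv ℝ f y v) ε (x + t • v)) t := by
  classical
  set r := ‖x‖ + (|t| + 1) * ‖v‖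
  have hr : ∀ s ∈ Metric.ball t 1, ‖x + s • v‖ ≤ r := by
    intro s hs
    refine (norm_add_le _ _).trans (add_le_add_right ?_ _)
    rw [norm_smul]
    refine mul_le_mul_of_nonneg_right ?_ (norm_nonneg _)
    rw [Metric.mem_ball, Real.dist_eq] at hs
    have := abs_sub_abs_le_abs_sub s t
    rw [Real.norm_eq_abs]
    linarith
  have hfd : HasCompactSupport (fun y ↦ fderiv ℝ f y v) := hf.fderiv_apply ℝ v
  have h1 := finite_latticeSum_support e hf hε r
  have h2 := finite_latticeSum_support e hfd hε r
  set T := h1.toFinset ∪ h2.toFinset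
  have e1 : ∀ s ∈ Metric.ball t 1, latticeSum e f ε (x + s • v) =
      ∑ l ∈ T, f (ε • (x + s • v + (l : V))) := fun s hs ↦ by
    refine tsum_eq_sum fun l hl ↦ ?_
    by_contra h0
    exact hl (Finset.mem_union_left _ (h1.mem_toFinset.2 ⟨_, hr s hs, h0⟩))
  have e2 : latticeSum e (fun y ↦ fderiv ℝ f y v) ε (x + t • v) =
      ∑ l ∈ T, fderiv ℝ f (ε • (x + t • v + (l : V))) v := by
    refine tsum_eq_sum fun l hl ↦ ?_
    by_contra h0
    exact hl (Finset.mem_union_right _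
      (h2.mem_toFinset.2 ⟨_, hr t (Metric.mem_ball_self one_pos), h0⟩))
  rw [e2, Finset.mul_sum]
  refine HasDerivAt.congr_of_eventuallyEq (HasDerivAt.fun_sum fun l _ ↦ ?_)
    (eventually_of_mem (Metric.ball_mem_nhds t one_pos) e1)
  have h3 : HasDerivAt (fun s : ℝ ↦ ε • (x + s • v + (l : V))) (ε • v) t := by
    have := ((((hasDerivAt_id t).smul_const v).const_add x).add_const (l : V)).const_smul ε
    rwa [one_smul] at this
  have h4 : HasFDerivAt f (fderiv ℝ f (ε • (x + t • v + (l : V)))) (ε • (x + t • v + (l : V))) :=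
    (hfc.differentiable (by simp) _).hasFDerivAt
  have h5 := h4.comp_hasDerivAt t h3
  rwa [map_smul, smul_eq_mul] at h5

end LatticeSum

end

section

open MeasureTheory Set Filter Topology Module Submodule
open scoped ContDiff

section LatticeSum

variable {V ι : Type*} [NormedAddCommGroup V] [NormedSpace ℝ V]

theorem contDiff_fderiv_apply_const {f : V → ℝ} (hfc : ContDiff ℝ ∞ f) (v : V) :
    ContDiff ℝ ∞ fun y ↦ fderiv ℝ f y v :=
  (hfc.fderiv_right (m := ∞) (by simp)).clm_apply contDiff_const

variable [Fintype ι] [FiniteDimensional ℝ V]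

theorem exists_abs_latticeSum_fderiv_le (e : Basis ι ℝ V) (i : ι) (k : ℕ) :
    ∀ {f : V → ℝ}, HasCompactSupport f → ContDiff ℝ ∞ f →
    ∃ C : ℝ, 0 ≤ C ∧ ∀ x, ∀ ε ∈ Ioc (0 : ℝ) 1,
      |latticeSum e (fun y ↦ fderiv ℝ f y (e i)) ε x| ≤ C / ε ^ Fintype.card ι * ε ^ k := by
  induction k with
  | zero =>
    intro f hf hfc
    simpa using exists_abs_latticeSum_le e (hf.fderiv_apply ℝ (e i))
      (contDiff_fderiv_apply_const hfc (e i)).continuous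
  | succ k ih =>
    intro f hf hfc
    set g := fun y ↦ fderiv ℝ f y (e i)
    have hg : HasCompactSupport g := hf.fderiv_apply ℝ (e i)
    have hgc : ContDiff ℝ ∞ g := contDiff_fderiv_apply_const hfc (e i)
    obtain ⟨C, hC, h⟩ := ih hg hgc
    refine ⟨C, hC, fun x ε hε ↦ ?_⟩
    have hd := fun t ↦ hasDerivAt_latticeSum e hf hfc hε.1 x (e i) t
    have hd2 := fun t ↦ hasDerivAt_latticeSum e hg hgc hε.1 x (e i) t
    obtain ⟨t, ht, ht0⟩ := exists_hasDerivAt_eq_zero (zero_lt_one' ℝ)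
      (fun s _ ↦ (hd s).continuousAt.continuousWithinAt) (by
        rw [zero_smul, one_smul, add_zero,
          latticeSum_add_mem e f ε x (subset_span (mem_range_self i))]) fun s _ ↦ hd s
    have ht1 : latticeSum e g ε (x + t • e i) = 0 := (mul_eq_zero.1 ht0).resolve_left hε.1.ne'
    have h1 := Convex.norm_image_sub_le_of_norm_hasDerivWithin_le
      (f := fun s : ℝ ↦ latticeSum e g ε (x + s • e i)) (s := univ)
      (C := ε * (C / ε ^ Fintype.card ι * ε ^ k))
      (fun s _ ↦ (hd2 s).hasDerivWithinAt) (fun s _ ↦ by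
        rw [norm_mul, Real.norm_of_nonneg hε.1.le, Real.norm_eq_abs]
        exact mul_le_mul_of_nonneg_left (h _ ε hε) hε.1.le) convex_univ (mem_univ t) (mem_univ 0)
    simp only [zero_smul, add_zero, ht1, sub_zero, Real.norm_eq_abs, zero_sub, abs_neg,
      abs_of_pos ht.1] at h1
    refine h1.trans ?_
    have h2 : 0 ≤ ε * (C / ε ^ Fintype.card ι * ε ^ k) := by have := hε.1; positivity
    calc _ ≤ ε * (C / ε ^ Fintype.card ι * ε ^ k) * 1 :=
          mul_le_mul_of_nonneg_left ht.2.le h2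
      _ = _ := by ring

theorem exists_abs_latticeSum_sub_le (e : Basis ι ℝ V) {f : V → ℝ} (hf : HasCompactSupport f)
    (hfc : ContDiff ℝ ∞ f) (k : ℕ) :
    ∃ C : ℝ, 0 ≤ C ∧ ∀ x y, ∀ ε ∈ Ioc (0 : ℝ) 1,
      |latticeSum e f ε x - latticeSum e f ε y| ≤ C * ε ^ k := by
  classical
  choose C hC h using fun i ↦ exists_abs_latticeSum_fderiv_le e i (k + Fintype.card ι) hf hfc
  have hstep : ∀ x i, ∀ t : ℝ, |t| ≤ 1 → ∀ ε ∈ Ioc (0 : ℝ) 1,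
      |latticeSum e f ε (x + t • e i) - latticeSum e f ε x| ≤ C i * ε ^ k := by
    intro x i t ht ε hε
    have hd := fun t ↦ hasDerivAt_latticeSum e hf hfc hε.1 x (e i) t
    have hCk : 0 ≤ C i * ε ^ k := mul_nonneg (hC i) (pow_nonneg hε.1.le _)
    have h1 := Convex.norm_image_sub_le_of_norm_hasDerivWithin_le
      (f := fun s : ℝ ↦ latticeSum e f ε (x + s • e i)) (s := univ)
      (C := C i * ε ^ k)
      (fun s _ ↦ (hd s).hasDerivWithinAt) (fun s _ ↦ by
        rw [norm_mul, Real.norm_of_nonneg hε.1.le, Real.norm_eq_abs]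
        have h2 := h i (x + s • e i) ε hε
        have h3 : C i / ε ^ Fintype.card ι * ε ^ (k + Fintype.card ι) = C i * ε ^ k := by
          have := hε.1
          field_simp
          ring
        rw [h3] at h2
        calc _ ≤ 1 * |_| := mul_le_mul_of_nonneg_right hε.2 (abs_nonneg _)
          _ ≤ _ := by rwa [one_mul]) convex_univ (mem_univ 0) (mem_univ t)
    simp only [zero_smul, add_zero, sub_zero, Real.norm_eq_abs] at h1
    exact h1.trans (mul_le_of_le_one_right hCk ht)
  have hsum : ∀ (c : ι → ℝ), (∀ i, |c i| ≤ 1) → ∀ x, ∀ ε ∈ Ioc (0 : ℝ) 1, ∀ s : Finset ι,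
      |latticeSum e f ε (x + ∑ i ∈ s, c i • e i) - latticeSum e f ε x| ≤
        ∑ i ∈ s, C i * ε ^ k := by
    intro c hc x ε hε s
    induction s using Finset.induction_on with
    | empty => simp
    | insert a s ha ih =>
      rw [Finset.sum_insert ha, Finset.sum_insert ha, add_comm (c a • e a), ← add_assoc]
      refine (abs_sub_le _ (latticeSum e f ε (x + ∑ i ∈ s, c i • e i)) _).trans ?_
      exact add_le_add (hstep _ _ _ (hc a) ε hε) ih
  refine ⟨∑ i, C i, Finset.sum_nonneg fun i _ ↦ hC i, fun x y ε hε ↦ ?_⟩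
  have hred : ∀ x, latticeSum e f ε x = latticeSum e f ε (ZSpan.fract e x) := by
    intro x
    conv_lhs => rw [← sub_add_cancel x (ZSpan.floor e x : V)]
    exact latticeSum_add_mem e f ε _ (ZSpan.floor e x).2
  rw [hred x, hred y]
  have h1 := hsum (fun i ↦ e.repr (ZSpan.fract e x - ZSpan.fract e y) i) (fun i ↦ by
    rw [map_sub, Finsupp.sub_apply, ZSpan.repr_fract_apply, ZSpan.repr_fract_apply, abs_le]
    have a1 := Int.fract_nonneg (e.repr x i)
    have a2 := Int.fract_nonneg (e.repr y i)
    have a3 := Int.fract_lt_one (e.repr x i)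
    have a4 := Int.fract_lt_one (e.repr y i)
    constructor <;> linarith) (ZSpan.fract e y) ε hε Finset.univ
  rw [e.sum_repr, add_sub_cancel] at h1
  rwa [Finset.sum_mul]

theorem continuous_latticeSum_comp (e : Basis ι ℝ V) {f : V → ℝ} (hf : HasCompactSupport f)
    (hfc : Continuous f) {ε : ℝ} (hε : 0 < ε) : Continuous (latticeSum e f ε) := by
  refine continuous_iff_continuousAt.2 fun x ↦ ?_
  have hfin := finite_latticeSum_support e hf hε (‖x‖ + 1)
  have h1 : ∀ y ∈ Metric.ball x 1, latticeSum e f ε y =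
      ∑ l ∈ hfin.toFinset, f (ε • (y + (l : V))) := fun y hy ↦ by
    refine tsum_eq_sum fun l hl ↦ ?_
    by_contra h0
    refine hl (hfin.mem_toFinset.2 ⟨y, ?_, h0⟩)
    rw [Metric.mem_ball, dist_eq_norm] at hy
    have := norm_sub_norm_le y x
    linarith
  refine ContinuousAt.congr ?_ (eventually_of_mem (Metric.ball_mem_nhds x one_pos)
    fun y hy ↦ (h1 y hy).symm)
  fun_prop

variable [MeasurableSpace V] [BorelSpace V]

theorem setIntegral_latticeSum (e : Basis ι ℝ V) (μ : Measure V) [μ.IsAddHaarMeasure]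
    {f : V → ℝ} (hf : HasCompactSupport f) (hfc : Continuous f) {ε : ℝ} (hε : 0 < ε) :
    ∫ x in ZSpan.fundamentalDomain e, latticeSum e f ε x ∂μ =
      (ε ^ Fintype.card ι)⁻¹ * ∫ x, f x ∂μ := by
  obtain ⟨r, hr⟩ := (ZSpan.fundamentalDomain_isBounded e).exists_norm_le
  have hfin := finite_latticeSum_support e hf hε r
  have hint : ∀ v : V, Integrable (fun x ↦ f (ε • (x + v))) μ := fun v ↦ by
    have h1 : Integrable (fun x ↦ f (ε • x)) μ :=
      (hfc.integrable_of_hasCompactSupport hf).comp_smul hε.ne'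
    exact h1.comp_add_right v
  have h1 : ∫ x in ZSpan.fundamentalDomain e, latticeSum e f ε x ∂μ =
      ∫ x in ZSpan.fundamentalDomain e, ∑ l ∈ hfin.toFinset, f (ε • (x + (l : V))) ∂μ := by
    refine setIntegral_congr_fun (ZSpan.fundamentalDomain_measurableSet e) fun x hx ↦ ?_
    refine tsum_eq_sum fun l hl ↦ ?_
    by_contra h0
    exact hl (hfin.mem_toFinset.2 ⟨x, hr x hx, h0⟩)
  rw [h1, integral_finsetSum _ fun (l : span ℤ (Set.range e)) _ ↦ (hint l).integrableOn]
  have : VAddInvariantMeasure (span ℤ (Set.range e)) V μ :=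
    inferInstanceAs (VAddInvariantMeasure (span ℤ (Set.range e)).toAddSubgroup V μ)
  have h2 := (ZSpan.isAddFundamentalDomain e μ).integral_eq_tsum'' (fun x ↦ f (ε • x)) (by
    simpa using hint 0)
  rw [Measure.integral_comp_smul_of_nonneg μ f ε (hR := hε.le), finrank_eq_card_basis e, smul_eq_mul] at h2
  rw [h2]
  symm
  refine (tsum_eq_sum (s := hfin.toFinset) fun l hl ↦ ?_).trans
    (Finset.sum_congr rfl fun l _ ↦ ?_)
  · refine setIntegral_eq_zero_of_forall_eq_zero fun x hx ↦ ?_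
    by_contra h0
    refine hl (hfin.mem_toFinset.2 ⟨x, hr x hx, ?_⟩)
    rw [add_comm]
    exact h0
  · refine setIntegral_congr_fun (ZSpan.fundamentalDomain_measurableSet e) fun x _ ↦ ?_
    simp only [add_comm x]
    rfl

theorem exists_abs_latticeSum_sub_integral_le (e : Basis ι ℝ V) (μ : Measure V)
    [μ.IsAddHaarMeasure] {f : V → ℝ} (hf : HasCompactSupport f) (hfc : ContDiff ℝ ∞ f) (k : ℕ) :
    ∃ C : ℝ, ∀ x, ∀ ε ∈ Ioc (0 : ℝ) 1,
      |latticeSum e f ε x -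
        (∫ x, f x ∂μ) / μ.real (ZSpan.fundamentalDomain e) / ε ^ Fintype.card ι| ≤ C * ε ^ k := by
  obtain ⟨C, hC, h⟩ := exists_abs_latticeSum_sub_le e hf hfc k
  refine ⟨C, fun x ε hε ↦ ?_⟩
  have hD : 0 < μ.real (ZSpan.fundamentalDomain e) :=
    ENNReal.toReal_pos (ZSpan.measure_fundamentalDomain_ne_zero e)
      (ZSpan.fundamentalDomain_isBounded e).measure_lt_top.ne
  have hDfin : μ (ZSpan.fundamentalDomain e) < ⊤ :=
    (ZSpan.fundamentalDomain_isBounded e).measure_lt_top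
  have h1 := setIntegral_latticeSum e μ hf hfc.continuous hε.1
  have hcont := continuous_latticeSum_comp e hf hfc.continuous hε.1
  have h2 : IntegrableOn (latticeSum e f ε) (ZSpan.fundamentalDomain e) μ := by
    obtain ⟨r, hr⟩ := (ZSpan.fundamentalDomain_isBounded e).subset_closedBall 0
    exact (hcont.continuousOn.integrableOn_compact
      (isCompact_closedBall (0 : V) r)).mono_set hr
  have h3 : ‖∫ y in ZSpan.fundamentalDomain e, (latticeSum e f ε x - latticeSum e f ε y) ∂μ‖ ≤
      C * ε ^ k * μ.real (ZSpan.fundamentalDomain e) :=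
    norm_setIntegral_le_of_norm_le_const hDfin fun y _ ↦ h x y ε hε
  rw [integral_sub (integrableOn_const (C := latticeSum e f ε x) hDfin.ne).integrable h2.integrable,
    h1, setIntegral_const, smul_eq_mul,
    Real.norm_eq_abs] at h3
  have h4 : latticeSum e f ε x -
        (∫ x, f x ∂μ) / μ.real (ZSpan.fundamentalDomain e) / ε ^ Fintype.card ι =
      (μ.real (ZSpan.fundamentalDomain e) * latticeSum e f ε x -
        (ε ^ Fintype.card ι)⁻¹ * ∫ x, f x ∂μ) / μ.real (ZSpan.fundamentalDomain e) := by
    have := hε.1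
    field_simp
  rw [h4, abs_div, abs_of_pos hD, div_le_iff₀ hD]
  exact h3

end LatticeSum

end

section

open Set Filter Topology Real
open scoped ContDiff

section PartitionOfUnity

/-- A smooth bump function supported in `[-1, 1]` whose integer translates sum to one. -/
noncomputable def unitBump (y : ℝ) : ℝ := smoothTransition (y + 1) - smoothTransition y

theorem contDiff_unitBump : ContDiff ℝ ∞ unitBump :=
  (smoothTransition.contDiff.comp (contDiff_id.add contDiff_const)).sub smoothTransition.contDiff

theorem unitBump_nonneg (y : ℝ) : 0 ≤ unitBump y :=
  sub_nonneg.2 (smoothTransition.monotone (by linarith))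

theorem unitBump_zero : unitBump 0 = 1 := by simp [unitBump]

theorem abs_le_of_unitBump_ne_zero {y : ℝ} (h : unitBump y ≠ 0) : |y| ≤ 1 := by
  rw [abs_le]
  by_contra! h1
  refine h ?_
  rcases lt_or_ge y (-1) with hy | hy
  · rw [unitBump, smoothTransition.zero_of_nonpos (by linarith),
      smoothTransition.zero_of_nonpos (by linarith), sub_zero]
  · have := h1 hy
    rw [unitBump, smoothTransition.one_of_one_le (by linarith),
      smoothTransition.one_of_one_le (by linarith), sub_self]

theorem exists_sum_unitBump_eq_one (y : ℝ) :
    ∃ s : Finset ℤ, (∀ k ∉ s, unitBump (y + k) = 0) ∧ ∑ k ∈ s, unitBump (y + k) = 1 := by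
  refine ⟨{-⌊y⌋, -⌊y⌋ - 1}, fun k hk ↦ ?_, ?_⟩
  · simp only [Finset.mem_insert, Finset.mem_singleton, not_or] at hk
    have h1 := Int.floor_le y
    have h2 := Int.lt_floor_add_one y
    rcases lt_or_ge k (-⌊y⌋) with h | h
    · have : k + 2 ≤ -⌊y⌋ := by lia
      have : (k : ℝ) + 2 ≤ -⌊y⌋ := by exact_mod_cast this
      rw [unitBump, smoothTransition.zero_of_nonpos (by linarith),
        smoothTransition.zero_of_nonpos (by linarith), sub_zero]
    · have : -⌊y⌋ + 1 ≤ k := by lia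
      have : -(⌊y⌋ : ℝ) + 1 ≤ k := by exact_mod_cast this
      rw [unitBump, smoothTransition.one_of_one_le (by linarith),
        smoothTransition.one_of_one_le (by linarith), sub_self]
  · have h1 := Int.floor_le y
    have h2 := Int.lt_floor_add_one y
    rw [Finset.sum_pair (by lia)]
    push_cast
    rw [unitBump, unitBump, smoothTransition.one_of_one_le (by linarith),
      smoothTransition.zero_of_nonpos (x := y + (-⌊y⌋ - 1)) (by linarith)]
    ring_nf

theorem hasSum_prod_unitBump {ι : Type*} [Fintype ι] (y : ι → ℝ) :
    HasSum (fun k : ι → ℤ ↦ ∏ i, unitBump (y i + k i)) 1 := by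
  classical
  choose s hs hs1 using fun i ↦ exists_sum_unitBump_eq_one (y i)
  have h : ∑ k ∈ Fintype.piFinset s, ∏ i, unitBump (y i + k i) = 1 := by
    rw [← Finset.prod_univ_sum s fun i (k : ℤ) ↦ unitBump (y i + k)]
    exact Finset.prod_eq_one fun i _ ↦ hs1 i
  rw [← h]
  refine hasSum_sum_of_ne_finset_zero fun k hk ↦ ?_
  rw [Fintype.mem_piFinset] at hk
  push Not at hk
  obtain ⟨i, hi⟩ := hk
  exact Finset.prod_eq_zero (Finset.mem_univ i) (hs i _ hi)

theorem exists_hasSum_prod_unitBump {ι U : Type*} [Fintype ι] [Group U] (b : U → ι → ℤ)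
    (hb : ∀ u v, b (u * v) = b u + b v) (hfin : ∀ k, {u | b u = k}.Finite) {M : ℕ} (hM : 0 < M)
    (s : (ι → ℤ) → U) (hs : ∀ k i, b (s k) i = M * k i) :
    ∃ q : ℕ, 0 < q ∧ ∀ y : ι → ℝ, HasSum (fun u : U ↦ ∏ i, unitBump ((y i + b u i) / M)) q := by
  classical
  have hM0 : (0 : ℝ) < M := by exact_mod_cast hM
  have hMz : (0 : ℤ) < M := by exact_mod_cast hM
  let D := {u : U | b u ∈ Set.univ.pi fun _ ↦ Set.Ico (0 : ℤ) M}
  have hD : D.Finite :=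
    (Set.Finite.pi fun _ : ι ↦ Set.finite_Ico (0 : ℤ) (M : ℤ)).preimage' fun k _ ↦ hfin k
  have : Finite D := hD
  have : Fintype D := Fintype.ofFinite D
  have h1 : b 1 = 0 := by
    have := hb 1 1
    rwa [mul_one, left_eq_add] at this
  have hinv : ∀ u, b u⁻¹ = -b u := fun u ↦ by
    have := hb u u⁻¹
    rw [mul_inv_cancel, h1] at this
    exact (neg_eq_of_add_eq_zero_right this.symm).symm
  have : Nonempty D := ⟨⟨1, fun i _ ↦ by rw [h1]; exact ⟨le_rfl, hMz⟩⟩⟩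
  let E : U ≃ D × (ι → ℤ) :=
    { toFun := fun u ↦ (⟨u * (s fun i ↦ b u i / M)⁻¹, fun i _ ↦ by
          rw [hb, hinv, Pi.add_apply, Pi.neg_apply, hs]
          have e1 := Int.emod_add_mul_ediv (b u i) M
          have e2 := Int.emod_nonneg (b u i) hMz.ne'
          have e3 := Int.emod_lt_of_pos (b u i) hMz
          constructor <;> linarith⟩, fun i ↦ b u i / M)
      invFun := fun d ↦ d.1 * s d.2
      left_inv := fun u ↦ by simp
      right_inv := fun d ↦ by
        have h3 : (fun i ↦ b (d.1 * s d.2) i / M) = d.2 := by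
          funext i
          have := d.1.2 i trivial
          rw [hb, Pi.add_apply, hs, Int.add_mul_ediv_left _ _ hMz.ne', Int.ediv_eq_zero_of_lt this.1 this.2, zero_add]
        refine Prod.ext (Subtype.ext ?_) h3
        simp only [h3]
        simp }
  refine ⟨Fintype.card D, Fintype.card_pos, fun y ↦ ?_⟩
  rw [← E.symm.hasSum_iff]
  have h2 : ∀ d : D, HasSum (fun k : ι → ℤ ↦ ((fun u : U ↦ ∏ i, unitBump ((y i + b u i) / M)) ∘
      E.symm) (d, k)) 1 := fun d ↦ by
    have := hasSum_prod_unitBump fun i ↦ (y i + b d i) / M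
    convert this using 3 with k
    refine Finset.prod_congr rfl fun i _ ↦ ?_
    congr 1
    change (y i + (b (d * s k) i : ℝ)) / M = _
    rw [hb, Pi.add_apply, hs]
    push_cast
    field_simp
    ring
  have h3 : Summable ((fun u : U ↦ ∏ i, unitBump ((y i + b u i) / M)) ∘ E.symm) := by
    refine (summable_prod_of_nonneg fun d ↦ Finset.prod_nonneg fun i _ ↦
      unitBump_nonneg _).2 ⟨fun d ↦ (h2 d).summable, (hasSum_fintype _).summable⟩
  rw [h3.hasSum_iff, h3.tsum_prod, tsum_congr fun d ↦ (h2 d).tsum_eq, tsum_fintype]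
  simp

end PartitionOfUnity

theorem exists_isWeight : ∃ w : ℝ → ℝ, IsWeight w ∧ ContDiff ℝ ∞ w := by
  let φ : ContDiffBump (1 / 2 : ℝ) := ⟨1 / 8, 1 / 4, by norm_num, by norm_num⟩
  refine ⟨φ, ⟨φ.continuous, fun u ↦ φ.nonneg, fun u hu ↦ ?_, ?_⟩, φ.contDiff⟩
  · have h : u ∈ Function.support φ := hu
    rw [φ.support_eq, Metric.mem_ball, Real.dist_eq, abs_lt] at h
    have h1 := h.1
    have h2 := h.2
    simp only [φ] at h1 h2
    constructor <;> linarith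
  · exact φ.pos_of_mem_ball (Metric.mem_ball_self φ.rOut_pos)

end

section

open Set Filter Topology NumberField NumberField.InfinitePlace NumberField.mixedEmbedding
open NumberField.Units NumberField.Units.dirichletUnitTheorem MeasureTheory
open scoped ContDiff Classical

section ConeWeight

variable {K : Type*} [Field K] [NumberField K]

/-- The coordinates of `logMap z` with respect to the basis of the unit lattice. -/
noncomputable def unitCoord (z : mixedSpace K) (i : Fin (rank K)) : ℝ :=
  ((basisUnitLattice K).ofZLatticeBasis ℝ (unitLattice K)).repr (logMap z) i

/-- A compactly supported weight on the mixed space, depending on the norm and on the position with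
respect to the unit lattice, and supported on the totally positive part. -/
noncomputable def coneWeight (w : ℝ → ℝ) (M : ℕ) (z : mixedSpace K) : ℝ :=
  if ∀ v, 0 < z.1 v then
    w (mixedEmbedding.norm z) * ∏ i, unitBump (unitCoord z i / M) else 0

variable {w : ℝ → ℝ} {M : ℕ}

theorem coneWeight_nonneg (hw : IsWeight w) (z : mixedSpace K) : 0 ≤ coneWeight w M z := by
  unfold coneWeight
  split_ifs
  · exact mul_nonneg (hw.nonneg _) (Finset.prod_nonneg fun _ _ ↦ unitBump_nonneg _)
  · exact le_rfl

theorem pos_of_coneWeight_ne_zero {z : mixedSpace K} (h : coneWeight w M z ≠ 0) :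
    ∀ v, 0 < z.1 v := by
  by_contra h1
  exact h (if_neg h1)

theorem exists_coneWeight_pos (hw : IsWeight w) : ∃ z : mixedSpace K, 0 < coneWeight w M z := by
  set n := Module.finrank ℚ K
  have hn : n ≠ 0 := Module.finrank_pos.ne'
  set c : ℝ := (1 / 2) ^ ((n : ℝ)⁻¹)
  have hc : 0 < c := by positivity
  have hcn : c ^ n = 1 / 2 := Real.rpow_inv_natCast_pow (by norm_num) hn
  refine ⟨c • 1, ?_⟩
  have h1 : ∀ i, unitCoord (c • (1 : mixedSpace K)) i = 0 := fun i ↦ by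
    simp [unitCoord, logMap_real]
  rw [coneWeight, if_pos]
  · simp only [h1, zero_div, unitBump_zero, Finset.prod_const_one, mul_one]
    rw [mixedEmbedding.norm_smul, map_one, mul_one, abs_of_pos hc, hcn]
    exact hw.pos
  · intro v
    simpa using hc

theorem exists_bound_of_coneWeight_ne_zero (hw : IsWeight w) (hM : 0 < M) :
    ∃ C : ℝ, ∀ z : mixedSpace K, coneWeight w M z ≠ 0 →
      ∀ v, Real.exp (-C) ≤ normAtPlace v z ∧ normAtPlace v z ≤ Real.exp C := by
  have hM0 : (0 : ℝ) < M := by exact_mod_cast hM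
  set B := (basisUnitLattice K).ofZLatticeBasis ℝ (unitLattice K)
  set C₀ := ∑ i, M * ‖B i‖ + Real.log 4
  set C := Real.log 4 + ∑ v : InfinitePlace K, mult v * C₀
  have hlog4 : 0 ≤ Real.log 4 := Real.log_nonneg (by norm_num)
  have hC₀ : 0 ≤ C₀ := by positivity
  have hmult : ∀ v : InfinitePlace K, (1 : ℝ) ≤ mult v := fun v ↦ by exact_mod_cast mult_pos
  have hCC : C₀ ≤ C := by
    have h1 := Finset.single_le_sum (f := fun v : InfinitePlace K ↦ mult v * C₀)
      (fun v _ ↦ by positivity) (Finset.mem_univ w₀)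
    have h2 : C₀ ≤ mult (w₀ : InfinitePlace K) * C₀ := le_mul_of_one_le_left hC₀ (hmult _)
    simp only [C]
    linarith
  refine ⟨C, fun z hz ↦ ?_⟩
  have hpos := pos_of_coneWeight_ne_zero hz
  rw [coneWeight, if_pos hpos] at hz
  have hN := hw.le_of_ne _ (left_ne_zero_of_mul hz)
  have hN0 : 0 < mixedEmbedding.norm z := by linarith [hN.1]
  have hNlog : |Real.log (mixedEmbedding.norm z)| ≤ Real.log 4 := by
    rw [abs_le]
    constructor
    · rw [← Real.log_inv]
      exact Real.log_le_log (by norm_num) (by linarith [hN.1])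
    · exact (Real.log_nonpos hN0.le hN.2).trans hlog4
  have hcoord : ∀ i, |unitCoord z i| ≤ M := fun i ↦ by
    have := abs_le_of_unitBump_ne_zero
      (Finset.prod_ne_zero_iff.1 (right_ne_zero_of_mul hz) i (Finset.mem_univ i))
    rwa [abs_div, Nat.abs_cast, div_le_one hM0] at this
  have hlm : ‖logMap z‖ ≤ ∑ i, M * ‖B i‖ := by
    rw [← B.sum_repr (logMap z)]
    refine (norm_sum_le _ _).trans (Finset.sum_le_sum fun i _ ↦ ?_)
    rw [_root_.norm_smul]
    exact mul_le_mul_of_nonneg_right (hcoord i) (norm_nonneg _)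
  have hne := mixedEmbedding.norm_ne_zero_iff.1 hN0.ne'
  have hlogv : ∀ v : InfinitePlace K, v ≠ w₀ → |Real.log (normAtPlace v z)| ≤ C₀ := by
    intro v hv
    have h1 := (norm_le_pi_norm (logMap z) ⟨v, hv⟩).trans hlm
    rw [logMap_apply, Real.norm_eq_abs, abs_mul, Nat.abs_cast] at h1
    have h2 := (le_mul_of_one_le_left (abs_nonneg _) (hmult v)).trans h1
    have h3 : |Real.log (mixedEmbedding.norm z) * (Module.finrank ℚ K : ℝ)⁻¹| ≤ Real.log 4 := by
      rw [abs_mul]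
      have hn1 : (1 : ℝ) ≤ Module.finrank ℚ K := by exact_mod_cast Module.finrank_pos
      have : |((Module.finrank ℚ K : ℝ))⁻¹| ≤ 1 := by
        rw [abs_inv, Nat.abs_cast]
        exact inv_le_one_of_one_le₀ hn1
      calc _ ≤ Real.log 4 * 1 := mul_le_mul hNlog this (abs_nonneg _) hlog4
        _ = _ := mul_one _
    have h4 := abs_sub_abs_le_abs_sub (Real.log (normAtPlace v z))
      (Real.log (mixedEmbedding.norm z) * (Module.finrank ℚ K : ℝ)⁻¹)
    simp only [C₀]
    linarith
  have hsum : Real.log (mixedEmbedding.norm z) =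
      ∑ v : InfinitePlace K, mult v * Real.log (normAtPlace v z) := by
    rw [mixedEmbedding.norm_apply, Real.log_prod fun v _ ↦ pow_ne_zero _ (hne v)]
    simp_rw [Real.log_pow]
  have hlog0 : |Real.log (normAtPlace w₀ z)| ≤ C := by
    rw [← Finset.add_sum_erase _ _ (Finset.mem_univ w₀)] at hsum
    have h1 : mult (w₀ : InfinitePlace K) * Real.log (normAtPlace w₀ z) =
        Real.log (mixedEmbedding.norm z) -
          ∑ v ∈ Finset.univ.erase w₀, mult v * Real.log (normAtPlace v z) := by linarith
    have h2 : |mult (w₀ : InfinitePlace K) * Real.log (normAtPlace w₀ z)| ≤ C := by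
      rw [h1]
      refine (abs_sub _ _).trans (add_le_add hNlog ((Finset.abs_sum_le_sum_abs _ _).trans ?_))
      refine (Finset.sum_le_sum (g := fun v ↦ mult v * C₀) fun v hv ↦ ?_).trans
        (Finset.sum_le_sum_of_subset_of_nonneg (Finset.erase_subset _ _)
          fun v _ _ ↦ by positivity)
      rw [abs_mul, Nat.abs_cast]
      exact mul_le_mul_of_nonneg_left (hlogv v (Finset.ne_of_mem_erase hv)) (Nat.cast_nonneg _)
    rw [abs_mul, Nat.abs_cast] at h2
    exact (le_mul_of_one_le_left (abs_nonneg _) (hmult _)).trans h2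
  intro v
  have hv : |Real.log (normAtPlace v z)| ≤ C := by
    rcases eq_or_ne v w₀ with rfl | hv
    · exact hlog0
    · exact (hlogv v hv).trans hCC
  have hvpos : 0 < normAtPlace v z := lt_of_le_of_ne (normAtPlace_nonneg _ _) (hne v).symm
  rw [abs_le] at hv
  exact ⟨(Real.le_log_iff_exp_le hvpos).1 hv.1, (Real.log_le_iff_le_exp hvpos).1 hv.2⟩

theorem contDiffAt_normAtPlace {z : mixedSpace K} {v : InfinitePlace K} (h : normAtPlace v z ≠ 0) :
    ContDiffAt ℝ ∞ (normAtPlace v) z := by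
  by_cases hv : IsReal v
  · have e : (normAtPlace v : mixedSpace K → ℝ) = fun x ↦ ‖x.1 ⟨v, hv⟩‖ :=
      funext fun x ↦ normAtPlace_apply_of_isReal hv x
    rw [e] at h ⊢
    have h1 : ContDiffAt ℝ ∞ (fun x : mixedSpace K ↦ x.1 ⟨v, hv⟩) z := by fun_prop
    exact h1.norm ℝ (norm_ne_zero_iff.1 h)
  · have hv := not_isReal_iff_isComplex.1 hv
    have e : (normAtPlace v : mixedSpace K → ℝ) = fun x ↦ ‖x.2 ⟨v, hv⟩‖ :=
      funext fun x ↦ normAtPlace_apply_of_isComplex hv x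
    rw [e] at h ⊢
    have h1 : ContDiffAt ℝ ∞ (fun x : mixedSpace K ↦ x.2 ⟨v, hv⟩) z := by fun_prop
    exact h1.norm ℝ (norm_ne_zero_iff.1 h)

theorem contDiffAt_coneWeight (hws : ContDiff ℝ ∞ w) {z : mixedSpace K}
    (hz : ∀ v, 0 < z.1 v) (hN : mixedEmbedding.norm z ≠ 0) :
    ContDiffAt ℝ ∞ (coneWeight w M) z := by
  have hne := mixedEmbedding.norm_ne_zero_iff.1 hN
  have hnorm : ContDiffAt ℝ ∞ (mixedEmbedding.norm : mixedSpace K → ℝ) z := by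
    have e : (mixedEmbedding.norm : mixedSpace K → ℝ) =
      fun x ↦ ∏ v, (normAtPlace v x) ^ (mult v) := funext fun x ↦ mixedEmbedding.norm_apply x
    rw [e]
    exact contDiffAt_prod fun v _ ↦ (contDiffAt_normAtPlace (hne v)).pow _
  have hlm : ContDiffAt ℝ ∞ (logMap : mixedSpace K → logSpace K) z := by
    rw [contDiffAt_pi]
    intro v
    simp only [logMap_apply]
    exact contDiffAt_const.mul (((contDiffAt_normAtPlace (hne v)).log (hne v)).sub
      ((hnorm.log hN).mul contDiffAt_const))
  have hcoord : ∀ i, ContDiffAt ℝ ∞ (fun x : mixedSpace K ↦ unitCoord x i) z := fun i ↦ by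
    have h1 : ContDiff ℝ ∞ (LinearMap.toContinuousLinearMap
      (((basisUnitLattice K).ofZLatticeBasis ℝ (unitLattice K)).coord i)) :=
      ContinuousLinearMap.contDiff _
    exact h1.contDiffAt.comp z hlm
  have hev : ∀ᶠ x in 𝓝 z, ∀ v, 0 < x.1 v := by
    rw [eventually_all]
    intro v
    exact ((continuous_apply v).comp continuous_fst).continuousAt.eventually_const_lt (hz v)
  refine ContDiffAt.congr_of_eventuallyEq (f := fun x : mixedSpace K ↦
    w (mixedEmbedding.norm x) * ∏ i, unitBump (unitCoord x i / M)) ?_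
    (hev.mono fun x hx ↦ if_pos hx)
  exact (hws.contDiffAt.comp z hnorm).mul (contDiffAt_prod fun i _ ↦
    contDiff_unitBump.contDiffAt.comp z ((hcoord i).div_const _))

/-- A compact set away from the boundary of the totally positive cone. -/
theorem exists_isCompact_coneWeight (hw : IsWeight w) (hM : 0 < M) :
    ∃ A : Set (mixedSpace K), IsCompact A ∧ (∀ z ∉ A, coneWeight w M z = 0) ∧
      ∀ z ∈ A, (∀ v, 0 < z.1 v) ∧ mixedEmbedding.norm z ≠ 0 := by
  obtain ⟨C, hC⟩ := exists_bound_of_coneWeight_ne_zero (K := K) hw hM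
  refine ⟨{z | (∀ v, 0 ≤ z.1 v) ∧
      ∀ v, Real.exp (-C) ≤ normAtPlace v z ∧ normAtPlace v z ≤ Real.exp C}, ?_, ?_, ?_⟩
  · refine Metric.isCompact_of_isClosed_isBounded ?_ ?_
    · simp only [ofPred_and, ofPred_forall]
      refine (isClosed_iInter fun v ↦ isClosed_le continuous_const (by fun_prop)).inter
        (isClosed_iInter fun v ↦ ?_)
      exact (isClosed_le continuous_const (continuous_normAtPlace v)).inter
        (isClosed_le (continuous_normAtPlace v) continuous_const)
    · refine isBounded_iff_forall_norm_le.2 ⟨Real.exp C, fun z hz ↦ ?_⟩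
      rw [norm_eq_sup'_normAtPlace]
      exact Finset.sup'_le _ _ fun v _ ↦ (hz.2 v).2
  · intro z hz
    by_contra h
    exact hz ⟨fun v ↦ (pos_of_coneWeight_ne_zero h v).le, hC z h⟩
  · intro z hz
    have h1 : ∀ v, normAtPlace v z ≠ 0 := fun v ↦ ((Real.exp_pos _).trans_le (hz.2 v).1).ne'
    refine ⟨fun v ↦ lt_of_le_of_ne (hz.1 v) fun h ↦ h1 v ?_, mixedEmbedding.norm_ne_zero_iff.2 h1⟩
    rw [normAtPlace_apply_of_isReal v.2, ← h, norm_zero]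

theorem hasCompactSupport_coneWeight (hw : IsWeight w) (hM : 0 < M) :
    HasCompactSupport (coneWeight w M : mixedSpace K → ℝ) := by
  obtain ⟨A, hA, h, _⟩ := exists_isCompact_coneWeight (K := K) hw hM
  exact HasCompactSupport.intro hA h

theorem contDiff_coneWeight (hw : IsWeight w) (hws : ContDiff ℝ ∞ w) (hM : 0 < M) :
    ContDiff ℝ ∞ (coneWeight w M : mixedSpace K → ℝ) := by
  obtain ⟨A, hA, h, h'⟩ := exists_isCompact_coneWeight (K := K) hw hM
  refine contDiff_iff_contDiffAt.2 fun z ↦ ?_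
  by_cases hz : z ∈ A
  · exact contDiffAt_coneWeight hws (h' z hz).1 (h' z hz).2
  · refine ContDiffAt.congr_of_eventuallyEq (f := fun _ ↦ (0 : ℝ)) contDiffAt_const ?_
    exact eventually_of_mem (hA.isClosed.isOpen_compl.mem_nhds hz) h

theorem integral_coneWeight_pos (hw : IsWeight w) (hws : ContDiff ℝ ∞ w) (hM : 0 < M) :
    0 < ∫ z : mixedSpace K, coneWeight w M z := by
  obtain ⟨z, hz⟩ := exists_coneWeight_pos (K := K) (M := M) hw
  exact (contDiff_coneWeight hw hws hM).continuous.integral_pos_of_hasCompactSupport_nonneg_nonzero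
    (hasCompactSupport_coneWeight hw hM) (coneWeight_nonneg hw) hz.ne'

end ConeWeight

end

section

open Set Filter Topology NumberField NumberField.InfinitePlace NumberField.mixedEmbedding
open NumberField.Units NumberField.Units.dirichletUnitTheorem MeasureTheory
open scoped ContDiff Classical

section ConeWeight

variable {K : Type*} [Field K] [NumberField K]

theorem finite_logEmbedding_eq (l : logSpace K) :
    {u : (𝓞 K)ˣ | logEmbedding K (Additive.ofMul u) = l}.Finite := by
  rcases Set.eq_empty_or_nonempty {u : (𝓞 K)ˣ | logEmbedding K (Additive.ofMul u) = l} with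
    h | ⟨u₀, hu₀⟩
  · rw [h]; exact Set.finite_empty
  · have hfin : (torsion K : Set (𝓞 K)ˣ).Finite :=
      inferInstanceAs (Finite (torsion K))
    refine (hfin.image (· * u₀)).subset fun u hu ↦ ⟨u * u₀⁻¹, ?_, by simp⟩
    rw [SetLike.mem_coe, ← logEmbedding_eq_zero_iff, ofMul_mul, ofMul_inv, map_add, map_neg]
    rw [mem_ofPred_eq] at hu hu₀
    rw [hu, hu₀, add_neg_cancel]

/-- The image of a unit in the unit lattice. -/
noncomputable def unitLatticeMk (u : (𝓞 K)ˣ) : unitLattice K :=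
  ⟨logEmbedding K (Additive.ofMul u), ⟨_, trivial, rfl⟩⟩

theorem coe_unitLatticeMk (u : (𝓞 K)ˣ) :
    (unitLatticeMk u : logSpace K) = logEmbedding K (Additive.ofMul u) := rfl

/-- The integral coordinates of a unit in the unit lattice. -/
noncomputable def unitExponent (u : (𝓞 K)ˣ) (i : Fin (rank K)) : ℤ :=
  (basisUnitLattice K).repr (unitLatticeMk u) i

theorem unitLatticeMk_mul (u v : (𝓞 K)ˣ) :
    unitLatticeMk (u * v) = unitLatticeMk u + unitLatticeMk v :=
  Subtype.ext (map_add (logEmbedding K) (Additive.ofMul u) (Additive.ofMul v))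

theorem unitExponent_mul (u v : (𝓞 K)ˣ) :
    unitExponent (u * v) = unitExponent u + unitExponent v := by
  funext i
  rw [Pi.add_apply, unitExponent, unitExponent, unitExponent, ← Finsupp.add_apply, ← map_add,
    unitLatticeMk_mul]

theorem coe_unitExponent (u : (𝓞 K)ˣ) (i : Fin (rank K)) :
    (unitExponent u i : ℝ) = ((basisUnitLattice K).ofZLatticeBasis ℝ (unitLattice K)).repr
      (logEmbedding K (Additive.ofMul u)) i :=
  ((basisUnitLattice K).ofZLatticeBasis_repr_apply ℝ (unitLattice K) (unitLatticeMk u) i).symm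

theorem unitExponent_prod (k : Fin (rank K) → ℤ) :
    unitExponent (∏ i, fundSystem K i ^ k i) = k := by
  funext i
  have : unitLatticeMk (∏ i, fundSystem K i ^ k i) = ∑ i, k i • basisUnitLattice K i := by
    refine Subtype.ext ?_
    rw [coe_unitLatticeMk, ofMul_prod, map_sum, AddSubmonoidClass.coe_finsetSum]
    refine Finset.sum_congr rfl fun i _ ↦ ?_
    rw [ofMul_zpow, map_zsmul, logEmbedding_fundSystem]
    rfl
  rw [unitExponent, this, (basisUnitLattice K).repr_sum_self]

theorem unitCoord_unit_mul (u : (𝓞 K)ˣ) {z : mixedSpace K} (hz : mixedEmbedding.norm z ≠ 0)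
    (i : Fin (rank K)) :
    unitCoord (mixedEmbedding K u * z) i = unitCoord z i + unitExponent u i := by
  rw [unitCoord, logMap_mul (by rw [norm_unit]; norm_num) hz, logMap_eq_logEmbedding, map_add,
    Finsupp.add_apply, coe_unitExponent, add_comm]
  rfl

theorem exists_hasSum_coneWeight (U : Subgroup (𝓞 K)ˣ)
    (hU : ∀ u ∈ U, ∀ v, 0 < (mixedEmbedding K (u : K)).1 v) {M : ℕ} (hM : 0 < M)
    (hUM : ∀ u : (𝓞 K)ˣ, u ^ M ∈ U) :
    ∃ q : ℕ, 0 < q ∧ ∀ (w : ℝ → ℝ) (z : mixedSpace K), (∀ v, 0 < z.1 v) →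
      mixedEmbedding.norm z ≠ 0 →
      HasSum (fun u : U ↦ coneWeight w M (mixedEmbedding K ((u : (𝓞 K)ˣ) : K) * z))
        (q * w (mixedEmbedding.norm z)) := by
  obtain ⟨q, hq, h⟩ := exists_hasSum_prod_unitBump (ι := Fin (rank K)) (U := U)
    (fun u ↦ unitExponent (u : (𝓞 K)ˣ)) (fun u v ↦ by simp [unitExponent_mul])
    (fun k ↦ by
      refine Set.Finite.preimage (f := ((↑) : U → (𝓞 K)ˣ))
        (s := {u | unitExponent u = k}) Subtype.val_injective.injOn ?_
      refine (finite_logEmbedding_eq (∑ i, k i • (basisUnitLattice K i : logSpace K))).subset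
        fun u hu ↦ ?_
      rw [mem_ofPred_eq] at hu ⊢
      rw [← coe_unitLatticeMk, ← (basisUnitLattice K).sum_repr (unitLatticeMk u),
        AddSubmonoidClass.coe_finsetSum, ← hu]
      rfl) hM
    (fun k ↦ ⟨∏ i, (fundSystem K i ^ M) ^ k i, Subgroup.prod_mem _ fun i _ ↦
      Subgroup.zpow_mem _ (hUM _) _⟩) fun k i ↦ by
        have : ∏ i, (fundSystem K i ^ M) ^ k i = ∏ i, fundSystem K i ^ (M * k i) :=
          Finset.prod_congr rfl fun i _ ↦ by rw [zpow_mul, zpow_natCast]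
        simp only [this, unitExponent_prod]
  refine ⟨q, hq, fun w z hz hN ↦ ?_⟩
  have h1 := (h fun i ↦ unitCoord z i).mul_left (w (mixedEmbedding.norm z))
  rw [mul_comm]
  suffices h2 : (fun u : U ↦ coneWeight w M (mixedEmbedding K ((u : (𝓞 K)ˣ) : K) * z)) =
      fun u : U ↦ w (mixedEmbedding.norm z) *
        ∏ i, unitBump ((unitCoord z i + unitExponent (u : (𝓞 K)ˣ) i) / M) by
    rw [h2]
    exact h1
  funext u
  unfold coneWeight
  rw [if_pos]
  · rw [map_mul, norm_unit, one_mul]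
    simp_rw [unitCoord_unit_mul _ hN]
  · intro v
    exact mul_pos (hU u u.2 v) (hz v)

end ConeWeight

end

section

open NumberField

section RayClass

variable {K : Type*} [Field K] [NumberField K]

/-- The nonzero ideals coprime to `m`. -/
def coprimeIdeals (m : Ideal (𝓞 K)) : Submonoid (Ideal (𝓞 K)) where
  carrier := {I | I ≠ ⊥ ∧ IsCoprime I m}
  one_mem' := ⟨one_ne_zero, isCoprime_one_left⟩
  mul_mem' hI hJ := ⟨mul_ne_zero hI.1 hJ.1, hI.2.mul_left hJ.2⟩

/-- The nonzero totally positive integers congruent to `1` modulo `m`. -/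
def rayMonoid (m : Ideal (𝓞 K)) : Submonoid (𝓞 K) where
  carrier := {α | α ≠ 0 ∧ α - 1 ∈ m ∧ ∀ σ : K →+* ℝ, 0 < σ (algebraMap (𝓞 K) K α)}
  one_mem' := ⟨one_ne_zero, by simp, by simp⟩
  mul_mem' := by
    rintro α β ⟨h1, h2, h3⟩ ⟨h4, h5, h6⟩
    refine ⟨mul_ne_zero h1 h4, ?_, fun σ ↦ ?_⟩
    · have : α * β - 1 = α * (β - 1) + (α - 1) := by ring
      rw [this]
      exact m.add_mem (m.mul_mem_left _ h5) h2
    · rw [map_mul, map_mul]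
      exact mul_pos (h3 σ) (h6 σ)

variable {m : Ideal (𝓞 K)}

theorem mem_coprimeIdeals {I : Ideal (𝓞 K)} :
    I ∈ coprimeIdeals m ↔ I ≠ ⊥ ∧ IsCoprime I m := Iff.rfl

theorem mul_mem_coprimeIdeals_iff {I J : Ideal (𝓞 K)} :
    I * J ∈ coprimeIdeals m ↔ I ∈ coprimeIdeals m ∧ J ∈ coprimeIdeals m := by
  simp only [mem_coprimeIdeals, IsCoprime.mul_left_iff, ← Ideal.zero_eq_bot, mul_ne_zero_iff]
  tauto

theorem mem_rayMonoid_of_mul {α β : 𝓞 K} (hα : α ∈ rayMonoid m) (h : α * β ∈ rayMonoid m) :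
    β ∈ rayMonoid m := by
  obtain ⟨h1, h2, h3⟩ := hα
  obtain ⟨h4, h5, h6⟩ := h
  refine ⟨right_ne_zero_of_mul h4, ?_, fun σ ↦ ?_⟩
  · have : β - 1 = (α * β - 1) - (α - 1) * β := by ring
    rw [this]
    exact m.sub_mem h5 (m.mul_mem_right _ h2)
  · have := h6 σ
    rw [map_mul, map_mul] at this
    exact (mul_pos_iff_of_pos_left (h3 σ)).1 this

theorem span_mem_coprimeIdeals {α : 𝓞 K} (hα : α ∈ rayMonoid m) :
    Ideal.span {α} ∈ coprimeIdeals m := by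
  refine ⟨by simpa using hα.1, Ideal.isCoprime_iff_exists.2
    ⟨α, Ideal.mem_span_singleton_self α, 1 - α, ?_, by ring⟩⟩
  rw [← neg_sub]
  exact m.neg_mem hα.2.1

/-- Two ideals are equivalent if they differ by the quotient of two elements of `rayMonoid m`. -/
def rayCon (m : Ideal (𝓞 K)) : Con (coprimeIdeals m) where
  r I J := ∃ α ∈ rayMonoid m, ∃ β ∈ rayMonoid m,
    Ideal.span {α} * (I : Ideal (𝓞 K)) = Ideal.span {β} * (J : Ideal (𝓞 K))
  iseqv := by
    refine ⟨fun I ↦ ⟨1, one_mem _, 1, one_mem _, rfl⟩,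
      fun ⟨α, hα, β, hβ, h⟩ ↦ ⟨β, hβ, α, hα, h.symm⟩, ?_⟩
    rintro I J L ⟨α, hα, β, hβ, h⟩ ⟨α', hα', β', hβ', h'⟩
    refine ⟨α' * α, mul_mem hα' hα, β * β', mul_mem hβ hβ', ?_⟩
    rw [← Ideal.span_singleton_mul_span_singleton, ← Ideal.span_singleton_mul_span_singleton,
      mul_assoc, h, mul_assoc, ← h', mul_left_comm]
  mul' := by
    rintro I J I' J' ⟨α, hα, β, hβ, h⟩ ⟨α', hα', β', hβ', h'⟩
    refine ⟨α * α', mul_mem hα hα', β * β', mul_mem hβ hβ', ?_⟩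
    rw [← Ideal.span_singleton_mul_span_singleton, ← Ideal.span_singleton_mul_span_singleton,
      Submonoid.coe_mul, Submonoid.coe_mul, mul_mul_mul_comm, h, h', mul_mul_mul_comm]

/-- The narrow ray class group of modulus `m`. -/
def RayClassGroup (m : Ideal (𝓞 K)) : Type _ := (rayCon m).Quotient

namespace RayClassGroup

instance : CommMonoid (RayClassGroup m) := inferInstanceAs (CommMonoid (rayCon m).Quotient)

/-- The ray class of an ideal coprime to `m`. -/
def mk : coprimeIdeals m →* RayClassGroup m := (rayCon m).mk'

theorem mk_surjective : Function.Surjective (mk (m := m)) := Con.mk'_surjective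

theorem mk_eq_mk_iff {I J : coprimeIdeals m} : mk I = mk J ↔
    ∃ α ∈ rayMonoid m, ∃ β ∈ rayMonoid m,
      Ideal.span {α} * (I : Ideal (𝓞 K)) = Ideal.span {β} * (J : Ideal (𝓞 K)) :=
  Con.eq (rayCon m)

theorem mk_eq_one_iff {J : coprimeIdeals m} : mk J = 1 ↔
    ∃ γ ∈ rayMonoid m, (J : Ideal (𝓞 K)) = Ideal.span {γ} := by
  rw [← map_one (mk (m := m)), mk_eq_mk_iff]
  constructor
  · rintro ⟨α, hα, β, hβ, h⟩
    rw [OneMemClass.coe_one, mul_one] at h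
    have h1 : β ∈ Ideal.span {α} * (J : Ideal (𝓞 K)) := h ▸ Ideal.mem_span_singleton_self β
    obtain ⟨γ, hγ, rfl⟩ := Ideal.mem_span_singleton_mul.1 h1
    refine ⟨γ, mem_rayMonoid_of_mul hα hβ, ?_⟩
    rw [← Ideal.span_singleton_mul_span_singleton] at h
    exact mul_left_cancel₀ (by simpa using hα.1) h
  · rintro ⟨γ, hγ, h⟩
    exact ⟨1, one_mem _, γ, hγ, by rw [h]; simp [Ideal.span_singleton_one]⟩

theorem mul_left_cancel' {x y z : RayClassGroup m} (h : x * y = x * z) : y = z := by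
  obtain ⟨I, rfl⟩ := mk_surjective x
  obtain ⟨J, rfl⟩ := mk_surjective y
  obtain ⟨J', rfl⟩ := mk_surjective z
  rw [← map_mul, ← map_mul, mk_eq_mk_iff] at h
  obtain ⟨α, hα, β, hβ, h⟩ := h
  refine mk_eq_mk_iff.2 ⟨α, hα, β, hβ, mul_left_cancel₀ I.2.1 ?_⟩
  rwa [Submonoid.coe_mul, Submonoid.coe_mul, mul_left_comm, mul_left_comm _ (I : Ideal (𝓞 K))] at h

end RayClassGroup

theorem isUnit_mk_of_isCoprime {β : 𝓞 K} (h : IsCoprime (Ideal.span {β}) m) :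
    IsUnit (Ideal.Quotient.mk m β) := by
  obtain ⟨a, ha, b, hb, hab⟩ := Ideal.isCoprime_iff_exists.1 h
  obtain ⟨c, rfl⟩ := Ideal.mem_span_singleton'.1 ha
  refine IsUnit.of_mul_eq_one (Ideal.Quotient.mk m c) ?_
  rw [← map_mul, ← map_one (Ideal.Quotient.mk m), Ideal.Quotient.eq, ← hab, mul_comm]
  simpa using hb

theorem exists_mul_mem_rayMonoid (hm : m ≠ ⊥) {β : 𝓞 K} (hβ : Ideal.span {β} ∈ coprimeIdeals m) :
    ∃ γ : 𝓞 K, γ ≠ 0 ∧ γ * β ∈ rayMonoid m ∧ ∀ β' : 𝓞 K, β' ≠ 0 → β' - β ∈ m →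
      (∀ σ : K →+* ℝ, SignType.sign (σ (algebraMap (𝓞 K) K β')) =
        SignType.sign (σ (algebraMap (𝓞 K) K β))) → γ * β' ∈ rayMonoid m := by
  have hfin : Finite (𝓞 K ⧸ m) := Ideal.finiteQuotientOfFreeOfNeBot m hm
  have hβ0 : β ≠ 0 := by simpa using hβ.1
  set N := Nat.card (𝓞 K ⧸ m)ˣ
  have hN : 0 < N := Nat.card_pos
  obtain ⟨n, hn⟩ : ∃ n, n + 1 = 2 * N := ⟨2 * N - 1, by omega⟩
  have h1 : (Ideal.Quotient.mk m β) ^ (n + 1) = 1 := by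
    obtain ⟨u, hu⟩ := isUnit_mk_of_isCoprime hβ.2
    rw [← hu, hn, mul_comm, pow_mul, ← Units.val_pow_eq_pow_val, pow_card_eq_one', Units.val_one,
      one_pow]
  have key : ∀ β' : 𝓞 K, β' ≠ 0 → β' - β ∈ m →
      (∀ σ : K →+* ℝ, SignType.sign (σ (algebraMap (𝓞 K) K β')) =
        SignType.sign (σ (algebraMap (𝓞 K) K β))) → β ^ n * β' ∈ rayMonoid m := by
    intro β' hβ' h2 h3
    refine ⟨mul_ne_zero (pow_ne_zero _ hβ0) hβ', ?_, fun σ ↦ ?_⟩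
    · rw [← Ideal.Quotient.eq, map_mul, map_pow, Ideal.Quotient.eq.2 h2, ← pow_succ, h1, map_one]
    · rw [← sign_eq_one_iff, map_mul, map_mul, sign_mul, h3 σ, ← sign_mul, ← map_mul, ← map_mul,
        ← pow_succ, hn, map_pow, map_pow, sign_eq_one_iff, pow_mul]
      have : σ (algebraMap (𝓞 K) K β) ≠ 0 := by simpa using hβ0
      positivity
  exact ⟨β ^ n, pow_ne_zero _ hβ0, key β hβ0 (by simp) fun _ ↦ rfl, key⟩

theorem mk_eq_mk_of_span {I I' J : coprimeIdeals m} (hm : m ≠ ⊥) {β β' : 𝓞 K}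
    (hI : (J * I : Ideal (𝓞 K)) = Ideal.span {β}) (hI' : (J * I' : Ideal (𝓞 K)) = Ideal.span {β'})
    (h : β' - β ∈ m) (hs : ∀ σ : K →+* ℝ, SignType.sign (σ (algebraMap (𝓞 K) K β')) =
      SignType.sign (σ (algebraMap (𝓞 K) K β))) :
    RayClassGroup.mk I = RayClassGroup.mk I' := by
  obtain ⟨γ, hγ0, hγ, hγ'⟩ := exists_mul_mem_rayMonoid hm (hI ▸ mul_mem J.2 I.2)
  have hβ' : β' ≠ 0 := by
    have := (mul_mem J.2 I'.2).1
    rw [hI'] at this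
    simpa using this
  refine RayClassGroup.mk_eq_mk_iff.2 ⟨γ * β', hγ' β' hβ' h hs, γ * β, hγ,
    mul_left_cancel₀ J.2.1 ?_⟩
  rw [mul_left_comm, hI, mul_left_comm, hI', Ideal.span_singleton_mul_span_singleton,
    Ideal.span_singleton_mul_span_singleton]
  congr 2
  ring

theorem finite_rayClassGroup (hm : m ≠ ⊥) : Finite (RayClassGroup m) := by
  have hfin : Finite (𝓞 K ⧸ m) := Ideal.finiteQuotientOfFreeOfNeBot m hm
  let c : coprimeIdeals m → ClassGroup (𝓞 K) := fun I ↦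
    ClassGroup.mk0 ⟨I, mem_nonZeroDivisors_of_ne_zero I.2.1⟩
  have hc : ∀ I J, c (I * J) = c I * c J := fun I J ↦ by
    simp only [c, ← map_mul]
    rfl
  have hex : ∀ I : coprimeIdeals m, ∃ β : 𝓞 K,
      ((Function.invFun c (c I) ^ (Fintype.card (ClassGroup (𝓞 K)) - 1) : coprimeIdeals m) :
        Ideal (𝓞 K)) * I = Ideal.span {β} := fun I ↦ by
    have h1 : c (Function.invFun c (c I) ^ (Fintype.card (ClassGroup (𝓞 K)) - 1) * I) = 1 := by
      have hpow : ∀ (J : coprimeIdeals m) (k : ℕ), c (J ^ k) = c J ^ k := fun J k ↦ by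
        simp only [c, ← map_pow]
        rfl
      have hinv : c (Function.invFun c (c I)) = c I := Function.invFun_eq ⟨I, rfl⟩
      rw [hc, hpow, hinv, ← pow_succ,
        Nat.sub_add_cancel Fintype.card_pos, pow_card_eq_one]
    have h2 := (ClassGroup.mk0_eq_one_iff _).1 h1
    obtain ⟨β, hβ⟩ := h2.principal
    exact ⟨β, hβ⟩
  choose β hβ using hex
  let F : coprimeIdeals m → ClassGroup (𝓞 K) × (𝓞 K ⧸ m) × ((K →+* ℝ) → SignType) := fun I ↦
    (c I, Ideal.Quotient.mk m (β I), fun σ ↦ SignType.sign (σ (algebraMap (𝓞 K) K (β I))))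
  have hF : ∀ I I', F I = F I' → RayClassGroup.mk I = RayClassGroup.mk I' := fun I I' h ↦ by
    simp only [F, Prod.mk.injEq] at h
    have h1 := hβ I
    rw [h.1] at h1
    exact mk_eq_mk_of_span hm h1 (hβ I') (Ideal.Quotient.eq.1 h.2.1.symm)
      fun σ ↦ (congrFun h.2.2 σ).symm
  refine Finite.of_injective (fun x ↦ F (Function.surjInv RayClassGroup.mk_surjective x))
    fun x y h ↦ ?_
  rw [← Function.surjInv_eq RayClassGroup.mk_surjective x,
    ← Function.surjInv_eq RayClassGroup.mk_surjective y]
  exact hF _ _ h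

namespace RayClassGroup

theorem isUnit (hm : m ≠ ⊥) (x : RayClassGroup m) : IsUnit x := by
  have := finite_rayClassGroup hm
  have hinj : Function.Injective (x * ·) := fun _ _ h ↦ mul_left_cancel' h
  obtain ⟨y, hy⟩ := Finite.surjective_of_injective hinj 1
  exact IsUnit.of_mul_eq_one y hy

noncomputable instance [NeZero m] : CommGroup (RayClassGroup m) :=
  commGroupOfIsUnit (isUnit (NeZero.ne m))

instance [NeZero m] : Finite (RayClassGroup m) := finite_rayClassGroup (NeZero.ne m)

open Classical in
/-- The ray class of an ideal, or zero if the ideal is not coprime to `m`. -/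
noncomputable def ofIdeal (m : Ideal (𝓞 K)) : Ideal (𝓞 K) →*₀ WithZero (RayClassGroup m) where
  toFun I := if h : I ∈ coprimeIdeals m then (mk ⟨I, h⟩ : RayClassGroup m) else 0
  map_zero' := dif_neg fun h ↦ h.1 rfl
  map_one' := by
    rw [dif_pos (one_mem _), ← WithZero.coe_one, WithZero.coe_inj]
    exact map_one mk
  map_mul' I J := by
    by_cases hI : I ∈ coprimeIdeals m
    · by_cases hJ : J ∈ coprimeIdeals m
      · rw [dif_pos hI, dif_pos hJ, dif_pos (mul_mem hI hJ), ← WithZero.coe_mul, ← map_mul]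
        rfl
      · rw [dif_neg hJ, dif_neg fun h ↦ hJ (mul_mem_coprimeIdeals_iff.1 h).2, mul_zero]
    · rw [dif_neg hI, dif_neg fun h ↦ hI (mul_mem_coprimeIdeals_iff.1 h).1, zero_mul]

theorem ofIdeal_eq_coe_iff {I : Ideal (𝓞 K)} {g : RayClassGroup m} :
    ofIdeal m I = g ↔ ∃ h : I ∈ coprimeIdeals m, mk ⟨I, h⟩ = g := by
  by_cases h : I ∈ coprimeIdeals m
  · simp [ofIdeal, h]
  · simp [ofIdeal, h]

theorem ofIdeal_ne_zero_iff {I : Ideal (𝓞 K)} :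
    ofIdeal m I ≠ 0 ↔ I ∈ coprimeIdeals m := by
  by_cases h : I ∈ coprimeIdeals m
  · simp [ofIdeal, h]
  · simp [ofIdeal, h]

theorem ofIdeal_eq_iff {b : coprimeIdeals m} {g : RayClassGroup m} (hb : mk b * g = 1)
    {I : Ideal (𝓞 K)} :
    ofIdeal m I = g ↔ ∃ γ ∈ rayMonoid m, I * b = Ideal.span {γ} := by
  rw [ofIdeal_eq_coe_iff]
  constructor
  · rintro ⟨h, rfl⟩
    rw [mul_comm, ← map_mul] at hb
    exact mk_eq_one_iff.1 hb
  · rintro ⟨γ, hγ, h⟩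
    have hI : I ∈ coprimeIdeals m := by
      have := span_mem_coprimeIdeals hγ
      rw [← h] at this
      exact (mul_mem_coprimeIdeals_iff.1 this).1
    refine ⟨hI, mul_left_cancel' (x := mk b) ?_⟩
    rw [hb, ← map_mul]
    exact mk_eq_one_iff.2 ⟨γ, hγ, by rw [← h, mul_comm]; rfl⟩

end RayClassGroup

end RayClass

end

section

open NumberField

section RayUnits

variable {K : Type*} [Field K] [NumberField K]

theorem tsum_classCount {G : Type*} [CommGroup G] [Finite G] (cl : Ideal (𝓞 K) →*₀ WithZero G)
    (g : G) {f : ℕ → ℝ} (hf : f.support.Finite) :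
    ∑' I : {I : Ideal (𝓞 K) // cl I = g}, f (Ideal.absNorm (I : Ideal (𝓞 K))) =
      ∑' n : ℕ, classCount cl g n * f n := by
  set N : {I : Ideal (𝓞 K) // cl I = g} → ℕ := fun I ↦ Ideal.absNorm (I : Ideal (𝓞 K))
  have hfib : ∀ n, Nat.card (N ⁻¹' {n}) = classCount cl g n := fun n ↦ by
    classical
    rw [classCount, ← Fintype.card_coe, ← Nat.card_eq_fintype_card]
    refine Nat.card_congr ⟨fun I ↦ ⟨I.1.1, ?_⟩, fun I ↦ ⟨⟨I.1, ?_⟩, ?_⟩, fun _ ↦ rfl, fun _ ↦ rfl⟩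
    · exact Finset.mem_filter.2 ⟨mem_normFiber.2 I.2, I.1.2⟩
    · exact (Finset.mem_filter.1 I.2).2
    · exact mem_normFiber.1 (Finset.mem_filter.1 I.2).1
  have hfin : ∀ n, Finite (N ⁻¹' {n}) := fun n ↦ by
    refine Finite.of_injective (fun I : N ⁻¹' {n} ↦ (⟨I.1.1, mem_normFiber.2 I.2⟩ :
      normFiber K n)) fun I J h ↦ ?_
    exact Subtype.ext (Subtype.ext (by simpa using h))
  have hs : Summable fun I ↦ f (N I) := by
    refine summable_of_hasFiniteSupport ?_
    refine (hf.biUnion fun n _ ↦ (N ⁻¹' {n}).toFinite).subset fun I hI ↦ ?_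
    exact Set.mem_biUnion (x := N I) hI rfl
  rw [← (hs.hasSum.tsum_fiberwise N).tsum_eq]
  refine tsum_congr fun n ↦ ?_
  rw [← hfib, tsum_congr (g := fun _ ↦ f n) fun b ↦ congrArg f b.2, tsum_const, nsmul_eq_mul]

variable {m : Ideal (𝓞 K)}

/-- The totally positive units congruent to `1` modulo `m`. -/
def rayUnits (m : Ideal (𝓞 K)) : Subgroup (𝓞 K)ˣ where
  carrier := {u | (u : 𝓞 K) ∈ rayMonoid m}
  one_mem' := one_mem (rayMonoid m)
  mul_mem' hu hv := (rayMonoid m).mul_mem hu hv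
  inv_mem' {u} hu := mem_rayMonoid_of_mul hu (by rw [Units.mul_inv]; exact one_mem _)

theorem mem_rayUnits {u : (𝓞 K)ˣ} : u ∈ rayUnits m ↔ (u : 𝓞 K) ∈ rayMonoid m := Iff.rfl

theorem exists_pow_mem_rayUnits (hm : m ≠ ⊥) : ∃ M, 0 < M ∧ ∀ u : (𝓞 K)ˣ, u ^ M ∈ rayUnits m := by
  have hfin : Finite (𝓞 K ⧸ m) := Ideal.finiteQuotientOfFreeOfNeBot m hm
  set N := Nat.card (𝓞 K ⧸ m)ˣ
  have hN : 0 < N := Nat.card_pos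
  refine ⟨N * 2, by omega, fun u ↦ mem_rayUnits.2 ⟨Units.ne_zero _, ?_, fun σ ↦ ?_⟩⟩
  · rw [← Ideal.Quotient.eq, map_one, Units.val_pow_eq_pow_val, map_pow]
    have h1 : Ideal.Quotient.mk m (u : 𝓞 K) = Units.map (Ideal.Quotient.mk m).toMonoidHom u := rfl
    rw [h1, ← Units.val_pow_eq_pow_val, pow_mul, pow_card_eq_one', one_pow, Units.val_one]
  · rw [Units.val_pow_eq_pow_val, map_pow, map_pow, pow_mul]
    have : σ (algebraMap (𝓞 K) K u) ≠ 0 := by simp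
    positivity

theorem exists_mem_rayUnits {γ γ' : 𝓞 K} (hγ : γ ∈ rayMonoid m) (hγ' : γ' ∈ rayMonoid m)
    (h : Ideal.span {γ} = Ideal.span {γ'}) : ∃ u ∈ rayUnits m, γ' = (u : 𝓞 K) * γ := by
  obtain ⟨u, hu⟩ := Ideal.span_singleton_eq_span_singleton.1 h
  refine ⟨u, mem_rayMonoid_of_mul hγ (hu ▸ hγ'), by rw [← hu, mul_comm]⟩

theorem mixedEmbedding_pos_iff {x : K} :
    (∀ v, 0 < (mixedEmbedding K x).1 v) ↔ ∀ σ : K →+* ℝ, 0 < σ x := by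
  constructor
  · intro h σ
    set φ : K →+* ℂ := Complex.ofRealHom.comp σ
    have hφ : ComplexEmbedding.IsReal φ := by
      rw [ComplexEmbedding.isReal_iff]
      ext y
      simp [φ]
    have hv : (InfinitePlace.mk φ).IsReal := ⟨φ, hφ, rfl⟩
    have h1 := h ⟨_, hv⟩
    rw [mixedEmbedding.mixedEmbedding_apply_isReal] at h1
    have h2 := InfinitePlace.embedding_of_isReal_apply hv x
    rw [InfinitePlace.embedding_mk_eq_of_isReal hφ] at h2
    have h3 : InfinitePlace.embedding_of_isReal hv x = σ x := Complex.ofReal_injective h2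
    rwa [h3] at h1
  · intro h v
    rw [mixedEmbedding.mixedEmbedding_apply_isReal]
    exact h _

end RayUnits

end

section

open Set Filter Topology NumberField NumberField.InfinitePlace NumberField.mixedEmbedding
open MeasureTheory
open scoped ContDiff Classical

section RaySum

variable {K : Type*} [Field K] [NumberField K] {m : Ideal (𝓞 K)} {w : ℝ → ℝ} {M : ℕ}

theorem norm_ne_zero_of_coneWeight (hw : IsWeight w) {z : mixedSpace K}
    (h : coneWeight w M z ≠ 0) : mixedEmbedding.norm z ≠ 0 := by
  intro h0
  have hpos := pos_of_coneWeight_ne_zero h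
  rw [coneWeight, if_pos hpos, h0] at h
  linarith [(hw.le_of_ne _ (left_ne_zero_of_mul h)).1]

/-- The product of `b` and `m` as an invertible fractional ideal. -/
noncomputable def rayFractionalIdeal (hm : m ≠ ⊥) (b : coprimeIdeals m) :
    (FractionalIdeal (nonZeroDivisors (𝓞 K)) K)ˣ :=
  FractionalIdeal.mk0 K ⟨b * m, mem_nonZeroDivisors_of_ne_zero (mul_ne_zero b.2.1 hm)⟩

theorem mem_rayFractionalIdeal_iff (hm : m ≠ ⊥) (b : coprimeIdeals m) {z : mixedSpace K} :
    z ∈ Submodule.span ℤ (Set.range (fractionalIdealLatticeBasis K (rayFractionalIdeal hm b))) ↔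
      ∃ y : 𝓞 K, y ∈ (b : Ideal (𝓞 K)) ∧ y ∈ m ∧ mixedEmbedding K (y : K) = z := by
  rw [mem_span_fractionalIdealLatticeBasis]
  have h1 : (b : Ideal (𝓞 K)) * m = (b : Ideal (𝓞 K)) ⊓ m := Ideal.mul_eq_inf_of_isCoprime b.2.2
  constructor
  · rintro ⟨x, hx, rfl⟩
    obtain ⟨y, hy, rfl⟩ := (FractionalIdeal.mem_coeIdeal _).1 hx
    have hy' : y ∈ (b : Ideal (𝓞 K)) * m := hy
    rw [h1] at hy'
    exact ⟨y, hy'.1, hy'.2, rfl⟩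
  · rintro ⟨y, hy, hy', rfl⟩
    refine ⟨y, (FractionalIdeal.mem_coeIdeal _).2 ⟨y, ?_, rfl⟩, rfl⟩
    show y ∈ (b : Ideal (𝓞 K)) * m
    rw [h1]
    exact ⟨hy, hy'⟩

/-- The elements of `rayMonoid m` lying in the ideal `b`. -/
abbrev RayElement (b : coprimeIdeals m) : Type _ :=
  {γ : 𝓞 K // γ ∈ rayMonoid m ∧ γ ∈ (b : Ideal (𝓞 K))}

theorem hasSum_rayElement (hm : m ≠ ⊥) (b : coprimeIdeals m) (hw : IsWeight w) (hM : 0 < M)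
    {γ₀ : 𝓞 K} (hb₀ : γ₀ ∈ (b : Ideal (𝓞 K))) (hm₀ : γ₀ - 1 ∈ m) {ε : ℝ} (hε : 0 < ε) :
    HasSum (fun γ : RayElement b ↦ coneWeight w M (ε • mixedEmbedding K ((γ : 𝓞 K) : K)))
      (latticeSum (fractionalIdealLatticeBasis K (rayFractionalIdeal hm b)) (coneWeight w M) ε
        (mixedEmbedding K (γ₀ : K))) := by
  set e := fractionalIdealLatticeBasis K (rayFractionalIdeal hm b)
  let j : RayElement b → Submodule.span ℤ (Set.range e) := fun γ ↦
    ⟨mixedEmbedding K ((γ : 𝓞 K) : K) - mixedEmbedding K (γ₀ : K),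
      (mem_rayFractionalIdeal_iff hm b).2 ⟨γ - γ₀, Ideal.sub_mem _ γ.2.2 hb₀, by
        have := m.sub_mem γ.2.1.2.1 hm₀
        rwa [sub_sub_sub_cancel_right] at this, by push_cast; rw [map_sub]⟩⟩
  have hj : Function.Injective j := fun γ γ' h ↦ by
    have h1 := congrArg Subtype.val h
    simp only [j, sub_left_inj] at h1
    exact Subtype.ext (RingOfIntegers.ext (mixedEmbedding_injective K h1))
  set F : Submodule.span ℤ (Set.range e) → ℝ := fun l ↦
    coneWeight w M (ε • (mixedEmbedding K (γ₀ : K) + (l : mixedSpace K)))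
  have hFj : ∀ γ, F (j γ) = coneWeight w M (ε • mixedEmbedding K ((γ : 𝓞 K) : K)) := fun γ ↦ by
    simp only [F, j, add_sub_cancel]
  have hsupp : Function.support F ⊆ Set.range j := by
    intro l hl
    obtain ⟨y, hyb, hym, hy⟩ := (mem_rayFractionalIdeal_iff hm b).1 l.2
    have hl' : coneWeight w M (ε • mixedEmbedding K ((γ₀ + y : 𝓞 K) : K)) ≠ 0 := by
      have h2 : F l ≠ 0 := hl
      simp only [F, ← hy, ← map_add] at h2
      push_cast
      exact h2
    have hpos := pos_of_coneWeight_ne_zero hl'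
    have hnorm := norm_ne_zero_of_coneWeight hw hl'
    refine ⟨⟨γ₀ + y, ⟨?_, ?_, mixedEmbedding_pos_iff.1 fun v ↦ ?_⟩, Ideal.add_mem _ hb₀ hyb⟩, ?_⟩
    · rintro h0
      rw [h0] at hnorm
      simp at hnorm
    · have := m.add_mem hm₀ hym
      rwa [sub_add_eq_add_sub] at this
    · have := hpos v
      exact (mul_pos_iff_of_pos_left hε).1 this
    · refine Subtype.ext ?_
      simp only [j]
      rw [← hy]
      push_cast
      rw [map_add, add_sub_cancel_left]
  have hsum : Summable F := by
    refine summable_of_hasFiniteSupport ?_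
    refine (finite_latticeSum_support e (hasCompactSupport_coneWeight hw hM) hε
      ‖mixedEmbedding K (γ₀ : K)‖).subset fun l hl ↦ ⟨_, le_rfl, hl⟩
  have h3 : HasSum (F ∘ j) (∑' l, F l) :=
    (hj.hasSum_iff fun l hl ↦ Function.notMem_support.1 fun h ↦ hl (hsupp h)).2 hsum.hasSum
  simp only [Function.comp_def, hFj] at h3
  exact h3

/-- Elements of `rayMonoid m` in `b` correspond to ideals in a ray class together with a unit. -/
theorem exists_equiv_rayElement [NeZero m] {b : coprimeIdeals m} {g : RayClassGroup m}
    (hb : RayClassGroup.mk b * g = 1) :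
    ∃ (γ : {I : Ideal (𝓞 K) // RayClassGroup.ofIdeal m I = g} → 𝓞 K)
      (φ : {I : Ideal (𝓞 K) // RayClassGroup.ofIdeal m I = g} × rayUnits m ≃ RayElement b),
      (∀ I, γ I ∈ rayMonoid m ∧ (I : Ideal (𝓞 K)) * b = Ideal.span {γ I}) ∧
      ∀ p, (φ p : 𝓞 K) = ((p.2 : (𝓞 K)ˣ) : 𝓞 K) * γ p.1 := by
  have h0 := fun I : {I : Ideal (𝓞 K) // RayClassGroup.ofIdeal m I = g} ↦
    (RayClassGroup.ofIdeal_eq_iff hb).1 I.2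
  choose γ hγ hγb using h0
  have hspan : ∀ (u : (𝓞 K)ˣ) I, Ideal.span {(u : 𝓞 K) * γ I} = Ideal.span {γ I} := fun u I ↦
    Ideal.span_singleton_mul_left_unit u.isUnit _
  let φ : {I : Ideal (𝓞 K) // RayClassGroup.ofIdeal m I = g} × rayUnits m → RayElement b := fun p ↦
    ⟨((p.2 : (𝓞 K)ˣ) : 𝓞 K) * γ p.1, mul_mem p.2.2 (hγ _), by
      refine Ideal.mul_mem_left _ _ (Ideal.mul_le_right (I := (p.1 : Ideal (𝓞 K))) ?_)
      rw [hγb]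
      exact Ideal.mem_span_singleton_self _⟩
  have hφ : Function.Bijective φ := by
    constructor
    · rintro ⟨I, u⟩ ⟨J, v⟩ h
      have h1 : ((u : (𝓞 K)ˣ) : 𝓞 K) * γ I = ((v : (𝓞 K)ˣ) : 𝓞 K) * γ J := congrArg Subtype.val h
      have h2 : Ideal.span {γ I} = Ideal.span {γ J} := by rw [← hspan u, h1, hspan]
      rw [← hγb, ← hγb] at h2
      obtain rfl : I = J := Subtype.ext (mul_right_cancel₀ b.2.1 h2)
      have h3 := mul_right_cancel₀ (hγ I).1 h1
      rw [Prod.mk.injEq]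
      exact ⟨rfl, Subtype.ext (Units.ext h3)⟩
    · rintro ⟨x, hx, hxb⟩
      obtain ⟨I, hI⟩ := Ideal.dvd_iff_le.2 ((Ideal.span_singleton_le_iff_mem _).2 hxb)
      have hIg := (RayClassGroup.ofIdeal_eq_iff hb).2 ⟨x, hx, by rw [hI, mul_comm]⟩
      obtain ⟨u, hu, hux⟩ := exists_mem_rayUnits (hγ ⟨I, hIg⟩) hx (by rw [← hγb, hI, mul_comm])
      exact ⟨(⟨I, hIg⟩, ⟨u, hu⟩), Subtype.ext hux.symm⟩
  exact ⟨γ, Equiv.ofBijective φ hφ, fun I ↦ ⟨hγ I, hγb I⟩, fun p ↦ rfl⟩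

theorem norm_smul_mixedEmbedding {γ : 𝓞 K} {I J : Ideal (𝓞 K)} (h : I * J = Ideal.span {γ})
    {ε : ℝ} (hε : 0 < ε) :
    mixedEmbedding.norm (ε • mixedEmbedding K (γ : K)) =
      ε ^ Module.finrank ℚ K * Ideal.absNorm J * Ideal.absNorm I := by
  have h1 : (Ideal.absNorm (Ideal.span {γ}) : ℝ) = mixedEmbedding.norm (mixedEmbedding K (γ : K)) := by
    rw [mixedEmbedding.norm_eq_norm, Ideal.absNorm_span_singleton, ← Algebra.coe_norm_int]
    push_cast
    rw [Nat.cast_natAbs]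
    push_cast
    rfl
  rw [mixedEmbedding.norm_smul, abs_of_pos hε, ← h1, ← h, map_mul]
  push_cast
  ring

theorem latticeSum_coneWeight_eq [NeZero m] {b : coprimeIdeals m} {g : RayClassGroup m}
    (hb : RayClassGroup.mk b * g = 1) (hw : IsWeight w) (hM : 0 < M) {q : ℕ}
    (hq : ∀ z : mixedSpace K, (∀ v, 0 < z.1 v) → mixedEmbedding.norm z ≠ 0 →
      HasSum (fun u : rayUnits m ↦ coneWeight w M (mixedEmbedding K ((u : (𝓞 K)ˣ) : K) * z))
        (q * w (mixedEmbedding.norm z)))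
    {γ₀ : 𝓞 K} (hb₀ : γ₀ ∈ (b : Ideal (𝓞 K))) (hm₀ : γ₀ - 1 ∈ m) {ε t : ℝ} (hε : 0 < ε)
    (hεt : ε ^ Module.finrank ℚ K * Ideal.absNorm (b : Ideal (𝓞 K)) = t) (ht : 0 < t) :
    latticeSum (fractionalIdealLatticeBasis K (rayFractionalIdeal (NeZero.ne m) b))
      (coneWeight w M) ε (mixedEmbedding K (γ₀ : K)) =
      q * ∑' n : ℕ, classCount (RayClassGroup.ofIdeal m) g n * w (t * n) := by
  obtain ⟨γ, φ, hγ, hφ⟩ := exists_equiv_rayElement hb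
  have h1 := φ.hasSum_iff.2 (hasSum_rayElement (NeZero.ne m) b hw hM hb₀ hm₀ hε)
  have h2 : ∀ I, HasSum (fun u : rayUnits m ↦
      coneWeight w M (ε • mixedEmbedding K ((φ (I, u) : 𝓞 K) : K)))
      (q * w (t * Ideal.absNorm (I : Ideal (𝓞 K)))) := fun I ↦ by
    have hnorm := norm_smul_mixedEmbedding (hγ I).2 hε
    rw [hεt] at hnorm
    rw [← hnorm]
    have h3 := hq (ε • mixedEmbedding K (γ I : K)) (fun v ↦ ?_) ?_
    · convert h3 using 3 with u
      rw [hφ, mul_smul_comm]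
      push_cast
      rw [map_mul]
    · exact mul_pos hε (mixedEmbedding_pos_iff.2 (hγ I).1.2.2 v)
    · rw [hnorm]
      have hI : (I : Ideal (𝓞 K)) ≠ ⊥ :=
        (RayClassGroup.ofIdeal_ne_zero_iff.1 (by rw [I.2]; exact WithZero.coe_ne_zero)).1
      have : Ideal.absNorm (I : Ideal (𝓞 K)) ≠ 0 := by rwa [Ne, Ideal.absNorm_eq_zero_iff]
      positivity
  have h3 := (h1.prod_fiberwise h2).tsum_eq
  rw [← h3, tsum_mul_left, tsum_classCount (RayClassGroup.ofIdeal m) g (f := fun n ↦ w (t * n))]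
  refine (Set.finite_Iic ⌊1 / t⌋₊).subset fun n hn ↦ ?_
  rw [Set.mem_Iic]
  refine Nat.le_floor ?_
  rw [le_div_iff₀ ht, mul_comm]
  exact (hw.le_of_ne _ hn).2

end RaySum

end

section

open Set Filter Topology NumberField NumberField.InfinitePlace NumberField.mixedEmbedding
open MeasureTheory
open scoped ContDiff Classical

section RayDirichlet

variable {K : Type*} [Field K] [NumberField K] (m : Ideal (𝓞 K)) [NeZero m]

theorem measureReal_rayFractionalIdeal (b : coprimeIdeals m) :
    volume.real (ZSpan.fundamentalDomain
      (fractionalIdealLatticeBasis K (rayFractionalIdeal (NeZero.ne m) b))) =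
      Ideal.absNorm (b : Ideal (𝓞 K)) * (Ideal.absNorm m *
        volume.real (ZSpan.fundamentalDomain (latticeBasis K))) := by
  rw [measureReal_def, volume_fundamentalDomain_fractionalIdealLatticeBasis, ENNReal.toReal_mul,
    ENNReal.toReal_ofReal (Rat.cast_nonneg.2 (FractionalIdeal.absNorm_nonneg _)), ← mul_assoc]
  congr 1
  rw [rayFractionalIdeal, FractionalIdeal.coe_mk0, FractionalIdeal.coeIdeal_absNorm, map_mul]
  push_cast
  rfl

theorem exists_smoothedEquidistribution : ∃ (w : ℝ → ℝ) (κ : ℝ), IsWeight w ∧ 0 < κ ∧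
    SmoothedEquidistribution (RayClassGroup.ofIdeal m) w κ := by
  obtain ⟨w, hw, hws⟩ := exists_isWeight
  obtain ⟨M, hM, hUM⟩ := exists_pow_mem_rayUnits (NeZero.ne m)
  obtain ⟨q, hq0, hq⟩ := exists_hasSum_coneWeight (rayUnits m)
    (fun u hu ↦ mixedEmbedding_pos_iff.2 hu.2.2) hM hUM
  have hq0' : (0 : ℝ) < q := by exact_mod_cast hq0
  set A := ∫ z : mixedSpace K, coneWeight w M z
  have hA : 0 < A := integral_coneWeight_pos hw hws hM
  set V := Ideal.absNorm m * volume.real (ZSpan.fundamentalDomain (latticeBasis K))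
  have hV0 : 0 < volume.real (ZSpan.fundamentalDomain (latticeBasis K)) := by
    rw [measureReal_def]
    exact ENNReal.toReal_pos (ZSpan.measure_fundamentalDomain_ne_zero _)
      (ZSpan.fundamentalDomain_isBounded _).measure_lt_top.ne
  have hV : 0 < V := by
    have : Ideal.absNorm m ≠ 0 := by
      rw [Ne, Ideal.absNorm_eq_zero_iff]
      exact NeZero.ne m
    exact mul_pos (Nat.cast_pos.2 (Nat.pos_of_ne_zero this)) hV0
  refine ⟨w, A / V / q, hw, div_pos (div_pos hA hV) hq0', fun g k ↦ ?_⟩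
  obtain ⟨b, hb⟩ := RayClassGroup.mk_surjective g⁻¹
  have hbg : RayClassGroup.mk b * g = 1 := by rw [hb, inv_mul_cancel]
  obtain ⟨x, hx, y, hy, hxy⟩ := Ideal.isCoprime_iff_exists.1 b.2.2
  have hxm : x - 1 ∈ m := by
    rw [← hxy, sub_add_cancel_left]
    exact m.neg_mem hy
  have hn : Module.finrank ℚ K ≠ 0 := Module.finrank_pos.ne'
  have hB : (1 : ℝ) ≤ ((Ideal.absNorm (b : Ideal (𝓞 K)) : ℕ) : ℝ) := by
    have : Ideal.absNorm (b : Ideal (𝓞 K)) ≠ 0 := by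
      rw [Ne, Ideal.absNorm_eq_zero_iff]
      exact b.2.1
    exact_mod_cast Nat.one_le_iff_ne_zero.2 this
  set B : ℝ := ((Ideal.absNorm (b : Ideal (𝓞 K)) : ℕ) : ℝ)
  have hB0 : 0 < B := by linarith
  set e := fractionalIdealLatticeBasis K (rayFractionalIdeal (NeZero.ne m) b) with he
  have hcard : Fintype.card (Module.Free.ChooseBasisIndex ℤ
      (rayFractionalIdeal (NeZero.ne m) b : FractionalIdeal (nonZeroDivisors (𝓞 K)) K)) =
      Module.finrank ℚ K := by
    rw [← Module.finrank_eq_card_chooseBasisIndex, fractionalIdeal_rank,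
      RingOfIntegers.rank]
  obtain ⟨C, hC⟩ := exists_abs_latticeSum_sub_integral_le e volume
    (hasCompactSupport_coneWeight hw hM) (contDiff_coneWeight hw hws hM) (Module.finrank ℚ K * k)
  refine ⟨C / B ^ k / q, fun t ht ↦ ?_⟩
  set ε : ℝ := (t / B) ^ ((Module.finrank ℚ K : ℝ)⁻¹)
  have htB : 0 < t / B := div_pos ht.1 hB0
  have hε : 0 < ε := Real.rpow_pos_of_pos htB _
  have hεn : ε ^ Module.finrank ℚ K = t / B := Real.rpow_inv_natCast_pow htB.le hn
  have hε1 : ε ≤ 1 := Real.rpow_le_one htB.le ((div_le_one hB0).2 (ht.2.trans hB)) (by positivity)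
  have h1 := hC (mixedEmbedding K (x : K)) ε ⟨hε, hε1⟩
  rw [latticeSum_coneWeight_eq hbg hw hM (hq w) hx hxm hε
    (by rw [hεn]; exact div_mul_cancel₀ t hB0.ne') ht.1, measureReal_rayFractionalIdeal m b, hcard,
    pow_mul, hεn] at h1
  set S := ∑' n : ℕ, classCount (RayClassGroup.ofIdeal m) g n * w (t * n)
  have ht0 := ht.1.ne'
  have h2 : S - A / V / q / t = (q * S - A / (B * V) / (t / B)) / q := by
    field_simp
  have h3 : C / B ^ k / q * t ^ k = C * (t / B) ^ k / q := by
    rw [div_pow]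
    ring
  rw [h2, h3, abs_div, abs_of_pos hq0']
  exact div_le_div_of_nonneg_right h1 hq0'.le

theorem exists_prime_ofIdeal_ne_zero :
    ∃ q : Ideal (𝓞 K), Prime q ∧ RayClassGroup.ofIdeal m q ≠ 0 := by
  obtain ⟨p, hp, hpp⟩ := Nat.exists_infinite_primes (Ideal.absNorm m + 1)
  have hm0 : Ideal.absNorm m ≠ 0 := by
    rw [Ne, Ideal.absNorm_eq_zero_iff]
    exact NeZero.ne m
  have hnt : Ideal.span {(p : 𝓞 K)} ≠ ⊤ := by
    rw [Ne, ← Ideal.absNorm_eq_one_iff, Ideal.absNorm_span_natCast,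
      Nat.pow_eq_one]
    rintro (h | h)
    · exact hpp.ne_one h
    · exact Module.finrank_pos.ne' h
  obtain ⟨q, hq, hpq⟩ := Ideal.exists_le_maximal _ hnt
  have hpq' : (p : 𝓞 K) ∈ q := hpq (Ideal.mem_span_singleton_self _)
  have hq0 : q ≠ ⊥ := by
    rintro rfl
    rw [Ideal.mem_bot, Nat.cast_eq_zero] at hpq'
    exact hpp.ne_zero hpq'
  refine ⟨q, Ideal.prime_of_isPrime hq0 hq.isPrime, RayClassGroup.ofIdeal_ne_zero_iff.2 ⟨hq0, ?_⟩⟩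
  rw [Ideal.isCoprime_iff_sup_eq]
  by_contra h
  have h1 : m ≤ q := by
    rw [hq.eq_of_le h le_sup_left]
    exact le_sup_right
  have h2 : (Ideal.absNorm m : 𝓞 K) ∈ q := h1 (Ideal.absNorm_mem m)
  have h3 : Nat.Coprime (Ideal.absNorm m) p :=
    ((Nat.Prime.coprime_iff_not_dvd hpp).2 fun hd ↦ by
      have := Nat.le_of_dvd (Nat.pos_of_ne_zero hm0) hd
      omega).symm
  refine hq.ne_top ((Ideal.eq_top_iff_one q).2 ?_)
  obtain ⟨u, v, huv⟩ := Nat.isCoprime_iff_coprime.2 h3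
  have h4 : ((u * Ideal.absNorm m + v * p : ℤ) : 𝓞 K) = 1 := by rw [huv, Int.cast_one]
  rw [← h4]
  push_cast
  exact q.add_mem (q.mul_mem_left _ h2) (q.mul_mem_left _ hpq')

theorem infinite_primes_rayClass (g : RayClassGroup m) :
    {P | Prime P ∧ RayClassGroup.ofIdeal m P = g}.Infinite := by
  obtain ⟨w, κ, hw, hκ, H⟩ := exists_smoothedEquidistribution m
  obtain ⟨q, hq, hq'⟩ := exists_prime_ofIdeal_ne_zero m
  exact infinite_primes_of_equidistribution _ hw hκ H hq hq' g

variable {m}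

/-- Dirichlet's theorem for prime elements: there are infinitely many principal primes with a
generator in a given residue class and with given signs at the real embeddings. -/
theorem infinite_prime_elements {α : 𝓞 K} (hα : α ≠ 0) (hαm : IsCoprime (Ideal.span {α}) m) :
    {P : Ideal (𝓞 K) | Prime P ∧ ∃ π, P = Ideal.span {π} ∧ π - α ∈ m ∧
      ∀ σ : K →+* ℝ, 0 < σ (algebraMap (𝓞 K) K α) → 0 < σ (algebraMap (𝓞 K) K π)}.Infinite := by
  have hα' : Ideal.span {α} ∈ coprimeIdeals m := ⟨by simpa using hα, hαm⟩
  refine (infinite_primes_rayClass m (RayClassGroup.mk ⟨_, hα'⟩)).mono ?_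
  rintro P ⟨hP, hPα⟩
  obtain ⟨hPm, h⟩ := RayClassGroup.ofIdeal_eq_coe_iff.1 hPα
  obtain ⟨ρ, hρ, ρ', hρ', h⟩ := RayClassGroup.mk_eq_mk_iff.1 h
  rw [Ideal.span_singleton_mul_span_singleton] at h
  have h1 : ρ' * α ∈ Ideal.span {ρ} * P := by
    rw [h]
    exact Ideal.mem_span_singleton_self _
  obtain ⟨π, hπ, hρπ⟩ := Ideal.mem_span_singleton_mul.1 h1
  refine ⟨hP, π, ?_, ?_, fun σ hσ ↦ ?_⟩
  · rw [← hρπ, ← Ideal.span_singleton_mul_span_singleton] at h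
    exact mul_left_cancel₀ (by simpa using hρ.1) h
  · have h2 : π - α = (ρ' - 1) * α - (ρ - 1) * π := by linear_combination hρπ
    rw [h2]
    exact m.sub_mem (m.mul_mem_right _ hρ'.2.1) (m.mul_mem_right _ hρ.2.1)
  · have h2 := congrArg (fun y : 𝓞 K ↦ σ (algebraMap (𝓞 K) K y)) hρπ
    simp only [map_mul] at h2
    rw [← mul_pos_iff_of_pos_left (hρ.2.2 σ), h2]
    exact mul_pos (hρ'.2.2 σ) hσ

end RayDirichlet

end

section Parameters

variable {K : Type*} [Field K] [NumberField K]

theorem exists_coprime_nonsquare {a : 𝓞 K} (ha : (Ideal.span {a}).IsPrime)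
    (ha0 : Ideal.span {a} ≠ ⊥) (ha8 : 8 ∣ a - 1) :
    ∃ α : 𝓞 K, α ≠ 0 ∧ IsCoprime (Ideal.span {α}) (Ideal.span {2 * a}) ∧ 2 ∣ α - 1 ∧
      ¬ ∃ u : 𝓞 K, α - u ^ 2 ∈ Ideal.span {a} := by
  obtain ⟨k, hk⟩ := ha8
  have hmax : (Ideal.span {a}).IsMaximal := ha.isMaximal ha0
  have hfin : Finite (𝓞 K ⧸ Ideal.span {a}) := Ideal.finiteQuotientOfFreeOfNeBot _ ha0
  let _ : Field (𝓞 K ⧸ Ideal.span {a}) := Ideal.Quotient.field _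
  have h2 : ringChar (𝓞 K ⧸ Ideal.span {a}) ≠ 2 := fun h ↦ by
    have h1 : ((2 : ℕ) : 𝓞 K ⧸ Ideal.span {a}) = 0 := by
      rw [← h]
      exact ringChar.Nat.cast_ringChar
    have h3 : (2 : 𝓞 K) ∈ Ideal.span {a} := by
      rw [← Ideal.Quotient.eq_zero_iff_mem]
      exact (map_natCast (Ideal.Quotient.mk (Ideal.span {a})) 2).trans h1
    refine hmax.ne_top ((Ideal.eq_top_iff_one _).2 ?_)
    have h4 : (1 : 𝓞 K) = a - 4 * k * 2 := by linear_combination -hk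
    rw [h4]
    exact Ideal.sub_mem _ (Ideal.mem_span_singleton_self a) (Ideal.mul_mem_left _ _ h3)
  obtain ⟨y, hy⟩ := FiniteField.exists_nonsquare h2
  obtain ⟨x, rfl⟩ := Ideal.Quotient.mk_surjective y
  have hns : ¬ ∃ u : 𝓞 K, a - 8 * k * x - u ^ 2 ∈ Ideal.span {a} := by
    rintro ⟨u, hu⟩
    refine hy ⟨Ideal.Quotient.mk _ u, ?_⟩
    rw [← map_mul, Ideal.Quotient.eq]
    have h5 : x - u * u = (a - 8 * k * x - u ^ 2) + (x - 1) * a := by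
      linear_combination -x * hk
    rw [h5]
    exact Ideal.add_mem _ hu (Ideal.mul_mem_left _ _ (Ideal.mem_span_singleton_self a))
  have hmem : a - 8 * k * x ∉ Ideal.span {a} := fun h ↦ hns ⟨0, by simpa using h⟩
  have hdvd : (2 : 𝓞 K) ∣ a - 8 * k * x - 1 := ⟨4 * k - 4 * k * x, by linear_combination hk⟩
  refine ⟨a - 8 * k * x, fun h ↦ hmem (by rw [h]; exact Ideal.zero_mem _), ?_, hdvd, hns⟩
  rw [← Ideal.span_singleton_mul_span_singleton]
  refine IsCoprime.mul_right ?_ ?_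
  · obtain ⟨r, hr⟩ := hdvd
    exact Ideal.isCoprime_span_singleton_iff _ _ |>.2 ⟨1, -r, by linear_combination hr⟩
  · rw [Ideal.isCoprime_iff_sup_eq, sup_comm]
    by_contra h
    have := hmax.eq_of_le h le_sup_left
    refine hmem ?_
    rw [this]
    exact Ideal.mem_sup_right (Ideal.mem_span_singleton_self _)

end Parameters

theorem stmt_3 (K : Type*) [Field K] [NumberField K] :
    ∃ a b c e : 𝓞 K,
      (Ideal.span {a} : Ideal (𝓞 K)).IsPrime ∧ Ideal.span {a} ≠ (⊥ : Ideal (𝓞 K)) ∧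
      (Ideal.span {b} : Ideal (𝓞 K)).IsPrime ∧ Ideal.span {b} ≠ (⊥ : Ideal (𝓞 K)) ∧
      (Ideal.span {c} : Ideal (𝓞 K)).IsPrime ∧ Ideal.span {c} ≠ (⊥ : Ideal (𝓞 K)) ∧
      (Ideal.span {e} : Ideal (𝓞 K)).IsPrime ∧ Ideal.span {e} ≠ (⊥ : Ideal (𝓞 K)) ∧
      ([Ideal.span {a}, Ideal.span {b}, Ideal.span {c}, Ideal.span {e}] :
        List (Ideal (𝓞 K))).Pairwise (· ≠ ·) ∧
      ((8 : 𝓞 K) ∣ a - 1) ∧ (∀ σ : K →+* ℝ, 0 < σ (algebraMap (𝓞 K) K a)) ∧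
      ((2 * a) ∣ b - 1) ∧
      ((2 : 𝓞 K) ∣ c - 1) ∧ (¬ ∃ u : 𝓞 K, c - u ^ 2 ∈ (Ideal.span {a} : Ideal (𝓞 K))) ∧
      (¬ ∃ u : 𝓞 K, e - u ^ 2 ∈ (Ideal.span {a} : Ideal (𝓞 K))) := by
  have hone : ∀ m : Ideal (𝓞 K), IsCoprime (Ideal.span {(1 : 𝓞 K)}) m := fun m ↦ by
    rw [Ideal.span_singleton_one, ← Ideal.one_eq_top]
    exact isCoprime_one_left
  have : NeZero (Ideal.span {(8 : 𝓞 K)}) := ⟨by simp⟩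
  obtain ⟨_, hA, a, rfl, ha8, hapos⟩ := (infinite_prime_elements (K := K) (m := Ideal.span {8})
    one_ne_zero (hone _)).nonempty
  have ha8 := Ideal.mem_span_singleton.1 ha8
  have hapos := fun σ ↦ hapos σ (by simp)
  have haI := Ideal.isPrime_of_prime hA
  have ha0 : a ≠ 0 := by simpa using hA.ne_zero
  have : NeZero (Ideal.span {2 * a}) := ⟨by simpa using ha0⟩
  obtain ⟨α, hα0, hα, hα2, hαn⟩ := exists_coprime_nonsquare haI hA.ne_zero ha8
  have hnonsquare : ∀ π : 𝓞 K, π - α ∈ Ideal.span {2 * a} →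
      ¬ ∃ u : 𝓞 K, π - u ^ 2 ∈ Ideal.span {a} := by
    rintro π hπ ⟨u, hu⟩
    refine hαn ⟨u, ?_⟩
    have h1 : π - α ∈ Ideal.span {a} :=
      Ideal.span_singleton_le_span_singleton.2 (Dvd.intro_left 2 rfl) hπ
    have h2 : α - u ^ 2 = (π - u ^ 2) - (π - α) := by ring
    rw [h2]
    exact Ideal.sub_mem _ hu h1
  obtain ⟨_, ⟨hB, b, rfl, hb, _⟩, hab⟩ := ((infinite_prime_elements
    (m := Ideal.span {2 * a}) one_ne_zero (hone _)).sdiff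
      (Set.finite_singleton (Ideal.span {a}))).nonempty
  have hinf := infinite_prime_elements hα0 hα
  obtain ⟨_, ⟨hC, c, rfl, hc, _⟩, habc⟩ := (hinf.sdiff
    (Set.toFinite {Ideal.span {a}, Ideal.span {b}})).nonempty
  obtain ⟨_, ⟨hE, e, rfl, he, _⟩, habce⟩ := (hinf.sdiff
    (Set.toFinite {Ideal.span {a}, Ideal.span {b}, Ideal.span {c}})).nonempty
  refine ⟨a, b, c, e, haI, hA.ne_zero, Ideal.isPrime_of_prime hB, hB.ne_zero,
    Ideal.isPrime_of_prime hC, hC.ne_zero, Ideal.isPrime_of_prime hE, hE.ne_zero, ?_, ha8, hapos,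
    Ideal.mem_span_singleton.1 hb, ?_, hnonsquare c hc, hnonsquare e he⟩
  · simp only [Set.mem_singleton_iff, Set.mem_insert_iff, not_or] at hab habc habce
    simp only [List.pairwise_cons, List.mem_cons, List.not_mem_nil, or_false, forall_eq_or_imp,
      forall_eq, IsEmpty.forall_iff, implies_true, List.Pairwise.nil, and_true]
    exact ⟨⟨Ne.symm hab, Ne.symm habc.1, Ne.symm habce.1⟩, ⟨Ne.symm habc.2, Ne.symm habce.2.1⟩,
      Ne.symm habce.2.2⟩
  · have h1 : c - 1 = (c - α) + (α - 1) := by ring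
    rw [h1]
    exact dvd_add ((Dvd.intro a rfl).trans (Ideal.mem_span_singleton.1 hc)) hα2
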